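/- (Hardy–Littlewood Theorem B) For every fixed a with 1/2 < a < 1 there exist constants K = K(a) > 0 and T₀ = T₀(a) > 0 such that for every T > T₀ there is a finite set F of real numbers contained in the open interval (T, T + T^a) with ζ(1/2 + i t) = 0 for every t ∈ F and with cardinality of F strictly greater than K · T^a. (In other words, the number N₀(T+U) − N₀(T) of zeros of ζ(1/2+it) with T < t < T + U, where U = T^a, exceeds K·U.) -/

import Mathlib

open Filter Topology

namespace HardyLittlewood

open MeasureTheory ComplexConjugate

lemma log_add_one {q : ℂ} (hq : 0 < q.re) :
    Complex.log (q + 1) = Complex.log q + Complex.log (1 + 1 / q) := by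
  have hq0 : q ≠ 0 := by rintro rfl; simp at hq
  have h1 : 0 < (1 + 1 / q).re := by
    simp only [Complex.add_re, Complex.one_re, one_div, Complex.inv_re]
    have : 0 ≤ q.re / Complex.normSq q := div_nonneg hq.le (Complex.normSq_nonneg _)
    linarith
  have h10 : 1 + 1 / q ≠ 0 := by
    intro h
    rw [h] at h1
    simp at h1
  have e : q + 1 = q * (1 + 1 / q) := by field_simp
  have a1 := abs_lt.mp (Complex.abs_arg_lt_pi_div_two_iff.mpr (Or.inl hq))
  have a2 := abs_lt.mp (Complex.abs_arg_lt_pi_div_two_iff.mpr (Or.inl h1))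
  rw [e, Complex.log_mul_eq_add_log_iff hq0 h10]
  constructor <;> linarith [a1.1, a1.2, a2.1, a2.2]

lemma norm_log_one_add_sub_le_sq {x : ℂ} (hx : ‖x‖ ≤ 1 / 2) :
    ‖Complex.log (1 + x) - x‖ ≤ ‖x‖ ^ 2 := by
  refine (Complex.norm_log_one_add_sub_self_le (by linarith)).trans ?_
  have h : (1 - ‖x‖)⁻¹ ≤ 2 := by
    rw [inv_le_comm₀ (by linarith) (by norm_num)]
    linarith
  have := mul_le_mul_of_nonneg_left h (sq_nonneg ‖x‖)
  linarith

/-- The factors of the Euler product of `Γ (z + w) / (Γ z * z ^ w)` are close to `1`. -/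
lemma gamma_factor {q w : ℂ} (hq : 0 < q.re) (hq2 : 2 ≤ ‖q‖) (hw : 2 * ‖w‖ ≤ ‖q‖) :
    ∃ δ : ℂ, ‖δ‖ ≤ (‖w‖ + ‖w‖ ^ 2) / ‖q‖ ^ 2 ∧
      Complex.exp (w * (Complex.log (q + 1) - Complex.log q)) * (q / (q + w)) =
        Complex.exp δ := by
  have hq0 : q ≠ 0 := by rintro rfl; simp at hq
  have hn : 0 < ‖q‖ := norm_pos_iff.mpr hq0
  have h1 : ‖1 / q‖ ≤ 1 / 2 := by
    rw [norm_div, norm_one]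
    exact one_div_le_one_div_of_le (by norm_num) hq2
  have h2 : ‖w / q‖ ≤ 1 / 2 := by
    rw [norm_div, div_le_iff₀ hn]
    linarith
  have h20 : 1 + w / q ≠ 0 := by
    intro h
    have : w / q = -1 := by linear_combination h
    rw [this] at h2
    norm_num at h2
  have hqw : q + w ≠ 0 := by
    intro h
    apply h20
    field_simp
    simpa using h
  refine ⟨w * Complex.log (1 + 1 / q) - Complex.log (1 + w / q), ?_, ?_⟩
  · have e : w * Complex.log (1 + 1 / q) - Complex.log (1 + w / q) =
        w * (Complex.log (1 + 1 / q) - 1 / q) - (Complex.log (1 + w / q) - w / q) := by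
      ring
    rw [e]
    refine (norm_sub_le _ _).trans ?_
    rw [norm_mul]
    have b1 := mul_le_mul_of_nonneg_left (norm_log_one_add_sub_le_sq h1) (norm_nonneg w)
    have b2 := norm_log_one_add_sub_le_sq h2
    rw [norm_div, norm_one] at b1
    rw [norm_div] at b2
    have : (‖w‖ + ‖w‖ ^ 2) / ‖q‖ ^ 2 = ‖w‖ * (1 / ‖q‖) ^ 2 + (‖w‖ / ‖q‖) ^ 2 := by
      field_simp
    rw [this]
    rw [norm_div] at *
    exact add_le_add b1 b2
  · rw [log_add_one hq, add_sub_cancel_left, Complex.exp_sub, Complex.exp_log h20]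
    field_simp

lemma sum_inv_sq_le {y : ℝ} (hy : 2 ≤ y) (n : ℕ) :
    ∑ j ∈ Finset.range n, 1 / (y + j) ^ 2 ≤ 2 / y := by
  have key : ∑ j ∈ Finset.range n, 1 / (y + j) ^ 2 ≤ 1 / (y - 1) - 1 / (y + n - 1) := by
    induction n with
    | zero => simp
    | succ n ih =>
      rw [Finset.sum_range_succ]
      have hn : (0 : ℝ) ≤ n := Nat.cast_nonneg n
      have h1 : 0 < y + n - 1 := by linarith
      have h2 : 0 < y + n := by linarith
      have : 1 / (y + n) ^ 2 ≤ 1 / (y + n - 1) - 1 / (y + (n + 1 : ℕ) - 1) := by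
        push_cast
        have e : y + (n + 1) - 1 = y + n := by ring
        rw [e, div_sub_div _ _ h1.ne' h2.ne', div_le_div_iff₀ (by positivity) (by positivity)]
        nlinarith
      linarith
  have h3 : 0 ≤ 1 / (y + n - 1) := by
    have hn : (0 : ℝ) ≤ n := Nat.cast_nonneg n
    exact one_div_nonneg.mpr (by linarith)
  have h4 : 1 / (y - 1) ≤ 2 / y := by
    rw [div_le_div_iff₀ (by linarith) (by linarith)]
    linarith
  linarith

lemma norm_exp_sub_one_le_exp (x : ℂ) : ‖Complex.exp x - 1‖ ≤ Real.exp ‖x‖ - 1 := by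
  simpa using Complex.norm_exp_sub_sum_le_exp_norm_sub_sum x 1

lemma gammaSeq_ratio {z w : ℂ} (hz : 0 < z.re) (hy : 2 ≤ z.im) (hw : 2 * ‖w‖ ≤ z.im) (n : ℕ) :
    ‖(∏ j ∈ Finset.range n, Complex.exp (w * (Complex.log (z + j + 1) - Complex.log (z + j))) *
      ((z + j) / (z + j + w))) - 1‖ ≤ Real.exp (4 * (‖w‖ + ‖w‖ ^ 2) / z.im) - 1 := by
  have hq : ∀ j : ℕ, 0 < (z + j).re := fun j => by
    simp only [Complex.add_re, Complex.natCast_re]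
    positivity
  have him : ∀ j : ℕ, z.im ≤ ‖z + j‖ := fun j => by
    have := Complex.abs_im_le_norm (z + j)
    simp only [Complex.add_im, Complex.natCast_im, add_zero] at this
    exact (le_abs_self _).trans this
  have hsq : ∀ j : ℕ, (z.im + j) ^ 2 / 2 ≤ ‖z + j‖ ^ 2 := fun j => by
    rw [← Complex.normSq_eq_norm_sq, Complex.normSq_apply]
    simp only [Complex.add_re, Complex.natCast_re, Complex.add_im, Complex.natCast_im, add_zero]
    have : (0 : ℝ) ≤ j := Nat.cast_nonneg j
    nlinarith [sq_nonneg (z.im - j), mul_nonneg hz.le this, sq_nonneg z.re]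
  choose δ hδ1 hδ2 using fun j : ℕ =>
    gamma_factor (w := w) (hq j) (hy.trans (him j)) (hw.trans (him j))
  rw [Finset.prod_congr rfl fun j _ => hδ2 j, ← Complex.exp_sum]
  refine (norm_exp_sub_one_le_exp _).trans ?_
  gcongr
  refine (norm_sum_le _ _).trans ?_
  have hB : 0 ≤ ‖w‖ + ‖w‖ ^ 2 := by positivity
  calc ∑ j ∈ Finset.range n, ‖δ j‖
      ≤ ∑ j ∈ Finset.range n, 2 * (‖w‖ + ‖w‖ ^ 2) * (1 / (z.im + j) ^ 2) := by
        refine Finset.sum_le_sum fun j _ => (hδ1 j).trans ?_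
        have hj : 0 < z.im + j := by positivity
        rw [mul_one_div, div_le_div_iff₀ (by nlinarith [hsq j, sq_pos_of_pos hj]) (by positivity)]
        nlinarith [hsq j, mul_le_mul_of_nonneg_left (hsq j) hB]
    _ ≤ 2 * (‖w‖ + ‖w‖ ^ 2) * (2 / z.im) := by
        rw [← Finset.mul_sum]
        exact mul_le_mul_of_nonneg_left (sum_inv_sq_le hy n) (by positivity)
    _ = 4 * (‖w‖ + ‖w‖ ^ 2) / z.im := by ring

/-- A form of Stirling's formula: `Γ (z + w) / Γ z` is close to `z ^ w`. -/
theorem gamma_ratio {z w : ℂ} (hz : 0 < z.re) (hy : 2 ≤ z.im) (hw : 2 * ‖w‖ ≤ z.im) :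
    ‖Complex.Gamma (z + w) / Complex.Gamma z * Complex.exp (-(w * Complex.log z)) - 1‖ ≤
      Real.exp (4 * (‖w‖ + ‖w‖ ^ 2) / z.im) - 1 := by
  have hG : Complex.Gamma z ≠ 0 := Complex.Gamma_ne_zero_of_re_pos hz
  have hl := ((Complex.GammaSeq_tendsto_Gamma (z + w)).div
    (Complex.GammaSeq_tendsto_Gamma z) hG).mul_const (Complex.exp (-(w * Complex.log z)))
  have him : ∀ j : ℕ, z.im ≤ ‖z + j‖ := fun j => by
    have := Complex.abs_im_le_norm (z + j)
    simp only [Complex.add_im, Complex.natCast_im, add_zero] at this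
    exact (le_abs_self _).trans this
  have hne : ∀ j : ℕ, z + j ≠ 0 := fun j => by
    rw [← norm_pos_iff]
    linarith [him j]
  have hnew : ∀ j : ℕ, z + j + w ≠ 0 := fun j h => by
    have : ‖z + j‖ = ‖w‖ := by
      rw [eq_neg_of_add_eq_zero_left h, norm_neg]
    linarith [him j, norm_nonneg w]
  -- the correction from `n ^ w` to `(z + n + 1) ^ w` disappears in the limit
  have hcorr : Tendsto (fun n : ℕ => Complex.exp (w * (Complex.log (z + (n + 1 : ℕ)) -
      Complex.log (n : ℂ)))) atTop (𝓝 1) := by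
    have h0 : Tendsto (fun n : ℕ => (1 : ℂ) + (z + 1) / n) atTop (𝓝 (1 + 0)) := by
      refine tendsto_const_nhds.add ?_
      exact tendsto_const_div_atTop_nhds_zero_nat (z + 1)
    rw [add_zero] at h0
    have h1 := (continuousAt_clog (x := 1) (by simp)).tendsto.comp h0
    rw [Complex.log_one] at h1
    have h2 := (Complex.continuous_exp.tendsto 0).comp (by simpa using h1.const_mul w)
    rw [Complex.exp_zero] at h2
    refine h2.congr' ?_
    filter_upwards [eventually_gt_atTop 0] with n hn
    have hn' : (0 : ℝ) < n := Nat.cast_pos.mpr hn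
    have hn0 : (n : ℂ) ≠ 0 := by exact_mod_cast hn.ne'
    simp only [Function.comp_apply]
    have e : z + (n + 1 : ℕ) = ((n : ℝ) : ℂ) * (1 + (z + 1) / n) := by
      push_cast
      field_simp
      ring
    have hx : (1 + (z + 1) / (n : ℂ)) ≠ 0 := by
      intro h
      rw [h, mul_zero] at e
      exact hne _ e
    rw [e, Complex.log_ofReal_mul hn' hx]
    congr 2
    rw [show (n : ℂ) = ((n : ℝ) : ℂ) by simp, ← Complex.ofReal_log hn'.le]
    ring
  have hl' := hl.mul hcorr
  rw [mul_one] at hl'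
  have hl'' := ((hl'.sub_const 1).norm)
  refine le_of_tendsto hl'' ?_
  filter_upwards [eventually_gt_atTop 0] with n hn
  refine le_of_eq_of_le ?_ (gammaSeq_ratio hz hy hw (n + 1))
  congr 2
  have hn0 : (n : ℂ) ≠ 0 := by exact_mod_cast hn.ne'
  rw [Finset.prod_mul_distrib, ← Complex.exp_sum, ← Finset.mul_sum, Finset.prod_div_distrib]
  have tel : ∑ j ∈ Finset.range (n + 1), (Complex.log (z + j + 1) - Complex.log (z + j)) =
      Complex.log (z + (n + 1 : ℕ)) - Complex.log z := by
    have := Finset.sum_range_sub (fun j : ℕ => Complex.log (z + j)) (n + 1)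
    simp only [Nat.cast_zero, add_zero] at this
    rw [← this]
    refine Finset.sum_congr rfl fun j _ => ?_
    push_cast
    rw [add_assoc]
  rw [tel]
  have hP1 : ∏ j ∈ Finset.range (n + 1), (z + j) ≠ 0 := Finset.prod_ne_zero_iff.mpr fun j _ => hne j
  have hP2 : ∏ j ∈ Finset.range (n + 1), (z + j + w) ≠ 0 :=
    Finset.prod_ne_zero_iff.mpr fun j _ => hnew j
  have hP3 : ∏ j ∈ Finset.range (n + 1), (z + w + j) =
      ∏ j ∈ Finset.range (n + 1), (z + j + w) := Finset.prod_congr rfl fun j _ => by ring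
  have hf : ((n.factorial : ℕ) : ℂ) ≠ 0 := by exact_mod_cast n.factorial_ne_zero
  have hnz : (n : ℂ) ^ z ≠ 0 := by simp [Complex.cpow_eq_zero_iff, hn0]
  simp only [Pi.div_apply]
  rw [Complex.GammaSeq, Complex.GammaSeq, hP3, Complex.cpow_add _ _ hn0,
    Complex.cpow_def_of_ne_zero hn0 w]
  rw [mul_sub w, mul_sub w, Complex.exp_sub, Complex.exp_sub, Complex.exp_neg]
  rw [mul_comm w (Complex.log (n : ℂ))]
  have x1 := Complex.exp_ne_zero (w * Complex.log z)
  have x2 := Complex.exp_ne_zero (Complex.log (n : ℂ) * w)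
  field_simp

lemma norm_exp_line (c y : ℝ) (β : ℂ) :
    ‖Complex.exp (((c : ℂ) + y * Complex.I) ^ 2 + β * (c + y * Complex.I))‖ =
      Real.exp (c ^ 2 + β.re * c - β.im * y - y ^ 2) := by
  rw [Complex.norm_exp]
  congr 1
  simp [pow_two]
  ring

lemma norm_exp_sq_line (c y : ℝ) :
    ‖Complex.exp (((c : ℂ) + y * Complex.I) ^ 2)‖ = Real.exp (c ^ 2 - y ^ 2) := by
  have := norm_exp_line c y 0
  simpa using this

lemma exp_sub_sq_le (B A y : ℝ) :
    Real.exp (B + A * |y| - y ^ 2) ≤ Real.exp (B + A ^ 2 / 2) * Real.exp (-(1 / 2) * y ^ 2) := by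
  rw [← Real.exp_add]
  gcongr
  nlinarith [sq_nonneg (|y| - A), sq_abs y]

lemma integrable_gauss : Integrable fun y : ℝ => Real.exp (-(1 / 2) * y ^ 2) :=
  integrable_exp_neg_mul_sq (by norm_num)

lemma line_ne_zero {c : ℝ} (hc : c ≠ 0) (y : ℝ) : (c : ℂ) + y * Complex.I ≠ 0 := by
  intro h
  apply hc
  simpa using congrArg Complex.re h

lemma abs_le_norm_line (c y : ℝ) : |c| ≤ ‖(c : ℂ) + y * Complex.I‖ := by
  simpa using Complex.abs_re_le_norm ((c : ℂ) + y * Complex.I)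

lemma continuous_line (c : ℝ) : Continuous fun y : ℝ => (c : ℂ) + y * Complex.I := by
  fun_prop

/-- A continuous function with exponential growth is integrable on a vertical line against
`exp (w ^ 2) / w`. -/
lemma integrable_line {c : ℝ} (hc : c ≠ 0) {g : ℝ → ℂ} (hg : Continuous g) {M A : ℝ}
    (hM : ∀ y, ‖g y‖ ≤ M * Real.exp (A * |y|)) :
    Integrable fun y : ℝ => g y * Complex.exp (((c : ℂ) + y * Complex.I) ^ 2) /
      (c + y * Complex.I) := by
  refine Integrable.mono' (integrable_gauss.const_mul (M * Real.exp (c ^ 2 + A ^ 2 / 2) / |c|)) ?_ ?_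
  · refine Continuous.aestronglyMeasurable (Continuous.div ?_ (continuous_line c) (line_ne_zero hc))
    exact hg.mul (Complex.continuous_exp.comp ((continuous_line c).pow 2))
  · refine Eventually.of_forall fun y => ?_
    have hc' : 0 < |c| := abs_pos.mpr hc
    have hM0 : 0 ≤ M := by
      have := (norm_nonneg _).trans (hM 0)
      simpa using this
    rw [norm_div, norm_mul, norm_exp_sq_line]
    calc ‖g y‖ * Real.exp (c ^ 2 - y ^ 2) / ‖(c : ℂ) + y * Complex.I‖
        ≤ M * Real.exp (A * |y|) * Real.exp (c ^ 2 - y ^ 2) / |c| := by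
          gcongr
          · exact hM y
          · exact abs_le_norm_line c y
      _ = M * Real.exp (c ^ 2 + A * |y| - y ^ 2) / |c| := by
          rw [mul_assoc, ← Real.exp_add]
          ring_nf
      _ ≤ M * (Real.exp (c ^ 2 + A ^ 2 / 2) * Real.exp (-(1 / 2) * y ^ 2)) / |c| := by
          gcongr
          exact exp_sub_sq_le _ _ _
      _ = _ := by ring

/-- The integral of `exp (w ^ 2 + β w) / w` over a vertical line as an incomplete Gaussian
integral. -/
lemma integral_exp_div_line {c : ℝ} (hc : 0 < c) (β : ℂ) :
    ∫ y : ℝ, Complex.exp (((c : ℂ) + y * Complex.I) ^ 2 + β * (c + y * Complex.I)) /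
      (c + y * Complex.I) =
    (Real.sqrt Real.pi : ℂ) * ∫ l in Set.Ioi (0 : ℝ), Complex.exp (-((l - β) ^ 2 / 4)) := by
  have h1 : ∀ y : ℝ, Complex.exp (((c : ℂ) + y * Complex.I) ^ 2 + β * (c + y * Complex.I)) /
      (c + y * Complex.I) = ∫ l in Set.Ioi (0 : ℝ),
        Complex.exp (((c : ℂ) + y * Complex.I) ^ 2 + β * (c + y * Complex.I)) *
          Complex.exp (-(c + y * Complex.I) * l) := by
    intro y
    rw [integral_const_mul, integral_exp_mul_complex_Ioi (by simpa using hc)]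
    have := line_ne_zero hc.ne' y
    simp only [Complex.ofReal_zero, mul_zero, Complex.exp_zero]
    field_simp
  simp_rw [h1]
  rw [integral_integral_swap]
  · rw [← integral_const_mul]
    refine integral_congr_ae (Eventually.of_forall fun l => ?_)
    simp only
    have e : ∀ y : ℝ, Complex.exp (((c : ℂ) + y * Complex.I) ^ 2 + β * (c + y * Complex.I)) *
          Complex.exp (-(c + y * Complex.I) * l) =
        Complex.exp ((-1 : ℂ) * y ^ 2 + (Complex.I * (2 * c + β - l)) * y +
          (c ^ 2 + (β - l) * c)) := by
      intro y
      rw [← Complex.exp_add]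
      congr 1
      linear_combination (y : ℂ) ^ 2 * Complex.I_sq
    simp_rw [e]
    rw [integral_cexp_quadratic (by simp)]
    congr 1
    · rw [neg_neg, div_one, Real.sqrt_eq_rpow, Complex.ofReal_cpow Real.pi_pos.le]
      norm_num
    · congr 1
      linear_combination ((2 * c + β - l) ^ 2 / 4) * Complex.I_sq
  · have hi : Integrable (fun p : ℝ × ℝ => Real.exp (c ^ 2 + β.re * c - β.im * p.1 - p.1 ^ 2) *
        Real.exp (-c * p.2)) (volume.prod (volume.restrict (Set.Ioi 0))) := by
      refine Integrable.mul_prod (f := fun y => Real.exp (c ^ 2 + β.re * c - β.im * y - y ^ 2))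
        (g := fun l => Real.exp (-c * l)) ?_ ?_
      · refine Integrable.mono' (integrable_gauss.const_mul
          (Real.exp (c ^ 2 + β.re * c + |β.im| ^ 2 / 2))) (by fun_prop)
          (Eventually.of_forall fun y => ?_)
        rw [Real.norm_of_nonneg (Real.exp_pos _).le]
        refine le_trans ?_ (exp_sub_sq_le _ _ _)
        gcongr
        have := neg_abs_le (β.im * y)
        rw [abs_mul] at this
        linarith
      · exact (exp_neg_integrableOn_Ioi 0 hc)
    refine hi.mono ?_ (Eventually.of_forall fun p => ?_)
    · simp only [Function.uncurry_def]
      fun_prop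
    · simp only [Function.uncurry_def]
      rw [norm_mul, norm_exp_line, norm_mul, Real.norm_of_nonneg (Real.exp_pos _).le,
        Real.norm_of_nonneg (Real.exp_pos _).le, Complex.norm_exp]
      simp

lemma integral_exp_sq_div_line {c : ℝ} (hc : 0 < c) :
    ∫ y : ℝ, Complex.exp (((c : ℂ) + y * Complex.I) ^ 2) / (c + y * Complex.I) = Real.pi := by
  have := integral_exp_div_line hc 0
  simp only [zero_mul, add_zero, sub_zero] at this
  rw [this]
  have h2 : ∀ l : ℝ, Complex.exp (-((l : ℂ) ^ 2 / 4)) =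
      ((Real.exp (-(1 / 4) * l ^ 2) : ℝ) : ℂ) := by
    intro l
    push_cast
    congr 1
    ring
  simp_rw [h2]
  rw [integral_complex_ofReal, integral_gaussian_Ioi, ← Complex.ofReal_mul]
  congr 1
  rw [show Real.pi / (1 / 4) = 2 ^ 2 * Real.pi by ring, Real.sqrt_mul (by norm_num),
    Real.sqrt_sq (by norm_num)]
  have := Real.mul_self_sqrt Real.pi_pos.le
  linarith

/-- Shifting a vertical line of integration. -/
lemma integral_line_shift {c : ℝ} (hc : 0 < c) {g : ℂ → ℂ} (hg : Differentiable ℂ g) {M : ℝ}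
    (hM : ∀ w : ℂ, |w.re| ≤ c → 1 ≤ |w.im| → ‖g w‖ ≤ M * Real.exp (-(1 / 2) * w.im ^ 2)) :
    ∫ y : ℝ, g (c + y * Complex.I) = ∫ y : ℝ, g (((-c : ℝ) : ℂ) + y * Complex.I) := by
  have hint : ∀ b : ℝ, |b| ≤ c → Integrable fun y : ℝ => g (b + y * Complex.I) := by
    intro b hb
    have hcont : Continuous fun y : ℝ => g (b + y * Complex.I) :=
      hg.continuous.comp (continuous_line b)
    obtain ⟨K, hK⟩ := (isCompact_Icc (a := (-1 : ℝ)) (b := 1)).exists_bound_of_continuousOn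
      hcont.continuousOn
    refine Integrable.mono' (integrable_gauss.const_mul (|M| + |K| * Real.exp (1 / 2)))
      hcont.aestronglyMeasurable (Eventually.of_forall fun y => ?_)
    rw [add_mul]
    rcases le_total 1 |y| with h | h
    · have := hM (b + y * Complex.I) (by simpa using hb) (by simpa using h)
      simp only [Complex.add_im, Complex.ofReal_im, Complex.mul_im, Complex.ofReal_re,
        Complex.I_im, Complex.I_re, mul_one, mul_zero, add_zero, zero_add] at this
      have h2 : M * Real.exp (-(1 / 2) * y ^ 2) ≤ |M| * Real.exp (-(1 / 2) * y ^ 2) := by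
        gcongr
        exact le_abs_self M
      have h3 : 0 ≤ |K| * Real.exp (1 / 2) * Real.exp (-(1 / 2) * y ^ 2) := by positivity
      linarith
    · have h1 := hK y (abs_le.mp h)
      have h2 : |K| ≤ |K| * Real.exp (1 / 2) * Real.exp (-(1 / 2) * y ^ 2) := by
        rw [mul_assoc, ← Real.exp_add]
        refine le_mul_of_one_le_right (abs_nonneg _) (Real.one_le_exp ?_)
        nlinarith [sq_abs y, abs_nonneg y]
      have h3 : 0 ≤ |M| * Real.exp (-(1 / 2) * y ^ 2) := by positivity
      linarith [le_abs_self K]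
  have hedge : ∀ σ : ℝ → ℝ, (∀ R, |σ R| = |R|) →
      Tendsto (fun R : ℝ => ∫ x in (-c)..c, g (x + (σ R : ℝ) * Complex.I)) atTop (𝓝 0) := by
    intro σ hσ
    have hlim : Tendsto (fun R : ℝ => M * Real.exp (-(1 / 2) * R) * |c - -c|) atTop (𝓝 0) := by
      have h1 : Tendsto (fun R : ℝ => -(1 / 2) * R) atTop atBot :=
        tendsto_id.const_mul_atTop_of_neg (by norm_num)
      simpa using ((Real.tendsto_exp_atBot.comp h1).const_mul M).mul_const |c - -c|
    refine squeeze_zero_norm' ?_ hlim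
    filter_upwards [eventually_ge_atTop 1] with R hR
    refine intervalIntegral.norm_integral_le_of_norm_le_const fun x hx => ?_
    rw [Set.uIoc_of_le (by linarith)] at hx
    have hσR : |σ R| = R := by rw [hσ, abs_of_nonneg (by linarith)]
    have := hM (x + (σ R : ℝ) * Complex.I)
      (by simpa using abs_le.mpr ⟨hx.1.le, hx.2⟩) (by simpa [hσR] using hR)
    have hM0 : 0 ≤ M := by
      have := (norm_nonneg _).trans this
      exact nonneg_of_mul_nonneg_left this (Real.exp_pos _)
    refine this.trans (mul_le_mul_of_nonneg_left (Real.exp_le_exp.mpr ?_) hM0)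
    have e : ((x : ℂ) + (σ R : ℝ) * Complex.I).im = σ R := by simp
    rw [e]
    nlinarith [sq_abs (σ R)]
  have hside : ∀ b : ℝ, |b| ≤ c → Tendsto (fun R : ℝ => ∫ y in (-R)..R, g (b + y * Complex.I))
      atTop (𝓝 (∫ y : ℝ, g (b + y * Complex.I))) := fun b hb =>
    intervalIntegral_tendsto_integral (hint b hb) tendsto_neg_atTop_atBot tendsto_id
  have hrect : ∀ R : ℝ, (∫ x in (-c)..c, g (x + (-R : ℝ) * Complex.I)) -
      (∫ x in (-c)..c, g (x + (R : ℝ) * Complex.I)) +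
      Complex.I • (∫ y in (-R)..R, g (c + y * Complex.I)) -
      Complex.I • (∫ y in (-R)..R, g (((-c : ℝ) : ℂ) + y * Complex.I)) = 0 := by
    intro R
    have := Complex.integral_boundary_rect_eq_zero_of_differentiableOn g ⟨-c, -R⟩ ⟨c, R⟩
      hg.differentiableOn
    simpa using this
  have hlim := (((hedge (fun R => -R) (fun R => abs_neg R)).sub (hedge id (fun R => rfl))).add
    ((hside c (abs_of_pos hc).le).const_smul Complex.I)).sub
    ((hside (-c) (by simp [abs_of_pos hc])).const_smul Complex.I)
  have h0 := tendsto_nhds_unique hlim (tendsto_const_nhds.congr fun R => (hrect R).symm)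
  simp only [sub_zero, zero_add, smul_eq_mul, ← mul_sub, mul_eq_zero, Complex.I_ne_zero,
    false_or] at h0
  exact sub_eq_zero.mp h0

/-- Cauchy's formula for a function of moderate growth in a strip, with a Gaussian weight. -/
theorem cauchy_strip {c : ℝ} (hc : 0 < c) {f : ℂ → ℂ} (hf : Differentiable ℂ f) {M A : ℝ}
    (hM : ∀ w : ℂ, |w.re| ≤ c → ‖f w‖ ≤ M * Real.exp (A * |w.im|)) :
    (∫ y : ℝ, f (c + y * Complex.I) * Complex.exp (((c : ℂ) + y * Complex.I) ^ 2) /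
      (c + y * Complex.I)) +
    (∫ y : ℝ, f (-(c + y * Complex.I)) * Complex.exp (((c : ℂ) + y * Complex.I) ^ 2) /
      (c + y * Complex.I)) = 2 * Real.pi * f 0 := by
  set h : ℂ → ℂ := fun w => (f w - f 0) * Complex.exp (w ^ 2) with hh
  have hhd : Differentiable ℂ h := by
    simp only [hh]
    fun_prop
  have hh0 : h 0 = 0 := by simp [hh]
  have hd : Differentiable ℂ (dslope h 0) := by
    rw [← differentiableOn_univ, Complex.differentiableOn_dslope univ_mem]
    exact hhd.differentiableOn
  have hds : ∀ w : ℂ, w ≠ 0 → dslope h 0 w = (f w - f 0) * Complex.exp (w ^ 2) / w := by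
    intro w hw
    rw [dslope_of_ne _ hw, slope_def_field, hh0]
    simp [hh]
  have hM0 : 0 ≤ M := by
    have := (norm_nonneg _).trans (hM 0 (by simpa using hc.le))
    simpa using this
  have hbd : ∀ w : ℂ, |w.re| ≤ c → 1 ≤ |w.im| → ‖dslope h 0 w‖ ≤
      (M * Real.exp (c ^ 2 + A ^ 2 / 2) + ‖f 0‖ * Real.exp (c ^ 2)) *
        Real.exp (-(1 / 2) * w.im ^ 2) := by
    intro w hw hw1
    have hwn : 1 ≤ ‖w‖ := hw1.trans (Complex.abs_im_le_norm w)
    have hw0 : w ≠ 0 := norm_pos_iff.mp (by linarith)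
    rw [hds w hw0, norm_div, norm_mul]
    have he : ‖Complex.exp (w ^ 2)‖ ≤ Real.exp (c ^ 2 - w.im ^ 2) := by
      have := norm_exp_sq_line w.re w.im
      rw [Complex.re_add_im] at this
      rw [this]
      exact Real.exp_le_exp.mpr (sub_le_sub_right
        (sq_le_sq' (by linarith [(abs_le.mp hw).1]) (abs_le.mp hw).2) _)
    calc ‖f w - f 0‖ * ‖Complex.exp (w ^ 2)‖ / ‖w‖
        ≤ ‖f w - f 0‖ * ‖Complex.exp (w ^ 2)‖ := div_le_self (by positivity) hwn
      _ ≤ (M * Real.exp (A * |w.im|) + ‖f 0‖) * Real.exp (c ^ 2 - w.im ^ 2) := by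
          gcongr
          exact (norm_sub_le _ _).trans (by linarith [hM w hw])
      _ = M * Real.exp (c ^ 2 + A * |w.im| - w.im ^ 2) + ‖f 0‖ * Real.exp (c ^ 2 - w.im ^ 2) := by
          rw [add_mul, mul_assoc, ← Real.exp_add]
          ring_nf
      _ ≤ M * (Real.exp (c ^ 2 + A ^ 2 / 2) * Real.exp (-(1 / 2) * w.im ^ 2)) +
            ‖f 0‖ * (Real.exp (c ^ 2) * Real.exp (-(1 / 2) * w.im ^ 2)) := by
          gcongr
          · exact exp_sub_sq_le _ _ _
          · rw [← Real.exp_add]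
            gcongr
            nlinarith [sq_nonneg w.im]
      _ = _ := by ring
  have hshift := integral_line_shift hc hd hbd
  have hlin : ∀ w : ℂ, w ≠ 0 → dslope h 0 w =
      f w * Complex.exp (w ^ 2) / w - f 0 * (Complex.exp (w ^ 2) / w) := by
    intro w hw
    rw [hds w hw]
    ring
  have i1 : Integrable fun y : ℝ => f (c + y * Complex.I) *
      Complex.exp (((c : ℂ) + y * Complex.I) ^ 2) / (c + y * Complex.I) :=
    integrable_line hc.ne' (g := fun y => f (c + y * Complex.I))
      (hf.continuous.comp (continuous_line c)) (M := M) (A := A) fun y => by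
        simpa using hM (c + y * Complex.I) (by simp [abs_of_pos hc])
  have i2 : Integrable fun y : ℝ => f (-(c + y * Complex.I)) *
      Complex.exp (((c : ℂ) + y * Complex.I) ^ 2) / (c + y * Complex.I) :=
    integrable_line hc.ne' (g := fun y => f (-(c + y * Complex.I)))
      (hf.continuous.comp (continuous_line c).neg) (M := M) (A := A) fun y => by
        simpa using hM (-(c + y * Complex.I)) (by simp [abs_of_pos hc])
  have i3 : Integrable fun y : ℝ => Complex.exp (((c : ℂ) + y * Complex.I) ^ 2) /
      (c + y * Complex.I) := by
    simpa using integrable_line hc.ne' (g := fun _ => 1) continuous_const (M := 1) (A := 0)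
      (by simp)
  have e1 : ∫ y : ℝ, dslope h 0 (c + y * Complex.I) =
      (∫ y : ℝ, f (c + y * Complex.I) * Complex.exp (((c : ℂ) + y * Complex.I) ^ 2) /
      (c + y * Complex.I)) - f 0 * Real.pi := by
    simp_rw [hlin _ (line_ne_zero hc.ne' _)]
    rw [integral_sub i1 (i3.const_mul _), integral_const_mul, integral_exp_sq_div_line hc]
  have e2 : ∫ y : ℝ, dslope h 0 (((-c : ℝ) : ℂ) + y * Complex.I) =
      -(∫ y : ℝ, f (-(c + y * Complex.I)) * Complex.exp (((c : ℂ) + y * Complex.I) ^ 2) /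
      (c + y * Complex.I)) + f 0 * Real.pi := by
    rw [← integral_neg_eq_self]
    have : ∀ y : ℝ, dslope h 0 (((-c : ℝ) : ℂ) + (-y : ℝ) * Complex.I) =
        f 0 * (Complex.exp (((c : ℂ) + y * Complex.I) ^ 2) / (c + y * Complex.I)) -
        f (-(c + y * Complex.I)) * Complex.exp (((c : ℂ) + y * Complex.I) ^ 2) /
          (c + y * Complex.I) := by
      intro y
      have h0 := line_ne_zero hc.ne' y
      have e : (((-c : ℝ) : ℂ) + (-y : ℝ) * Complex.I) = -((c : ℂ) + y * Complex.I) := by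
        push_cast
        ring
      rw [e, hlin _ (neg_ne_zero.mpr h0), neg_sq]
      field_simp
      ring
    simp_rw [this]
    rw [integral_sub (i3.const_mul _) i2, integral_const_mul, integral_exp_sq_div_line hc]
    ring
  rw [e1, e2] at hshift
  linear_combination hshift

/-- The entire part of the completed zeta function is the Mellin transform of a real function. -/
theorem exists_real_mellin : ∃ φ : ℝ → ℝ, (∀ s, MellinConvergent (fun x => (φ x : ℂ)) s) ∧
    ∀ s, completedRiemannZeta₀ s = mellin (fun x => (φ x : ℂ)) (s / 2) / 2 := by
  set P := HurwitzZeta.hurwitzEvenFEPair 0 with hP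
  have hconv : ∀ s, MellinConvergent P.f_modif s := fun s =>
    (P.isStrongFEPair_toStrongFEPair.hasMellin s).1
  have hre : ∀ x, ((P.f_modif x).re : ℂ) = P.f_modif x := by
    intro x
    rw [← Complex.conj_eq_iff_re]
    simp only [WeakFEPair.f_modif, Pi.add_apply, map_add, Set.indicator]
    simp only [hP, HurwitzZeta.hurwitzEvenFEPair]
    split_ifs <;> simp
  have hfun : (fun x => ((P.f_modif x).re : ℂ)) = P.f_modif := funext hre
  exact ⟨fun x => (P.f_modif x).re, fun s => by rw [hfun]; exact hconv s,
    fun s => by rw [hfun]; rfl⟩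

theorem mellin_conj (φ : ℝ → ℝ) (s : ℂ) :
    mellin (fun x => (φ x : ℂ)) (conj s) = conj (mellin (fun x => (φ x : ℂ)) s) := by
  unfold mellin
  rw [← integral_conj]
  refine setIntegral_congr_fun measurableSet_Ioi fun x hx => ?_
  have hx0 : (0 : ℝ) < x := hx
  have h : ((x : ℂ) ^ (conj s - 1)) = conj ((x : ℂ) ^ (s - 1)) := by
    have := Complex.cpow_conj (x : ℂ) (s - 1)
      (by rw [Complex.arg_ofReal_of_nonneg hx0.le]; exact Real.pi_pos.ne)
    simpa using this
  simp [h]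

theorem norm_mellin_le {φ : ℝ → ℝ} (hφ : ∀ s, MellinConvergent (fun x => (φ x : ℂ)) s) (a b : ℝ) :
    ∃ M, ∀ s : ℂ, a ≤ s.re → s.re ≤ b → ‖mellin (fun x => (φ x : ℂ)) s‖ ≤ M := by
  have hi : ∀ c : ℝ, IntegrableOn (fun x : ℝ => x ^ (c - 1) * |φ x|) (Set.Ioi 0) := by
    intro c
    have h : IntegrableOn _ (Set.Ioi (0 : ℝ)) := Integrable.norm (hφ c)
    refine h.congr_fun (fun x hx => ?_) measurableSet_Ioi
    have hx0 : (0 : ℝ) < x := hx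
    simp [Complex.norm_cpow_eq_rpow_re_of_pos hx0]
  refine ⟨∫ x in Set.Ioi 0, (x ^ (a - 1) * |φ x| + x ^ (b - 1) * |φ x|), fun s ha hb => ?_⟩
  unfold mellin
  refine norm_integral_le_of_norm_le ((hi a).add (hi b)) ?_
  refine (ae_restrict_iff' measurableSet_Ioi).mpr (Eventually.of_forall fun x hx => ?_)
  have hx0 : (0 : ℝ) < x := hx
  rw [norm_smul, Complex.norm_cpow_eq_rpow_re_of_pos hx0, Complex.norm_real, Real.norm_eq_abs,
    ← add_mul]
  gcongr
  simp only [Complex.sub_re, Complex.one_re]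
  rcases le_total 1 x with h | h
  · have := Real.rpow_le_rpow_of_exponent_le h (show s.re - 1 ≤ b - 1 by linarith)
    have := Real.rpow_nonneg hx0.le (a - 1)
    linarith
  · have := Real.rpow_le_rpow_of_exponent_ge hx0 h (show a - 1 ≤ s.re - 1 by linarith)
    have := Real.rpow_nonneg hx0.le (b - 1)
    linarith

theorem completedZeta₀_conj (s : ℂ) :
    completedRiemannZeta₀ (conj s) = conj (completedRiemannZeta₀ s) := by
  obtain ⟨φ, -, h⟩ := exists_real_mellin
  rw [h, h, map_div₀, ← mellin_conj, map_div₀, map_ofNat]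

theorem norm_completedZeta₀_le (a b : ℝ) :
    ∃ M, ∀ s : ℂ, a ≤ s.re → s.re ≤ b → ‖completedRiemannZeta₀ s‖ ≤ M := by
  obtain ⟨φ, hc, h⟩ := exists_real_mellin
  obtain ⟨M, hM⟩ := norm_mellin_le hc (a / 2) (b / 2)
  refine ⟨M / 2, fun s ha hb => ?_⟩
  rw [h, norm_div, Complex.norm_ofNat]
  have : (s / 2).re = s.re / 2 := by simp
  have := hM (s / 2) (by linarith) (by linarith)
  linarith

/-- The entire function `s (s - 1) Λ(s)`. -/
noncomputable def xi (s : ℂ) : ℂ := s * (s - 1) * completedRiemannZeta₀ s + 1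

theorem differentiable_xi : Differentiable ℂ xi := by
  unfold xi
  have := differentiable_completedZeta₀
  fun_prop

theorem xi_one_sub (s : ℂ) : xi (1 - s) = xi s := by
  unfold xi
  rw [completedRiemannZeta₀_one_sub]
  ring

theorem xi_conj (s : ℂ) : xi (conj s) = conj (xi s) := by
  unfold xi
  rw [completedZeta₀_conj]
  simp

theorem xi_eq_completed {s : ℂ} (h0 : s ≠ 0) (h1 : s ≠ 1) :
    xi s = s * (s - 1) * completedRiemannZeta s := by
  unfold xi
  rw [completedRiemannZeta_eq]
  have : (1 : ℂ) - s ≠ 0 := sub_ne_zero.mpr h1.symm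
  field_simp
  ring

theorem xi_eq {s : ℂ} (h0 : 0 < s.re) (h1 : s ≠ 1) :
    xi s = s * (s - 1) * Complex.Gammaℝ s * riemannZeta s := by
  have hs : s ≠ 0 := fun h => by simp [h] at h0
  rw [xi_eq_completed hs h1, riemannZeta_def_of_ne_zero hs]
  have := Complex.Gammaℝ_ne_zero_of_re_pos h0
  field_simp

theorem norm_xi_add_le (s : ℂ) (c : ℝ) :
    ∃ M, ∀ w : ℂ, |w.re| ≤ c → ‖xi (s + w)‖ ≤ M * Real.exp (1 * |w.im|) := by
  obtain ⟨M, hM⟩ := norm_completedZeta₀_le (s.re - c) (s.re + c)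
  refine ⟨2 * (‖s‖ + c + 1) ^ 2 * |M| + 1, fun w hw => ?_⟩
  have hw' := abs_le.mp hw
  have h1 := hM (s + w) (by simp; linarith) (by simp; linarith)
  have hc : 0 ≤ c := (abs_nonneg _).trans hw
  set y := |w.im| with hy
  have hy0 : 0 ≤ y := abs_nonneg _
  have hwn : ‖w‖ ≤ c + y := (Complex.norm_le_abs_re_add_abs_im w).trans (by linarith)
  have ha : ‖s + w‖ ≤ (‖s‖ + c + 1) * (1 + y) := by
    refine (norm_add_le _ _).trans ?_
    nlinarith [norm_nonneg s]
  have hb : ‖s + w - 1‖ ≤ (‖s‖ + c + 1) * (1 + y) := by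
    refine (norm_sub_le _ _).trans ?_
    have := norm_add_le s w
    rw [norm_one]
    nlinarith [norm_nonneg s]
  have he : (1 + y) ^ 2 ≤ 2 * Real.exp (1 * y) := by
    rw [one_mul]
    have := Real.quadratic_le_exp_of_nonneg hy0
    nlinarith
  have he1 : 1 ≤ Real.exp (1 * y) := Real.one_le_exp (by linarith)
  unfold xi
  calc ‖(s + w) * (s + w - 1) * completedRiemannZeta₀ (s + w) + 1‖
      ≤ ‖s + w‖ * ‖s + w - 1‖ * ‖completedRiemannZeta₀ (s + w)‖ + 1 := by
        refine (norm_add_le _ _).trans ?_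
        rw [norm_mul, norm_mul, norm_one]
    _ ≤ ((‖s‖ + c + 1) * (1 + y)) * ((‖s‖ + c + 1) * (1 + y)) * |M| + 1 := by
        gcongr
        exact h1.trans (le_abs_self M)
    _ = (‖s‖ + c + 1) ^ 2 * |M| * (1 + y) ^ 2 + 1 := by ring
    _ ≤ (‖s‖ + c + 1) ^ 2 * |M| * (2 * Real.exp (1 * y)) + Real.exp (1 * y) := by gcongr
    _ = _ := by ring

/-- The point `1/2 + i u` of the critical line. -/
noncomputable def critPt (u : ℝ) : ℂ := 1 / 2 + u * Complex.I

/-- The point `3/5 + i y`, parametrising the line of integration. -/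
noncomputable def linePt (y : ℝ) : ℂ := ((3 / 5 : ℝ) : ℂ) + y * Complex.I

/-- The archimedean factor `s (s - 1) π^{-s/2} Γ(s/2)`. -/
noncomputable def archFactor (s : ℂ) : ℂ := s * (s - 1) * Complex.Gammaℝ s

/-- The phase in the functional equation on the critical line. -/
noncomputable def chi (u : ℝ) : ℂ := conj (Complex.Gammaℝ (critPt u)) / Complex.Gammaℝ (critPt u)

/-- One half of the smoothed approximate functional equation, as an integral. -/
noncomputable def halfZeta (u : ℝ) : ℂ :=
  ∫ y : ℝ, archFactor (critPt u + linePt y) / archFactor (critPt u) *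
    riemannZeta (critPt u + linePt y) * Complex.exp (linePt y ^ 2) / linePt y

@[simp] theorem critPt_re (u : ℝ) : (critPt u).re = 1 / 2 := by simp [critPt]
@[simp] theorem critPt_im (u : ℝ) : (critPt u).im = u := by simp [critPt]
@[simp] theorem linePt_re (y : ℝ) : (linePt y).re = 3 / 5 := by simp [linePt]
@[simp] theorem linePt_im (y : ℝ) : (linePt y).im = y := by simp [linePt]

theorem ne_of_re_ne {z w : ℂ} (h : z.re ≠ w.re) : z ≠ w := fun e => h (by rw [e])

theorem Gammaℝ_critPt_ne (u : ℝ) : Complex.Gammaℝ (critPt u) ≠ 0 :=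
  Complex.Gammaℝ_ne_zero_of_re_pos (by simp)

theorem critPt_ne_zero (u : ℝ) : critPt u ≠ 0 := ne_of_re_ne (by simp)

theorem critPt_ne_one (u : ℝ) : critPt u ≠ 1 := ne_of_re_ne (by simp)

theorem archFactor_critPt_ne (u : ℝ) : archFactor (critPt u) ≠ 0 :=
  mul_ne_zero (mul_ne_zero (critPt_ne_zero u) (sub_ne_zero.mpr (critPt_ne_one u)))
    (Gammaℝ_critPt_ne u)

theorem one_sub_critPt (u : ℝ) : 1 - critPt u = conj (critPt u) := by
  apply Complex.ext <;> simp [critPt]; norm_num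

theorem conj_archFactor_div (u : ℝ) :
    conj (archFactor (critPt u)) / archFactor (critPt u) = chi u := by
  have h : conj (critPt u * (critPt u - 1)) = critPt u * (critPt u - 1) := by
    rw [map_mul, map_sub, map_one, ← one_sub_critPt]
    ring
  have h2 : critPt u * (critPt u - 1) ≠ 0 :=
    mul_ne_zero (critPt_ne_zero u) (sub_ne_zero.mpr (critPt_ne_one u))
  unfold archFactor chi
  rw [map_mul, h, mul_div_mul_left _ _ h2]

theorem norm_chi (u : ℝ) : ‖chi u‖ = 1 := by
  unfold chi
  rw [norm_div, RCLike.norm_conj, div_self]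
  exact norm_ne_zero_iff.mpr (Gammaℝ_critPt_ne u)

theorem conj_linePt (y : ℝ) : conj (linePt y) = linePt (-y) := by
  simp [linePt, map_ofNat]

theorem xi_critPt_add (u y : ℝ) : xi (critPt u + linePt y) =
    archFactor (critPt u + linePt y) * riemannZeta (critPt u + linePt y) := by
  rw [xi_eq (by simp; norm_num) (ne_of_re_ne (by simp; norm_num)), archFactor]

/-- Exact smoothed functional equation on the critical line. -/
theorem two_pi_zeta (u : ℝ) :
    2 * Real.pi * riemannZeta (critPt u) = halfZeta u + chi u * conj (halfZeta u) := by
  set s := critPt u with hs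
  set P : ℂ := ∫ y : ℝ, xi (s + linePt y) * Complex.exp (linePt y ^ 2) / linePt y with hP
  have hg := archFactor_critPt_ne u
  rw [← hs] at hg
  have h1 : P + conj P = 2 * Real.pi * xi s := by
    obtain ⟨M, hM⟩ := norm_xi_add_le s (3 / 5)
    have hd : Differentiable ℂ fun w => xi (s + w) := by
      have := differentiable_xi
      fun_prop
    have := cauchy_strip (c := 3 / 5) (by norm_num) hd hM
    rw [add_zero] at this
    rw [← this]
    congr 1
    rw [hP, ← integral_conj, ← integral_neg_eq_self]
    refine integral_congr_ae (Eventually.of_forall fun y => ?_)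
    change conj (xi (s + linePt (-y)) * Complex.exp (linePt (-y) ^ 2) / linePt (-y)) =
      xi (s + -linePt y) * Complex.exp (linePt y ^ 2) / linePt y
    have e1 : xi (s + -linePt y) = conj (xi (s + linePt (-y))) := by
      rw [← xi_conj, ← xi_one_sub]
      congr 1
      rw [map_add, conj_linePt, neg_neg, ← one_sub_critPt]
      ring
    rw [e1, map_div₀, map_mul, ← Complex.exp_conj, map_pow, conj_linePt, neg_neg]
  have h2 : halfZeta u = P / archFactor s := by
    rw [hP, ← integral_div]
    unfold halfZeta
    refine integral_congr_ae (Eventually.of_forall fun y => ?_)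
    simp only
    rw [xi_critPt_add]
    ring
  have h3 : xi s = archFactor s * riemannZeta s := by
    rw [xi_eq (by simp) (critPt_ne_one u), archFactor]
  rw [h2, ← conj_archFactor_div, ← hs, map_div₀]
  have hg' : conj (archFactor s) ≠ 0 := by simpa using hg
  rw [h3] at h1
  field_simp
  rw [h1]
  ring

theorem norm_mul_sub_one_le_exp {x y : ℂ} {α β : ℝ} (hx : ‖x - 1‖ ≤ Real.exp α - 1)
    (hy : ‖y - 1‖ ≤ Real.exp β - 1) : ‖x * y - 1‖ ≤ Real.exp (α + β) - 1 := by
  have h : x * y - 1 = (x - 1) * (y - 1) + (x - 1) + (y - 1) := by ring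
  have h1 : ‖x * y - 1‖ ≤ ‖x - 1‖ * ‖y - 1‖ + ‖x - 1‖ + ‖y - 1‖ := by
    rw [h, ← norm_mul]
    exact (norm_add_le _ _).trans (by gcongr; exact norm_add_le _ _)
  have h2 : ‖x - 1‖ * ‖y - 1‖ ≤ (Real.exp α - 1) * (Real.exp β - 1) :=
    mul_le_mul hx hy (norm_nonneg _) ((norm_nonneg _).trans hx)
  rw [Real.exp_add]
  nlinarith

theorem exp_sub_one_le_mul_exp (x : ℝ) : Real.exp x - 1 ≤ x * Real.exp x := by
  have h := Real.add_one_le_exp (-x)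
  have h2 : Real.exp (-x) * Real.exp x = 1 := by rw [← Real.exp_add]; simp
  nlinarith [Real.exp_pos x]

/-- Comparison of the logarithm near a point high on the imaginary axis. -/
theorem norm_log_sub_le {T Δ u : ℝ} (hΔ : 1 ≤ Δ) (hT : 4 * Δ ≤ T) (hu : |u - T| ≤ Δ) :
    ‖Complex.log (critPt u / 2) - ((Real.log (T / 2) : ℂ) + (Real.pi / 2 : ℝ) * Complex.I)‖ ≤
      4 * (Δ / T) := by
  have hT0 : 0 < T := by linarith
  have hu' := abs_le.mp hu
  set ρ : ℂ := (((u - T) / T : ℝ) : ℂ) - ((1 / (2 * T) : ℝ) : ℂ) * Complex.I with hρ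
  have hρn : ‖ρ‖ ≤ 3 / 2 * (Δ / T) := by
    refine (norm_sub_le _ _).trans ?_
    rw [norm_mul, Complex.norm_real, Complex.norm_real, Complex.norm_I, mul_one, Real.norm_eq_abs,
      Real.norm_eq_abs, abs_div, abs_of_pos hT0, abs_of_pos (by positivity : 0 < 1 / (2 * T))]
    have h1 : |u - T| / T ≤ Δ / T := by gcongr
    have h2 : 1 / (2 * T) ≤ 1 / 2 * (Δ / T) := by
      rw [← div_div, div_eq_mul_inv (1 / 2) T, div_eq_mul_inv Δ T]
      have : 0 < T⁻¹ := by positivity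
      nlinarith
    linarith
  have hΔT : Δ / T ≤ 1 / 4 := by rw [div_le_iff₀ hT0]; linarith
  have hρ2 : ‖ρ‖ ≤ 1 / 2 := by linarith
  have hre : 0 < (1 + ρ).re := by
    have := (abs_le.mp ((Complex.abs_re_le_norm ρ).trans hρ2)).1
    rw [Complex.add_re, Complex.one_re]
    linarith
  have hne : (1 + ρ) ≠ 0 := fun h => by rw [h] at hre; simp at hre
  have hz : critPt u / 2 = ((T / 2 : ℝ) : ℂ) * (Complex.I * (1 + ρ)) := by
    have : (T : ℂ) ≠ 0 := by exact_mod_cast hT0.ne'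
    rw [hρ, critPt]
    push_cast
    field_simp
    linear_combination Complex.I_sq
  have harg := abs_lt.mp (Complex.abs_arg_lt_pi_div_two_iff.mpr (Or.inl hre))
  rw [hz, Complex.log_ofReal_mul (by positivity) (mul_ne_zero Complex.I_ne_zero hne),
    Complex.log_mul Complex.I_ne_zero hne, Complex.log_I]
  · have h := norm_log_one_add_sub_le_sq hρ2
    have h' : ‖Complex.log (1 + ρ)‖ ≤ ‖ρ‖ + ‖ρ‖ ^ 2 := by
      calc ‖Complex.log (1 + ρ)‖ = ‖ρ + (Complex.log (1 + ρ) - ρ)‖ := by ring_nf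
        _ ≤ _ := (norm_add_le _ _).trans (by linarith)
    have e : (Real.log (T / 2) : ℂ) + ((Real.pi / 2 : ℂ) * Complex.I + Complex.log (1 + ρ)) -
      ((Real.log (T / 2) : ℂ) + (Real.pi / 2 : ℝ) * Complex.I) = Complex.log (1 + ρ) := by
      push_cast; ring
    rw [e]
    nlinarith [norm_nonneg ρ]
  · rw [Complex.arg_I]
    constructor <;> linarith [Real.pi_pos]

theorem norm_Gamma_le {s : ℂ} (hs : 0 < s.re) : ‖Complex.Gamma s‖ ≤ Real.Gamma s.re := by
  rw [Complex.Gamma_eq_integral hs, Real.Gamma_eq_integral hs, Complex.GammaIntegral]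
  refine (norm_integral_le_integral_norm _).trans (le_of_eq ?_)
  refine setIntegral_congr_fun measurableSet_Ioi fun x hx => ?_
  have hx0 : (0 : ℝ) < x := hx
  rw [norm_mul, Complex.norm_cpow_eq_rpow_re_of_pos hx0, Complex.norm_real, Real.norm_eq_abs,
    abs_of_pos (Real.exp_pos _), Complex.sub_re, Complex.one_re]

theorem norm_sin_le_exp (z : ℂ) : ‖Complex.sin z‖ ≤ Real.exp |z.im| := by
  rw [Complex.sin, norm_div, norm_mul, Complex.norm_I, mul_one, Complex.norm_ofNat]
  have h1 : ‖Complex.exp (-z * Complex.I)‖ ≤ Real.exp |z.im| := by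
    rw [Complex.norm_exp]
    simpa using le_abs_self z.im
  have h2 : ‖Complex.exp (z * Complex.I)‖ ≤ Real.exp |z.im| := by
    rw [Complex.norm_exp]
    simpa using neg_le_abs z.im
  have := norm_sub_le (Complex.exp (-z * Complex.I)) (Complex.exp (z * Complex.I))
  linarith

theorem inv_norm_Gamma_le {z : ℂ} (h0 : 0 < z.re) (h1 : z.re < 1) :
    ‖Complex.Gamma z‖⁻¹ ≤ Real.Gamma (1 - z.re) * Real.exp (Real.pi * |z.im|) := by
  have hG : Complex.Gamma z ≠ 0 := Complex.Gamma_ne_zero_of_re_pos h0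
  have hG1 : Complex.Gamma (1 - z) ≠ 0 := Complex.Gamma_ne_zero_of_re_pos (by simpa using h1)
  have h := Complex.Gamma_mul_Gamma_one_sub z
  have hsin : Complex.sin (Real.pi * z) ≠ 0 := by
    intro hs
    rw [hs, div_zero] at h
    exact mul_ne_zero hG hG1 h
  have hpi : (Real.pi : ℂ) ≠ 0 := by exact_mod_cast Real.pi_ne_zero
  have h2 : (Complex.Gamma z)⁻¹ = Complex.Gamma (1 - z) * Complex.sin (Real.pi * z) / Real.pi := by
    rw [eq_div_iff hsin] at h
    rw [eq_div_iff hpi, inv_mul_eq_iff_eq_mul₀ hG]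
    linear_combination -h
  rw [← norm_inv, h2, norm_div, norm_mul, Complex.norm_real, Real.norm_eq_abs,
    abs_of_pos Real.pi_pos]
  have h3 := norm_sin_le_exp (Real.pi * z)
  have e3 : ((Real.pi : ℂ) * z).im = Real.pi * z.im := by simp
  rw [e3, abs_mul, abs_of_pos Real.pi_pos] at h3
  have h4 := norm_Gamma_le (s := 1 - z) (by simpa using h1)
  rw [Complex.sub_re, Complex.one_re] at h4
  refine (div_le_self (by positivity) (by linarith [Real.pi_gt_three])).trans ?_
  exact mul_le_mul h4 h3 (norm_nonneg _) ((norm_nonneg _).trans h4)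

/-- The approximation to the ratio of archimedean factors at height `T`. -/
noncomputable def mainKernel (T y : ℝ) : ℂ :=
  Complex.exp (linePt y / 2 * ((Real.log (T / (2 * Real.pi)) : ℂ) + (Real.pi / 2 : ℝ) * Complex.I))

theorem norm_mainKernel_le {T : ℝ} (hT : 1 ≤ T) (y : ℝ) :
    ‖mainKernel T y‖ ≤ T ^ (3 / 10 : ℝ) * Real.exp |y| := by
  have hT0 : 0 < T := by linarith
  have hpi := Real.pi_gt_three
  rw [mainKernel, Complex.norm_exp, Real.rpow_def_of_pos hT0, ← Real.exp_add]
  refine Real.exp_le_exp.mpr ?_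
  have hlog : Real.log (T / (2 * Real.pi)) ≤ Real.log T := by
    refine Real.log_le_log (by positivity) ?_
    exact div_le_self hT0.le (by linarith)
  have e : (linePt y / 2 * ((Real.log (T / (2 * Real.pi)) : ℂ) +
      (Real.pi / 2 : ℝ) * Complex.I)).re =
      3 / 10 * Real.log (T / (2 * Real.pi)) - y * (Real.pi / 4) := by
    have : linePt y / 2 = ((3 / 10 : ℝ) : ℂ) + ((y / 2 : ℝ) : ℂ) * Complex.I := by
      rw [linePt]; push_cast; ring
    rw [this]
    simp only [Complex.mul_re, Complex.add_re, Complex.add_im, Complex.ofReal_re, Complex.ofReal_im,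
      Complex.mul_im, Complex.I_re, Complex.I_im]
    ring
  rw [e]
  have h4 := Real.pi_lt_four
  have : -(y * (Real.pi / 4)) ≤ |y| := by
    calc -(y * (Real.pi / 4)) ≤ |y * (Real.pi / 4)| := neg_le_abs _
      _ = |y| * (Real.pi / 4) := by rw [abs_mul, abs_of_pos (by linarith : 0 < Real.pi / 4)]
      _ ≤ |y| * 1 := by gcongr; linarith
      _ = |y| := mul_one _
  linarith

theorem Gammaℝ_add_div {s : ℂ} (w : ℂ) :
    Complex.Gammaℝ (s + w) / Complex.Gammaℝ s =
      Complex.exp (-(w / 2 * Real.log Real.pi)) *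
        (Complex.Gamma (s / 2 + w / 2) / Complex.Gamma (s / 2)) := by
  have hpi : (Real.pi : ℂ) ≠ 0 := by exact_mod_cast Real.pi_ne_zero
  have e : ∀ t : ℂ, (Real.pi : ℂ) ^ t = Complex.exp (Real.log Real.pi * t) := fun t => by
    rw [Complex.cpow_def_of_ne_zero hpi, Complex.ofReal_log Real.pi_pos.le]
  rw [Complex.Gammaℝ_def, Complex.Gammaℝ_def, mul_div_mul_comm, e, e, ← Complex.exp_sub, add_div]
  congr 2
  ring

theorem archFactor_add_div {T u : ℝ} (hT : 0 < T) (w : ℂ) :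
    archFactor (critPt u + w) / archFactor (critPt u) =
      Complex.exp (w / 2 * ((Real.log (T / (2 * Real.pi)) : ℂ) + (Real.pi / 2 : ℝ) * Complex.I)) *
      ((1 + (w / critPt u + w / (critPt u - 1) + w / critPt u * (w / (critPt u - 1)))) *
        (Complex.Gamma (critPt u / 2 + w / 2) / Complex.Gamma (critPt u / 2) *
          Complex.exp (-(w / 2 * Complex.log (critPt u / 2)))) *
        Complex.exp (w / 2 * (Complex.log (critPt u / 2) -
          ((Real.log (T / 2) : ℂ) + (Real.pi / 2 : ℝ) * Complex.I)))) := by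
  have h0 := critPt_ne_zero u
  have h1 := sub_ne_zero.mpr (critPt_ne_one u)
  have hlog : Real.log (T / (2 * Real.pi)) = Real.log (T / 2) - Real.log Real.pi := by
    rw [← div_div, Real.log_div (by positivity) Real.pi_ne_zero]
  have hexp : Complex.exp (-(w / 2 * Real.log Real.pi)) =
      Complex.exp (w / 2 * ((Real.log (T / (2 * Real.pi)) : ℂ) + (Real.pi / 2 : ℝ) * Complex.I)) *
      Complex.exp (-(w / 2 * Complex.log (critPt u / 2))) *
      Complex.exp (w / 2 * (Complex.log (critPt u / 2) -
          ((Real.log (T / 2) : ℂ) + (Real.pi / 2 : ℝ) * Complex.I))) := by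
    rw [← Complex.exp_add, ← Complex.exp_add, hlog]
    congr 1
    push_cast
    ring
  have hp : (critPt u + w) * (critPt u + w - 1) / (critPt u * (critPt u - 1)) =
      1 + (w / critPt u + w / (critPt u - 1) + w / critPt u * (w / (critPt u - 1))) := by
    field_simp
    ring
  rw [archFactor, archFactor, mul_div_mul_comm, hp, Gammaℝ_add_div, hexp]
  ring

theorem norm_poly_le {u : ℝ} (hu : 1 ≤ u) (w : ℂ) :
    ‖w / critPt u + w / (critPt u - 1) + w / critPt u * (w / (critPt u - 1))‖ ≤
      2 * (‖w‖ + ‖w‖ ^ 2) / u := by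
  have hu0 : 0 < u := by linarith
  have h1 : u ≤ ‖critPt u‖ := by
    have := Complex.abs_im_le_norm (critPt u)
    rw [critPt_im] at this
    exact (le_abs_self u).trans this
  have h2 : u ≤ ‖critPt u - 1‖ := by
    have := Complex.abs_im_le_norm (critPt u - 1)
    rw [Complex.sub_im, critPt_im, Complex.one_im, sub_zero] at this
    exact (le_abs_self u).trans this
  have h3 : ‖w / critPt u‖ ≤ ‖w‖ / u := by rw [norm_div]; gcongr
  have h4 : ‖w / (critPt u - 1)‖ ≤ ‖w‖ / u := by rw [norm_div]; gcongr
  have h5 : ‖w / critPt u * (w / (critPt u - 1))‖ ≤ ‖w‖ / u * ‖w‖ := by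
    rw [norm_mul]
    refine mul_le_mul h3 (h4.trans (div_le_self (norm_nonneg _) hu)) (norm_nonneg _) (by positivity)
  calc _ ≤ ‖w / critPt u‖ + ‖w / (critPt u - 1)‖ + ‖w / critPt u * (w / (critPt u - 1))‖ := norm_add₃_le
    _ ≤ ‖w‖ / u + ‖w‖ / u + ‖w‖ / u * ‖w‖ := by gcongr
    _ ≤ 2 * (‖w‖ + ‖w‖ ^ 2) / u := by
      rw [show ‖w‖ / u + ‖w‖ / u + ‖w‖ / u * ‖w‖ = (2 * ‖w‖ + ‖w‖ ^ 2) / u by ring]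
      gcongr
      nlinarith [norm_nonneg w]

/-- Ratio of archimedean factors for moderate shifts. -/
theorem norm_archFactor_ratio_sub_le {T Δ u : ℝ} {w : ℂ} (hT1 : 2000 ≤ T) (hΔ : 1 ≤ Δ)
    (hT : 4 * Δ ≤ T) (hu : |u - T| ≤ Δ) (hw : 2 * ‖w‖ ≤ u) :
    ‖archFactor (critPt u + w) / archFactor (critPt u) -
      Complex.exp (w / 2 * ((Real.log (T / (2 * Real.pi)) : ℂ) + (Real.pi / 2 : ℝ) * Complex.I))‖ ≤
    ‖Complex.exp (w / 2 * ((Real.log (T / (2 * Real.pi)) : ℂ) +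
      (Real.pi / 2 : ℝ) * Complex.I))‖ *
      (Real.exp (8 * (‖w‖ + ‖w‖ ^ 2) / T + 2 * ‖w‖ * (Δ / T)) - 1) := by
  have hu' := abs_le.mp hu
  have hu3 : 3 / 4 * T ≤ u := by linarith
  have hu0 : 0 < u := by linarith
  have hT0 : 0 < T := by linarith
  rw [archFactor_add_div hT0, ← mul_sub_one, norm_mul]
  gcongr
  have h1 : ‖(1 + (w / critPt u + w / (critPt u - 1) + w / critPt u * (w / (critPt u - 1)))) - 1‖ ≤
      Real.exp (2 * (‖w‖ + ‖w‖ ^ 2) / u) - 1 := by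
    rw [add_sub_cancel_left]
    refine (norm_poly_le (by linarith) w).trans ?_
    linarith [Real.add_one_le_exp (2 * (‖w‖ + ‖w‖ ^ 2) / u)]
  have him : (critPt u / 2).im = u / 2 := by simp
  have hw2 : ‖w / 2‖ = ‖w‖ / 2 := by simp
  have h2 := gamma_ratio (z := critPt u / 2) (w := w / 2) (by simp) (by rw [him]; linarith)
    (by rw [him, hw2]; linarith)
  rw [him, hw2] at h2
  have h3 := norm_exp_sub_one_le_exp (w / 2 * (Complex.log (critPt u / 2) -
          ((Real.log (T / 2) : ℂ) + (Real.pi / 2 : ℝ) * Complex.I)))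
  refine (norm_mul_sub_one_le_exp (norm_mul_sub_one_le_exp h1 h2) h3).trans ?_
  refine sub_le_sub_right (Real.exp_le_exp.mpr ?_) 1
  have h4 : ‖w / 2 * (Complex.log (critPt u / 2) -
          ((Real.log (T / 2) : ℂ) + (Real.pi / 2 : ℝ) * Complex.I))‖ ≤ 2 * ‖w‖ * (Δ / T) := by
    rw [norm_mul, hw2]
    have := mul_le_mul_of_nonneg_left (norm_log_sub_le hΔ hT hu)
      (by positivity : 0 ≤ ‖w‖ / 2)
    linarith
  have h5 : 2 * (‖w‖ + ‖w‖ ^ 2) / u + 4 * (‖w‖ / 2 + (‖w‖ / 2) ^ 2) / (u / 2) ≤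
      8 * (‖w‖ + ‖w‖ ^ 2) / T := by
    have e : 2 * (‖w‖ + ‖w‖ ^ 2) / u + 4 * (‖w‖ / 2 + (‖w‖ / 2) ^ 2) / (u / 2) =
      (6 * ‖w‖ + 4 * ‖w‖ ^ 2) / u := by field_simp; ring
    rw [e, div_le_div_iff₀ hu0 hT0]
    have := norm_nonneg w
    calc (6 * ‖w‖ + 4 * ‖w‖ ^ 2) * T ≤ (6 * (‖w‖ + ‖w‖ ^ 2)) * T := by gcongr; nlinarith
      _ = 8 * (‖w‖ + ‖w‖ ^ 2) * (3 / 4 * T) := by ring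
      _ ≤ _ := by gcongr
  linarith

theorem norm_linePt_le (y : ℝ) : ‖linePt y‖ ≤ 3 / 5 + |y| := by
  have := Complex.norm_le_abs_re_add_abs_im (linePt y)
  rw [linePt_re, linePt_im] at this
  rwa [abs_of_pos (by norm_num : (0 : ℝ) < 3 / 5)] at this

theorem norm_ratio_small {T Δ u y : ℝ} (hT1 : 2000 ≤ T) (hΔ : 1 ≤ Δ)
    (hT : 4 * Δ ≤ T) (hu : |u - T| ≤ Δ) (hy : 2 * ‖linePt y‖ ≤ u) :
    ‖archFactor (critPt u + linePt y) / archFactor (critPt u) - mainKernel T y‖ ≤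
      (40 * Real.exp 10) * T ^ (3 / 10 : ℝ) * (Δ / T) * Real.exp (y ^ 2 / 2) := by
  have hT0 : 0 < T := by linarith
  refine (norm_archFactor_ratio_sub_le hT1 hΔ hT hu hy).trans ?_
  have h1 := norm_mainKernel_le (by linarith : 1 ≤ T) y
  have h2 := norm_linePt_le y
  set W := ‖linePt y‖ with hW
  set X := 8 * (W + W ^ 2) / T + 2 * W * (Δ / T) with hX
  have hW0 : 0 ≤ W := norm_nonneg _
  have hy0 := abs_nonneg y
  have hsq : |y| ^ 2 = y ^ 2 := sq_abs y
  have hDT0 : 0 ≤ Δ / T := by positivity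
  have hDT : Δ / T ≤ 1 / 4 := by rw [div_le_iff₀ hT0]; linarith
  have hTi : 1 / T ≤ Δ / T := by gcongr
  have hTi2 : 1 / T ≤ 1 / 2000 := by gcongr
  have hWW : W + W ^ 2 ≤ 4 * Real.exp |y| := by
    have := Real.quadratic_le_exp_of_nonneg hy0
    nlinarith
  have hXle : X ≤ 10 * (W + W ^ 2) * (Δ / T) := by
    have : 8 * (W + W ^ 2) / T ≤ 8 * (W + W ^ 2) * (Δ / T) := by
      rw [div_eq_mul_one_div]; gcongr
    have h3 : 2 * W * (Δ / T) ≤ 2 * (W + W ^ 2) * (Δ / T) := by gcongr; nlinarith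
    linarith
  have hXexp : X ≤ 10 - 2 * |y| + y ^ 2 / 2 := by
    have h3 : 8 * (W + W ^ 2) / T ≤ 8 * (W + W ^ 2) * (1 / 2000) := by
      rw [div_eq_mul_one_div]; gcongr
    have h4 : 2 * W * (Δ / T) ≤ 2 * W * (1 / 4) := by gcongr
    have h5 : W ^ 2 ≤ (3 / 5 + |y|) ^ 2 := by gcongr
    nlinarith [sq_nonneg (|y| - 4)]
  have hX1 := exp_sub_one_le_mul_exp X
  have hX0 : 0 ≤ X := by positivity
  calc ‖mainKernel T y‖ * (Real.exp X - 1)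
      ≤ (T ^ (3 / 10 : ℝ) * Real.exp |y|) *
        (10 * (4 * Real.exp |y|) * (Δ / T) * Real.exp (10 - 2 * |y| + y ^ 2 / 2)) := by
        have hx1 : 0 ≤ Real.exp X - 1 := by linarith [Real.add_one_le_exp X]
        refine mul_le_mul h1 (hX1.trans ?_) hx1 (by positivity)
        refine mul_le_mul (hXle.trans ?_) (Real.exp_le_exp.mpr hXexp) (Real.exp_pos _).le
          (by positivity)
        gcongr
    _ = 40 * T ^ (3 / 10 : ℝ) * (Δ / T) *
        (Real.exp |y| * Real.exp |y| * Real.exp (10 - 2 * |y| + y ^ 2 / 2)) := by ring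
    _ = 40 * T ^ (3 / 10 : ℝ) * (Δ / T) * (Real.exp 10 * Real.exp (y ^ 2 / 2)) := by
        rw [← Real.exp_add, ← Real.exp_add, ← Real.exp_add]
        ring_nf
    _ = _ := by ring

theorem norm_ratio_large {T Δ u y : ℝ} (hT1 : 2000 ≤ T) (hΔ : 1 ≤ Δ)
    (hT : 4 * Δ ≤ T) (hu : |u - T| ≤ Δ) (hy : u < 2 * ‖linePt y‖) :
    ‖archFactor (critPt u + linePt y) / archFactor (critPt u) - mainKernel T y‖ ≤
      (64 * (Real.Gamma (11 / 20) * Real.Gamma (3 / 4) + 1) * Real.exp 72) *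
        T ^ (3 / 10 : ℝ) * (Δ / T) * Real.exp (y ^ 2 / 2) := by
  have hT0 : 0 < T := by linarith
  have hu' := abs_le.mp hu
  have h2 := norm_linePt_le y
  have hy0 := abs_nonneg y
  have hyu : u ≤ 4 * |y| := by linarith
  have hTy : T ≤ 8 * |y| := by linarith
  have hsq : |y| ^ 2 = y ^ 2 := sq_abs y
  have hG1 : 0 < Real.Gamma (11 / 20) := Real.Gamma_pos_of_pos (by norm_num)
  have hG2 : 0 < Real.Gamma (3 / 4) := Real.Gamma_pos_of_pos (by norm_num)
  have h1 := norm_mainKernel_le (by linarith : 1 ≤ T) y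
  have hT3 : 1 ≤ T ^ (3 / 10 : ℝ) := Real.one_le_rpow (by linarith) (by norm_num)
  have hpi := Real.pi_gt_three
  have hQ : ‖archFactor (critPt u + linePt y) / archFactor (critPt u)‖ ≤
      8 * Real.exp |y| * (Real.Gamma (11 / 20) * (Real.Gamma (3 / 4) * Real.exp (8 * |y|))) := by
    rw [archFactor, archFactor, mul_div_mul_comm, norm_mul, Gammaℝ_add_div, norm_mul,
      norm_div (Complex.Gamma _)]
    have hp : (critPt u + linePt y) * (critPt u + linePt y - 1) / (critPt u * (critPt u - 1)) =
      1 + (linePt y / critPt u + linePt y / (critPt u - 1) +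
        linePt y / critPt u * (linePt y / (critPt u - 1))) := by
      have h0 := critPt_ne_zero u
      have h1 := sub_ne_zero.mpr (critPt_ne_one u)
      field_simp
      ring
    have hpn : ‖(critPt u + linePt y) * (critPt u + linePt y - 1) / (critPt u * (critPt u - 1))‖ ≤
        8 * Real.exp |y| := by
      rw [hp]
      refine (norm_add_le _ _).trans ?_
      have := norm_poly_le (by linarith : 1 ≤ u) (linePt y)
      have h3 := div_le_self (by positivity : 0 ≤ 2 * (‖linePt y‖ + ‖linePt y‖ ^ 2))
        (by linarith : 1 ≤ u)
      have h4 := Real.quadratic_le_exp_of_nonneg hy0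
      rw [norm_one]
      nlinarith [norm_nonneg (linePt y)]
    have he : ‖Complex.exp (-(linePt y / 2 * Real.log Real.pi))‖ ≤ 1 := by
      rw [Complex.norm_exp, Real.exp_le_one_iff]
      have : (-(linePt y / 2 * Real.log Real.pi)).re = -(3 / 10 * Real.log Real.pi) := by
        simp [linePt]
        norm_num
      rw [this]
      have := Real.log_nonneg (by linarith : 1 ≤ Real.pi)
      linarith
    have hga : ‖Complex.Gamma (critPt u / 2 + linePt y / 2)‖ ≤ Real.Gamma (11 / 20) := by
      have e : (critPt u / 2 + linePt y / 2).re = 11 / 20 := by simp; norm_num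
      have := norm_Gamma_le (s := critPt u / 2 + linePt y / 2) (by rw [e]; norm_num)
      rwa [e] at this
    have hgb : ‖Complex.Gamma (critPt u / 2)‖⁻¹ ≤ Real.Gamma (3 / 4) * Real.exp (8 * |y|) := by
      have e : (critPt u / 2).re = 1 / 4 := by simp; norm_num
      have e2 : (critPt u / 2).im = u / 2 := by simp
      have := inv_norm_Gamma_le (z := critPt u / 2) (by rw [e]; norm_num) (by rw [e]; norm_num)
      rw [e, e2, show (1 : ℝ) - 1 / 4 = 3 / 4 by norm_num] at this
      refine this.trans (mul_le_mul_of_nonneg_left (Real.exp_le_exp.mpr ?_) hG2.le)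
      rw [abs_of_pos (by linarith)]
      nlinarith [Real.pi_lt_four]
    rw [div_eq_mul_inv ‖Complex.Gamma (critPt u / 2 + linePt y / 2)‖]
    refine mul_le_mul hpn ?_ (by positivity) (by positivity)
    calc _ ≤ 1 * (‖Complex.Gamma (critPt u / 2 + linePt y / 2)‖ *
          ‖Complex.Gamma (critPt u / 2)‖⁻¹) := by gcongr
      _ ≤ _ := by rw [one_mul]; gcongr
  have hone : 1 ≤ Δ / T * (8 * |y|) := by
    rw [div_mul_eq_mul_div, le_div_iff₀ hT0]
    nlinarith
  have hye : |y| ≤ Real.exp |y| := by linarith [Real.add_one_le_exp |y|]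
  have hexp1 : Real.exp |y| ≤ Real.exp |y| * Real.exp (8 * |y|) :=
    le_mul_of_one_le_right (Real.exp_pos _).le (Real.one_le_exp (by positivity))
  set G := Real.Gamma (11 / 20) * Real.Gamma (3 / 4) with hG
  have hG0 : 0 < G := by positivity
  set S := T ^ (3 / 10 : ℝ) with hS
  set Ee := Real.exp |y| * Real.exp (8 * |y|) with hE
  have hE0 : 0 < Ee := by positivity
  calc ‖archFactor (critPt u + linePt y) / archFactor (critPt u) - mainKernel T y‖
      ≤ 8 * Real.exp |y| * (Real.Gamma (11 / 20) * (Real.Gamma (3 / 4) * Real.exp (8 * |y|))) +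
        S * Real.exp |y| := (norm_sub_le _ _).trans (add_le_add hQ h1)
    _ = 8 * G * Ee * 1 + S * Real.exp |y| := by rw [hG, hE]; ring
    _ ≤ 8 * G * Ee * S + S * (8 * Ee) := by
        gcongr
        linarith
    _ = 8 * (G + 1) * S * Ee * 1 := by ring
    _ ≤ 8 * (G + 1) * S * Ee * (Δ / T * (8 * Real.exp |y|)) := by
        gcongr
        exact hone.trans (by gcongr)
    _ = 64 * (G + 1) * S * (Δ / T) * (Ee * Real.exp |y|) := by ring
    _ ≤ 64 * (G + 1) * S * (Δ / T) * (Real.exp 72 * Real.exp (y ^ 2 / 2)) := by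
        refine mul_le_mul_of_nonneg_left ?_ (by positivity)
        rw [hE, ← Real.exp_add, ← Real.exp_add, ← Real.exp_add]
        refine Real.exp_le_exp.mpr ?_
        nlinarith [sq_nonneg (|y| - 10)]
    _ = _ := by ring

/-- Uniform approximation of the ratio of archimedean factors. -/
theorem exists_norm_ratio_sub_le : ∃ C > (0 : ℝ), ∀ T Δ u y : ℝ, 2000 ≤ T → 1 ≤ Δ → 4 * Δ ≤ T →
    |u - T| ≤ Δ →
    ‖archFactor (critPt u + linePt y) / archFactor (critPt u) - mainKernel T y‖ ≤
      C * T ^ (3 / 10 : ℝ) * (Δ / T) * Real.exp (y ^ 2 / 2) := by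
  have hG1 : 0 < Real.Gamma (11 / 20) := Real.Gamma_pos_of_pos (by norm_num)
  have hG2 : 0 < Real.Gamma (3 / 4) := Real.Gamma_pos_of_pos (by norm_num)
  refine ⟨40 * Real.exp 10 + 64 * (Real.Gamma (11 / 20) * Real.Gamma (3 / 4) + 1) * Real.exp 72,
    by positivity, fun T Δ u y hT1 hΔ hT hu => ?_⟩
  have hT0 : 0 < T := by linarith
  rw [add_mul, add_mul, add_mul]
  rcases le_or_gt (2 * ‖linePt y‖) u with h | h
  · exact (norm_ratio_small hT1 hΔ hT hu h).trans (le_add_of_nonneg_right (by positivity))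
  · exact (norm_ratio_large hT1 hΔ hT hu h).trans (le_add_of_nonneg_left (by positivity))

/-- The smoothing weight of the approximate functional equation, in logarithmic scale. -/
noncomputable def wgt (x : ℝ) : ℂ :=
  (Real.sqrt Real.pi : ℂ) * ∫ l in Set.Ioi (0 : ℝ),
    Complex.exp (-((l - (-x + (Real.pi / 4 : ℝ) * Complex.I)) ^ 2 / 4))

theorem norm_wgt_integrand (x l : ℝ) :
    ‖Complex.exp (-(((l : ℂ) - (-x + (Real.pi / 4 : ℝ) * Complex.I)) ^ 2 / 4))‖ =
      Real.exp (Real.pi ^ 2 / 64) * Real.exp (-(l + x) ^ 2 / 4) := by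
  rw [Complex.norm_exp, ← Real.exp_add]
  congr 1
  have : -(((l : ℂ) - (-x + (Real.pi / 4 : ℝ) * Complex.I)) ^ 2 / 4) =
      ((Real.pi ^ 2 / 64 + -(l + x) ^ 2 / 4 : ℝ) : ℂ) +
        (((l + x) * Real.pi / 8 : ℝ) : ℂ) * Complex.I := by
    push_cast
    linear_combination (-(Real.pi : ℂ) ^ 2 / 64) * Complex.I_sq
  rw [this, Complex.add_re, Complex.ofReal_re, Complex.re_ofReal_mul, Complex.I_re, mul_zero,
    add_zero]

theorem integrable_shift_gauss (x : ℝ) {b : ℝ} (hb : 0 < b) :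
    Integrable fun l : ℝ => Real.exp (-(l + x) ^ 2 / b) := by
  have := (integrable_exp_neg_mul_sq (inv_pos.mpr hb)).comp_add_right x
  refine this.congr (Eventually.of_forall fun l => ?_)
  simp only
  congr 1
  rw [div_eq_inv_mul]
  ring

theorem integral_shift_gauss (x : ℝ) :
    ∫ l : ℝ, Real.exp (-(l + x) ^ 2 / 8) = Real.sqrt (8 * Real.pi) := by
  have h1 : (fun l : ℝ => Real.exp (-(l + x) ^ 2 / 8)) =
      fun l => (fun v : ℝ => Real.exp (-(1 / 8) * v ^ 2)) (l + x) := by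
    ext l
    congr 1
    ring
  rw [h1, integral_add_right_eq_self (fun v : ℝ => Real.exp (-(1 / 8) * v ^ 2)), integral_gaussian]
  congr 1
  ring

theorem integrable_wgt_integrand (x : ℝ) : Integrable fun l : ℝ =>
    Complex.exp (-(((l : ℂ) - (-x + (Real.pi / 4 : ℝ) * Complex.I)) ^ 2 / 4)) := by
  refine Integrable.mono' ((integrable_shift_gauss x (b := 4) (by norm_num)).const_mul
    (Real.exp (Real.pi ^ 2 / 64))) (by fun_prop) (Eventually.of_forall fun l => ?_)
  rw [norm_wgt_integrand]

/-- A constant for bounds on the weight. -/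
noncomputable def wgtConst : ℝ :=
  Real.sqrt Real.pi * (Real.exp (Real.pi ^ 2 / 64) * Real.sqrt (8 * Real.pi))

theorem wgtConst_pos : 0 < wgtConst := by
  have := Real.pi_pos
  unfold wgtConst
  positivity

theorem norm_setIntegral_wgt_le {S : Set ℝ} (hS : MeasurableSet S) {x m : ℝ}
    (h : ∀ l ∈ S, -(l + x) ^ 2 / 8 ≤ m) :
    ‖(Real.sqrt Real.pi : ℂ) * ∫ l in S,
      Complex.exp (-(((l : ℂ) - (-x + (Real.pi / 4 : ℝ) * Complex.I)) ^ 2 / 4))‖ ≤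
      wgtConst * Real.exp m := by
  rw [norm_mul, Complex.norm_real, Real.norm_of_nonneg (Real.sqrt_nonneg _), wgtConst, mul_assoc]
  gcongr
  have hi := (integrable_shift_gauss x (b := 8) (by norm_num)).const_mul
    (Real.exp (Real.pi ^ 2 / 64) * Real.exp m)
  calc _ ≤ ∫ l in S, Real.exp (Real.pi ^ 2 / 64) * Real.exp m * Real.exp (-(l + x) ^ 2 / 8) := by
        refine norm_integral_le_of_norm_le hi.integrableOn ?_
        refine (ae_restrict_iff' hS).mpr (Eventually.of_forall fun l hl => ?_)
        rw [norm_wgt_integrand, mul_assoc, ← Real.exp_add m]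
        gcongr
        have := h l hl
        linarith
    _ ≤ ∫ l, Real.exp (Real.pi ^ 2 / 64) * Real.exp m * Real.exp (-(l + x) ^ 2 / 8) :=
        setIntegral_le_integral hi (Eventually.of_forall fun l => by positivity)
    _ = _ := by rw [integral_const_mul, integral_shift_gauss]; ring

theorem norm_wgt_le {k : ℝ} (hk : 0 ≤ k) (x : ℝ) :
    ‖wgt x‖ ≤ wgtConst * Real.exp (2 * k ^ 2) * Real.exp (-(k * x)) := by
  rw [mul_assoc, ← Real.exp_add]
  refine norm_setIntegral_wgt_le measurableSet_Ioi fun l hl => ?_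
  have hl0 : (0 : ℝ) < l := hl
  nlinarith [sq_nonneg (l + x - 4 * k), mul_nonneg hk hl0.le]

theorem norm_wgt_le_const (x : ℝ) : ‖wgt x‖ ≤ wgtConst := by
  have := norm_wgt_le le_rfl x
  simpa using this

theorem norm_wgt_sub_le {x : ℝ} (hx : x ≤ 0) :
    ‖wgt x - 2 * Real.pi‖ ≤ wgtConst * Real.exp (-x ^ 2 / 8) := by
  have hpi : (0 : ℝ) ≤ Real.pi := Real.pi_pos.le
  have hfull : (Real.sqrt Real.pi : ℂ) * ∫ l : ℝ,
      Complex.exp (-(((l : ℂ) - (-x + (Real.pi / 4 : ℝ) * Complex.I)) ^ 2 / 4)) = 2 * Real.pi := by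
    have h := integral_cexp_quadratic (b := ((-(1 / 4) : ℝ) : ℂ))
      (by rw [Complex.ofReal_re]; norm_num)
      ((-x + (Real.pi / 4 : ℝ) * Complex.I) / 2) (-((-x + (Real.pi / 4 : ℝ) * Complex.I) ^ 2 / 4))
    have e : ∀ l : ℝ, Complex.exp (-(((l : ℂ) - (-x + (Real.pi / 4 : ℝ) * Complex.I)) ^ 2 / 4)) =
        Complex.exp (((-(1 / 4) : ℝ) : ℂ) * (l : ℂ) ^ 2 +
          ((-x + (Real.pi / 4 : ℝ) * Complex.I) / 2) * l +
          -((-x + (Real.pi / 4 : ℝ) * Complex.I) ^ 2 / 4)) := by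
      intro l
      congr 1
      push_cast
      ring
    simp_rw [e]
    rw [h]
    have e2 : -((-(x : ℂ) + (Real.pi / 4 : ℝ) * Complex.I) ^ 2 / 4) -
        ((-x + (Real.pi / 4 : ℝ) * Complex.I) / 2) ^ 2 / (4 * ((-(1 / 4) : ℝ) : ℂ)) = 0 := by
      push_cast
      ring
    have e3 : (Real.pi : ℂ) / -((-(1 / 4) : ℝ) : ℂ) = ((4 * Real.pi : ℝ) : ℂ) := by
      push_cast
      ring
    rw [e2, e3, Complex.exp_zero, mul_one, show (1 / 2 : ℂ) = ((1 / 2 : ℝ) : ℂ) by push_cast; rfl,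
      ← Complex.ofReal_cpow (by positivity), ← Real.sqrt_eq_rpow, ← Complex.ofReal_mul,
      Real.sqrt_mul (by norm_num), show (4 : ℝ) = 2 ^ 2 by norm_num, Real.sqrt_sq (by norm_num),
      mul_left_comm, Real.mul_self_sqrt hpi]
    push_cast
    rfl
  have hsplit := integral_add_compl (μ := volume) (measurableSet_Ioi (a := (0 : ℝ)))
    (integrable_wgt_integrand x)
  rw [← hsplit, mul_add] at hfull
  have e : wgt x - 2 * Real.pi = -((Real.sqrt Real.pi : ℂ) * ∫ l in (Set.Ioi (0 : ℝ))ᶜ,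
      Complex.exp (-(((l : ℂ) - (-x + (Real.pi / 4 : ℝ) * Complex.I)) ^ 2 / 4))) := by
    rw [← hfull, wgt]
    ring
  rw [e, norm_neg]
  refine norm_setIntegral_wgt_le measurableSet_Ioi.compl fun l hl => ?_
  have hl0 : l ≤ 0 := by simpa using hl
  nlinarith [mul_nonneg (neg_nonneg.mpr hl0) (neg_nonneg.mpr hx), sq_nonneg l]

theorem norm_nat_cpow_inv (n : ℕ) (s : ℂ) : ‖1 / ((n : ℂ) + 1) ^ s‖ = 1 / ((n : ℝ) + 1) ^ s.re := by
  have h : (0 : ℝ) < (n : ℝ) + 1 := by positivity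
  have e : (n : ℂ) + 1 = (((n : ℝ) + 1 : ℝ) : ℂ) := by push_cast; rfl
  rw [norm_div, norm_one, e, Complex.norm_cpow_eq_rpow_re_of_pos h]

theorem summable_inv_rpow {p : ℝ} (hp : 1 < p) : Summable fun n : ℕ => 1 / ((n : ℝ) + 1) ^ p := by
  have := (summable_nat_add_iff 1).mpr (Real.summable_one_div_nat_rpow.mpr hp)
  refine this.congr fun n => ?_
  push_cast
  rfl

theorem norm_zeta_le {s : ℂ} (hs : s.re = 11 / 10) :
    ‖riemannZeta s‖ ≤ ∑' n : ℕ, 1 / ((n : ℝ) + 1) ^ (11 / 10 : ℝ) := by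
  rw [zeta_eq_tsum_one_div_nat_add_one_cpow (by rw [hs]; norm_num)]
  refine tsum_of_norm_bounded (summable_inv_rpow (by norm_num)).hasSum fun n => ?_
  rw [norm_nat_cpow_inv, hs]

/-- The bound for zeta on the line `Re s = 11/10`. -/
noncomputable def zetaBound : ℝ := ∑' n : ℕ, 1 / ((n : ℝ) + 1) ^ (11 / 10 : ℝ)

theorem zetaBound_nonneg : 0 ≤ zetaBound := tsum_nonneg fun n => by positivity

theorem critPt_add_linePt_re (u y : ℝ) : (critPt u + linePt y).re = 11 / 10 := by
  simp; norm_num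

theorem norm_zeta_line_le (u y : ℝ) : ‖riemannZeta (critPt u + linePt y)‖ ≤ zetaBound :=
  norm_zeta_le (critPt_add_linePt_re u y)

theorem continuous_linePt : Continuous linePt := continuous_line _

theorem continuous_zeta_line (u : ℝ) : Continuous fun y => riemannZeta (critPt u + linePt y) := by
  refine continuous_iff_continuousAt.mpr fun y => ?_
  have h : critPt u + linePt y ≠ 1 :=
    ne_of_re_ne (by rw [critPt_add_linePt_re]; norm_num)
  exact ContinuousAt.comp (f := fun y => critPt u + linePt y)
    (differentiableAt_riemannZeta h).continuousAt
    (continuous_const.add continuous_linePt).continuousAt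

theorem continuous_mainKernel (T : ℝ) : Continuous (mainKernel T) := by
  have := continuous_linePt
  unfold mainKernel
  fun_prop

theorem integrable_halfZeta (u : ℝ) : Integrable fun y : ℝ =>
    archFactor (critPt u + linePt y) / archFactor (critPt u) *
    riemannZeta (critPt u + linePt y) * Complex.exp (linePt y ^ 2) / linePt y := by
  obtain ⟨M, hM⟩ := norm_xi_add_le (critPt u) (3 / 5)
  have h := integrable_line (c := 3 / 5) (by norm_num)
    (g := fun y => xi (critPt u + linePt y))
    (differentiable_xi.continuous.comp (continuous_const.add continuous_linePt)) (M := M) (A := 1)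
    (fun y => by
      have := hM (linePt y) (by simp [abs_of_pos])
      rwa [linePt_im] at this)
  refine (h.div_const (archFactor (critPt u))).congr (Eventually.of_forall fun y => ?_)
  simp only
  rw [xi_critPt_add]
  change _ * Complex.exp (linePt y ^ 2) / linePt y / _ = _
  ring

theorem integrable_mainKernel {T : ℝ} (hT : 1 ≤ T) : Integrable fun y : ℝ =>
    mainKernel T y * Complex.exp (linePt y ^ 2) / linePt y :=
  integrable_line (c := 3 / 5) (by norm_num) (continuous_mainKernel T) (A := 1)
    (fun y => by simpa using norm_mainKernel_le hT y)

theorem integrable_mainKernel_zeta {T : ℝ} (hT : 1 ≤ T) (u : ℝ) : Integrable fun y : ℝ =>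
    mainKernel T y * riemannZeta (critPt u + linePt y) * Complex.exp (linePt y ^ 2) / linePt y :=
  integrable_line (c := 3 / 5) (by norm_num)
    ((continuous_mainKernel T).mul (continuous_zeta_line u)) (A := 1)
    (M := T ^ (3 / 10 : ℝ) * zetaBound)
    (fun y => by
      have h0 := zetaBound_nonneg
      have h1 := norm_mainKernel_le hT y
      have h2 := norm_zeta_line_le u y
      rw [norm_mul, one_mul]
      calc _ ≤ (T ^ (3 / 10 : ℝ) * Real.exp |y|) * zetaBound := by gcongr
        _ = _ := by ring)

/-- The half zeta integral is close to its stationary version. -/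
theorem exists_norm_halfZeta_sub_le : ∃ C > (0 : ℝ), ∀ T Δ u : ℝ, 2000 ≤ T → 1 ≤ Δ → 4 * Δ ≤ T →
    |u - T| ≤ Δ →
    ‖halfZeta u - ∫ y : ℝ, mainKernel T y * riemannZeta (critPt u + linePt y) *
      Complex.exp (linePt y ^ 2) / linePt y‖ ≤ C * T ^ (3 / 10 : ℝ) * (Δ / T) := by
  obtain ⟨C, hC, h⟩ := exists_norm_ratio_sub_le
  have hI : 0 ≤ ∫ y : ℝ, Real.exp (-(1 / 2) * y ^ 2) := integral_nonneg fun y => (Real.exp_pos _).le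
  have hZ := zetaBound_nonneg
  refine ⟨C * (zetaBound * Real.exp (9 / 25) * (5 / 3)) *
    (∫ y : ℝ, Real.exp (-(1 / 2) * y ^ 2)) + 1, by positivity, fun T Δ u hT1 hΔ hT hu => ?_⟩
  have hT0 : 0 < T := by linarith
  rw [halfZeta, ← integral_sub (integrable_halfZeta u) (integrable_mainKernel_zeta (by linarith) u)]
  have hb : ∀ y : ℝ, ‖archFactor (critPt u + linePt y) / archFactor (critPt u) *
      riemannZeta (critPt u + linePt y) * Complex.exp (linePt y ^ 2) / linePt y -
      mainKernel T y * riemannZeta (critPt u + linePt y) *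
      Complex.exp (linePt y ^ 2) / linePt y‖ ≤
      (C * T ^ (3 / 10 : ℝ) * (Δ / T) * (zetaBound * Real.exp (9 / 25) * (5 / 3))) *
        Real.exp (-(1 / 2) * y ^ 2) := by
    intro y
    rw [← sub_div, ← sub_mul, ← sub_mul, norm_div, norm_mul, norm_mul]
    have h1 := h T Δ u y hT1 hΔ hT hu
    have h2 := norm_zeta_line_le u y
    have h3 : ‖Complex.exp (linePt y ^ 2)‖ = Real.exp (9 / 25) * Real.exp (-y ^ 2) := by
      rw [linePt, norm_exp_sq_line, ← Real.exp_add]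
      congr 1
      ring
    have h4 : ‖linePt y‖⁻¹ ≤ 5 / 3 := by
      have := abs_le_norm_line (3 / 5) y
      rw [abs_of_pos (by norm_num)] at this
      change 3 / 5 ≤ ‖linePt y‖ at this
      rw [show (5 / 3 : ℝ) = (3 / 5)⁻¹ by norm_num]
      gcongr
    rw [h3, div_eq_mul_inv]
    calc _ ≤ (C * T ^ (3 / 10 : ℝ) * (Δ / T) * Real.exp (y ^ 2 / 2)) * zetaBound *
          (Real.exp (9 / 25) * Real.exp (-y ^ 2)) * (5 / 3) := by gcongr
      _ = (C * T ^ (3 / 10 : ℝ) * (Δ / T) * (zetaBound * Real.exp (9 / 25) * (5 / 3))) *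
          (Real.exp (y ^ 2 / 2) * Real.exp (-y ^ 2)) := by ring
      _ = _ := by
          rw [← Real.exp_add]
          ring_nf
  refine (norm_integral_le_of_norm_le (integrable_gauss.const_mul _)
    (Eventually.of_forall hb)).trans ?_
  rw [integral_const_mul]
  have : 0 ≤ T ^ (3 / 10 : ℝ) * (Δ / T) := by positivity
  nlinarith

/-- Coefficients of the approximating Dirichlet polynomial. -/
noncomputable def coef (T : ℝ) (n : ℕ) : ℂ :=
  ((((n : ℝ) + 1) ^ (-(1 / 2) : ℝ) : ℝ) : ℂ) *
    wgt (Real.log ((n : ℝ) + 1) - Real.log (T / (2 * Real.pi)) / 2)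

/-- The approximating Dirichlet polynomial. -/
noncomputable def dpoly (T : ℝ) (N : ℕ) (u : ℝ) : ℂ :=
  ∑ n ∈ Finset.range N, coef T n * Complex.exp (-(u * Real.log ((n : ℝ) + 1) : ℝ) * Complex.I)

theorem integral_mainKernel_term (T u : ℝ) (n : ℕ) :
    ∫ y : ℝ, mainKernel T y * (1 / ((n : ℂ) + 1) ^ (critPt u + linePt y)) *
      Complex.exp (linePt y ^ 2) / linePt y =
    coef T n * Complex.exp (-(u * Real.log ((n : ℝ) + 1) : ℝ) * Complex.I) := by
  set L := Real.log ((n : ℝ) + 1) with hL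
  have hn : (0 : ℝ) < (n : ℝ) + 1 := by positivity
  have hpow : ∀ s : ℂ, 1 / ((n : ℂ) + 1) ^ s = Complex.exp (-(s * L)) := by
    intro s
    have e : (n : ℂ) + 1 = (((n : ℝ) + 1 : ℝ) : ℂ) := by push_cast; rfl
    have hne : (((n : ℝ) + 1 : ℝ) : ℂ) ≠ 0 := by exact_mod_cast hn.ne'
    rw [e, Complex.cpow_def_of_ne_zero hne, ← Complex.ofReal_log hn.le, ← hL, Complex.exp_neg,
      one_div, mul_comm]
  set β : ℂ := -((L - Real.log (T / (2 * Real.pi)) / 2 : ℝ) : ℂ) +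
    (Real.pi / 4 : ℝ) * Complex.I with hβ
  have e1 : ∀ y : ℝ, mainKernel T y * (1 / ((n : ℂ) + 1) ^ (critPt u + linePt y)) *
      Complex.exp (linePt y ^ 2) / linePt y = Complex.exp (-(critPt u * L)) *
      (Complex.exp (linePt y ^ 2 + β * linePt y) / linePt y) := by
    intro y
    rw [hpow, mainKernel, ← Complex.exp_add, ← Complex.exp_add, ← mul_div_assoc, ← Complex.exp_add]
    congr 2
    rw [hβ]
    push_cast
    ring
  simp_rw [e1]
  rw [integral_const_mul]
  have h2 := integral_exp_div_line (c := 3 / 5) (by norm_num) β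
  change ∫ y : ℝ, Complex.exp (linePt y ^ 2 + β * linePt y) / linePt y = _ at h2
  rw [h2, coef, wgt, ← hL, mul_right_comm]
  congr 1
  rw [Real.rpow_def_of_pos hn, ← hL, Complex.ofReal_exp, ← Complex.exp_add]
  congr 1
  rw [critPt]
  push_cast
  ring

theorem hasSum_mainKernel {T : ℝ} (hT : 1 ≤ T) (u : ℝ) :
    HasSum (fun n : ℕ => coef T n * Complex.exp (-(u * Real.log ((n : ℝ) + 1) : ℝ) * Complex.I))
      (∫ y : ℝ, mainKernel T y * riemannZeta (critPt u + linePt y) *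
        Complex.exp (linePt y ^ 2) / linePt y) := by
  have hi := integrable_mainKernel hT
  have hcont : ∀ n : ℕ, Continuous fun y : ℝ => 1 / ((n : ℂ) + 1) ^ (critPt u + linePt y) := by
    intro n
    have hn : (n : ℂ) + 1 ≠ 0 := Nat.cast_add_one_ne_zero n
    refine Continuous.div continuous_const ?_ fun y => ?_
    · exact (continuous_const.add continuous_linePt).const_cpow (Or.inl hn)
    · rw [Complex.cpow_def_of_ne_zero hn]; exact Complex.exp_ne_zero _
  have hnorm : ∀ (n : ℕ) (y : ℝ), ‖1 / ((n : ℂ) + 1) ^ (critPt u + linePt y)‖ =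
      1 / ((n : ℝ) + 1) ^ (11 / 10 : ℝ) := by
    intro n y
    rw [norm_nat_cpow_inv, critPt_add_linePt_re]
  have hF : ∀ n : ℕ, Integrable fun y : ℝ =>
      mainKernel T y * (1 / ((n : ℂ) + 1) ^ (critPt u + linePt y)) *
      Complex.exp (linePt y ^ 2) / linePt y := by
    intro n
    have := hi.bdd_mul (c := 1 / ((n : ℝ) + 1) ^ (11 / 10 : ℝ)) (hcont n).aestronglyMeasurable
      (Eventually.of_forall fun y => (hnorm n y).le)
    refine this.congr (Eventually.of_forall fun y => ?_)
    simp only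
    ring
  have hS : Summable fun n : ℕ => ∫ y : ℝ,
      ‖mainKernel T y * (1 / ((n : ℂ) + 1) ^ (critPt u + linePt y)) *
      Complex.exp (linePt y ^ 2) / linePt y‖ := by
    refine ((summable_inv_rpow (p := 11 / 10) (by norm_num)).mul_right
      (∫ y : ℝ, ‖mainKernel T y * Complex.exp (linePt y ^ 2) / linePt y‖)).congr fun n => ?_
    rw [← integral_const_mul]
    refine integral_congr_ae (Eventually.of_forall fun y => ?_)
    simp only
    rw [← hnorm n y, ← norm_mul]
    congr 1
    ring
  have h := hasSum_integral_of_summable_integral_norm hF hS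
  simp_rw [integral_mainKernel_term] at h
  have e : ∀ y : ℝ, mainKernel T y * riemannZeta (critPt u + linePt y) *
      Complex.exp (linePt y ^ 2) / linePt y =
      ∑' n : ℕ, mainKernel T y * (1 / ((n : ℂ) + 1) ^ (critPt u + linePt y)) *
        Complex.exp (linePt y ^ 2) / linePt y := by
    intro y
    rw [zeta_eq_tsum_one_div_nat_add_one_cpow (by rw [critPt_add_linePt_re]; norm_num),
      ← tsum_mul_left, ← tsum_mul_right, ← tsum_div_const]
  simp_rw [e]
  exact h

theorem norm_coef_eq (T : ℝ) (n : ℕ) : ‖coef T n‖ = ((n : ℝ) + 1) ^ (-(1 / 2) : ℝ) *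
    ‖wgt (Real.log ((n : ℝ) + 1) - Real.log (T / (2 * Real.pi)) / 2)‖ := by
  rw [coef, norm_mul, Complex.norm_real, Real.norm_of_nonneg (by positivity)]

theorem norm_coef_le (T : ℝ) (n : ℕ) : ‖coef T n‖ ≤ ((n : ℝ) + 1) ^ (-(1 / 2) : ℝ) * wgtConst := by
  rw [norm_coef_eq]
  gcongr
  exact norm_wgt_le_const _

theorem norm_coef_le_rpow {T k : ℝ} (hT : 1 ≤ T) (hk : 0 ≤ k) (n : ℕ) :
    ‖coef T n‖ ≤ wgtConst * Real.exp (2 * k ^ 2) * T ^ (k / 2) *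
      ((n : ℝ) + 1) ^ (-(1 / 2) - k : ℝ) := by
  have hn : (0 : ℝ) < (n : ℝ) + 1 := by positivity
  have hT0 : 0 < T := by linarith
  have hw := wgtConst_pos
  have hpi := Real.pi_gt_three
  rw [norm_coef_eq]
  have h1 := norm_wgt_le hk (Real.log ((n : ℝ) + 1) - Real.log (T / (2 * Real.pi)) / 2)
  have hlog : Real.log (T / (2 * Real.pi)) ≤ Real.log T :=
    Real.log_le_log (by positivity) (div_le_self hT0.le (by linarith))
  have h2 : Real.exp (-(k * (Real.log ((n : ℝ) + 1) - Real.log (T / (2 * Real.pi)) / 2))) ≤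
      T ^ (k / 2) * ((n : ℝ) + 1) ^ (-k) := by
    rw [Real.rpow_def_of_pos hT0, Real.rpow_def_of_pos hn, ← Real.exp_add]
    refine Real.exp_le_exp.mpr ?_
    nlinarith
  calc _ ≤ ((n : ℝ) + 1) ^ (-(1 / 2) : ℝ) * (wgtConst * Real.exp (2 * k ^ 2) *
        (T ^ (k / 2) * ((n : ℝ) + 1) ^ (-k))) := by gcongr; exact h1.trans (by gcongr)
    _ = wgtConst * Real.exp (2 * k ^ 2) * T ^ (k / 2) *
        (((n : ℝ) + 1) ^ (-(1 / 2) : ℝ) * ((n : ℝ) + 1) ^ (-k)) := by ring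
    _ = _ := by rw [← Real.rpow_add hn]; ring_nf

/-- Length of the approximating Dirichlet polynomial. -/
noncomputable def len (ε T : ℝ) : ℕ := ⌈T ^ (1 / 2 + ε)⌉₊

theorem norm_main_sub_dpoly_le {ε T : ℝ} (hε : 0 < ε) (hε1 : ε ≤ 1 / 2) (hT : 1 ≤ T) (u : ℝ) :
    ‖(∫ y : ℝ, mainKernel T y * riemannZeta (critPt u + linePt y) *
        Complex.exp (linePt y ^ 2) / linePt y) - dpoly T (len ε T) u‖ ≤
      wgtConst * Real.exp (2 * (3 / ε) ^ 2) * (∑' n : ℕ, 1 / ((n : ℝ) + 1) ^ (2 : ℝ)) * T⁻¹ := by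
  have hT0 : 0 < T := by linarith
  have hs := hasSum_mainKernel hT u
  have hw := wgtConst_pos
  rw [← hs.tsum_eq, ← hs.summable.sum_add_tsum_nat_add (len ε T), dpoly, add_sub_cancel_left]
  set k := 3 / ε with hk
  have hk6 : 6 ≤ k := by rw [hk, le_div_iff₀ hε]; linarith
  have hkε : k * ε = 3 := by rw [hk]; field_simp
  rw [mul_right_comm]
  refine tsum_of_norm_bounded ((summable_inv_rpow (p := 2) (by norm_num)).hasSum.mul_left _)
    fun n => ?_
  have hexp : ∀ x : ℝ, ‖Complex.exp (-(x : ℝ) * Complex.I)‖ = 1 := fun x => by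
    rw [← Complex.ofReal_neg, Complex.norm_exp_ofReal_mul_I]
  rw [norm_mul, hexp, mul_one]
  refine (norm_coef_le_rpow hT (by linarith : 0 ≤ k) _).trans ?_
  set m : ℝ := ((n + len ε T : ℕ) : ℝ) + 1 with hm
  set X := T ^ (1 / 2 + ε) with hX
  have hX0 : 0 < X := by positivity
  have hXm : X ≤ m := by
    have : X ≤ (len ε T : ℝ) := Nat.le_ceil _
    rw [hm]
    push_cast
    have : (0 : ℝ) ≤ n := by positivity
    linarith
  have hnm : (n : ℝ) + 1 ≤ m := by
    rw [hm]
    push_cast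
    have : (0 : ℝ) ≤ len ε T := by positivity
    linarith
  have hm0 : 0 < m := hX0.trans_le hXm
  have h1 : m ^ (-(1 / 2) - k) ≤ 1 / ((n : ℝ) + 1) ^ (2 : ℝ) * X ^ (3 / 2 - k) := by
    have e : -(1 / 2) - k = -2 + (3 / 2 - k) := by ring
    rw [e, Real.rpow_add hm0, Real.rpow_neg hm0.le, ← one_div]
    have hpow : m ^ (3 / 2 - k) ≤ X ^ (3 / 2 - k) :=
      Real.rpow_le_rpow_of_nonpos hX0 hXm (by linarith)
    have hsq : 1 / m ^ (2 : ℝ) ≤ 1 / ((n : ℝ) + 1) ^ (2 : ℝ) :=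
      one_div_le_one_div_of_le (by positivity)
        (Real.rpow_le_rpow (by positivity) hnm (by norm_num))
    exact mul_le_mul hsq hpow (by positivity) (by positivity)
  have h2 : T ^ (k / 2) * X ^ (3 / 2 - k) ≤ T⁻¹ := by
    rw [hX, ← Real.rpow_mul hT0.le, ← Real.rpow_add hT0, ← Real.rpow_neg_one]
    refine Real.rpow_le_rpow_of_exponent_le hT ?_
    nlinarith
  calc wgtConst * Real.exp (2 * k ^ 2) * T ^ (k / 2) * m ^ (-(1 / 2) - k)
      ≤ wgtConst * Real.exp (2 * k ^ 2) * T ^ (k / 2) *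
        (1 / ((n : ℝ) + 1) ^ (2 : ℝ) * X ^ (3 / 2 - k)) := by gcongr
    _ = wgtConst * Real.exp (2 * k ^ 2) * (T ^ (k / 2) * X ^ (3 / 2 - k)) *
        (1 / ((n : ℝ) + 1) ^ (2 : ℝ)) := by ring
    _ ≤ _ := by gcongr

/-- Approximate functional equation in short intervals. -/
theorem exists_afe {a ε : ℝ} (ha : a ≤ 3 / 5) (ha0 : 0 ≤ a) (hε : 0 < ε) (hε1 : ε ≤ 1 / 2) :
    ∃ C > (0 : ℝ), ∀ᶠ T : ℝ in atTop, ∀ u : ℝ, |u - T| ≤ 3 * T ^ a →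
      ‖2 * Real.pi * riemannZeta (critPt u) -
        (dpoly T (len ε T) u + chi u * conj (dpoly T (len ε T) u))‖ ≤ C * T ^ (-(1 / 10) : ℝ) := by
  obtain ⟨C, hC, h⟩ := exists_norm_halfZeta_sub_le
  set S := ∑' n : ℕ, 1 / ((n : ℝ) + 1) ^ (2 : ℝ) with hS
  have hS0 : 0 ≤ S := tsum_nonneg fun n => by positivity
  have hw := wgtConst_pos
  set K := wgtConst * Real.exp (2 * (3 / ε) ^ 2) * S with hK
  have hK0 : 0 ≤ K := by positivity
  refine ⟨2 * (3 * C + K), by positivity, ?_⟩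
  have hev : ∀ᶠ T : ℝ in atTop, 12 ≤ T ^ (2 / 5 : ℝ) :=
    (tendsto_rpow_atTop (by norm_num)).eventually_ge_atTop 12
  filter_upwards [eventually_ge_atTop 2000, hev] with T hT h12 u hu
  have hT1 : 1 ≤ T := by linarith
  have hT0 : 0 < T := by linarith
  have hTa : 1 ≤ T ^ a := Real.one_le_rpow hT1 ha0
  have hTa2 : T ^ a ≤ T ^ (3 / 5 : ℝ) := Real.rpow_le_rpow_of_exponent_le hT1 ha
  have hT35 : T ^ (3 / 5 : ℝ) * T ^ (2 / 5 : ℝ) = T := by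
    rw [← Real.rpow_add hT0]; norm_num
  have h35 : 0 < T ^ (3 / 5 : ℝ) := by positivity
  have h1 := h T (3 * T ^ a) u hT (by linarith) (by nlinarith) hu
  have h2 := norm_main_sub_dpoly_le hε hε1 hT1 u
  rw [← hS, ← hK] at h2
  have h10 : T⁻¹ ≤ T ^ (-(1 / 10) : ℝ) := by
    rw [← Real.rpow_neg_one]
    exact Real.rpow_le_rpow_of_exponent_le hT1 (by norm_num)
  have h3 : T ^ (3 / 10 : ℝ) * (3 * T ^ a / T) ≤ 3 * T ^ (-(1 / 10) : ℝ) := by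
    have e : T ^ (-(1 / 10) : ℝ) = T ^ (3 / 10 : ℝ) * (T ^ (3 / 5 : ℝ) * T⁻¹) := by
      rw [← Real.rpow_neg_one, ← Real.rpow_add hT0, ← Real.rpow_add hT0]; norm_num
    rw [e, div_eq_mul_inv (3 * T ^ a) T]
    have : T ^ (3 / 10 : ℝ) * (3 * T ^ a * T⁻¹) ≤ T ^ (3 / 10 : ℝ) * (3 * T ^ (3 / 5 : ℝ) * T⁻¹) := by
      gcongr
    linarith
  have h4 : ‖halfZeta u - dpoly T (len ε T) u‖ ≤ (3 * C + K) * T ^ (-(1 / 10) : ℝ) := by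
    have h5 := norm_add_le (halfZeta u - ∫ y : ℝ, mainKernel T y *
      riemannZeta (critPt u + linePt y) * Complex.exp (linePt y ^ 2) / linePt y)
      ((∫ y : ℝ, mainKernel T y * riemannZeta (critPt u + linePt y) *
        Complex.exp (linePt y ^ 2) / linePt y) - dpoly T (len ε T) u)
    rw [sub_add_sub_cancel] at h5
    have h6 : C * T ^ (3 / 10 : ℝ) * (3 * T ^ a / T) ≤ C * (3 * T ^ (-(1 / 10) : ℝ)) := by
      rw [mul_assoc]; gcongr
    have h7 : K * T⁻¹ ≤ K * T ^ (-(1 / 10) : ℝ) := by gcongr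
    linarith
  rw [two_pi_zeta]
  have e : halfZeta u + chi u * conj (halfZeta u) -
      (dpoly T (len ε T) u + chi u * conj (dpoly T (len ε T) u)) =
      (halfZeta u - dpoly T (len ε T) u) + chi u * conj (halfZeta u - dpoly T (len ε T) u) := by
    rw [map_sub]; ring
  rw [e]
  refine (norm_add_le _ _).trans ?_
  rw [norm_mul, norm_chi, RCLike.norm_conj]
  linarith

theorem sum_range_inv_add_one_le {n N : ℕ} (h : n ≤ N) :
    ∑ j ∈ Finset.range n, 1 / ((j : ℝ) + 1) ≤ 1 + Real.log N := by
  have h1 := harmonic_le_one_add_log N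
  have h2 : ((harmonic N : ℚ) : ℝ) = ∑ j ∈ Finset.range N, 1 / ((j : ℝ) + 1) := by
    simp [harmonic]
  rw [h2] at h1
  exact (Finset.sum_le_sum_of_subset_of_nonneg (Finset.range_mono h)
    fun _ _ _ => by positivity).trans h1

theorem sum_inv_abs_sub_le {m N : ℕ} (hm : m < N) :
    ∑ n ∈ Finset.range N, 1 / |(m : ℝ) - n| ≤ 2 * (1 + Real.log N) := by
  rw [← Finset.sum_range_add_sum_Ico _ hm.le, Finset.sum_Ico_eq_sum_range,
    ← Finset.sum_range_reflect]
  have h1 : ∑ j ∈ Finset.range m, 1 / |(m : ℝ) - ((m - 1 - j : ℕ) : ℝ)| ≤ 1 + Real.log N := by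
    refine le_trans (le_of_eq (Finset.sum_congr rfl fun j hj => ?_)) (sum_range_inv_add_one_le hm.le)
    have hj' : j + 1 ≤ m := Finset.mem_range.mp hj
    have e : m - 1 - j = m - (j + 1) := by omega
    rw [e, Nat.cast_sub hj', sub_sub_cancel, abs_of_nonneg (by positivity)]
    push_cast
    rfl
  have h2 : ∑ j ∈ Finset.range (N - m), 1 / |(m : ℝ) - ((m + j : ℕ) : ℝ)| ≤ 1 + Real.log N := by
    obtain ⟨k, hk⟩ : ∃ k, N - m = k + 1 := ⟨N - m - 1, by omega⟩
    rw [hk, Finset.sum_range_succ']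
    refine le_trans (le_of_eq ?_) (sum_range_inv_add_one_le (by omega : k ≤ N))
    simp only [Nat.cast_add, add_zero, sub_self, abs_zero, div_zero, Nat.cast_one]
    refine Finset.sum_congr rfl fun j _ => ?_
    have e : (m : ℝ) - (m + (j + 1)) = -((j : ℝ) + 1) := by ring
    rw [e, abs_neg, abs_of_nonneg (by positivity)]
  linarith

theorem inv_abs_log_sub_le {m n N : ℕ} (hm : m < N) (hn : n < N) (hmn : m ≠ n) :
    1 / |Real.log ((m : ℝ) + 1) - Real.log ((n : ℝ) + 1)| ≤ N * (1 / |(m : ℝ) - n|) := by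
  wlog h : n < m generalizing m n
  · have := this hn hm hmn.symm (by omega)
    rwa [abs_sub_comm, abs_sub_comm (n : ℝ)] at this
  have hn0 : (0 : ℝ) < (n : ℝ) + 1 := by positivity
  have hm0 : (0 : ℝ) < (m : ℝ) + 1 := by positivity
  have hN : (m : ℝ) + 1 ≤ N := by exact_mod_cast hm
  have hd : (0 : ℝ) < (m : ℝ) - n := by
    have : (n : ℝ) < m := by exact_mod_cast h
    linarith
  have h1 : ((m : ℝ) - n) / N ≤ Real.log ((m : ℝ) + 1) - Real.log ((n : ℝ) + 1) := by
    rw [← Real.log_div hm0.ne' hn0.ne']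
    have := Real.one_sub_inv_le_log_of_pos (div_pos hm0 hn0)
    refine le_trans ?_ this
    rw [inv_div, one_sub_div hm0.ne', add_sub_add_right_eq_sub]
    gcongr
  have hN0 : (0 : ℝ) < N := by linarith
  have hp : 0 < ((m : ℝ) - n) / N := by positivity
  rw [abs_of_pos hd, abs_of_pos (hp.trans_le h1)]
  calc _ ≤ 1 / (((m : ℝ) - n) / N) := one_div_le_one_div_of_le hp h1
    _ = _ := by field_simp

theorem norm_integral_exp_mul_I_le {x : ℝ} (hx : x ≠ 0) (a b : ℝ) :
    ‖∫ t in a..b, Complex.exp ((t * x : ℝ) * Complex.I)‖ ≤ 2 * (1 / |x|) := by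
  have hc : (x : ℂ) * Complex.I ≠ 0 := by simp [hx]
  have e : ∀ t : ℝ, Complex.exp ((t * x : ℝ) * Complex.I) = Complex.exp ((x * Complex.I) * t) :=
    fun t => by push_cast; ring_nf
  simp_rw [e]
  rw [integral_exp_mul_complex hc, norm_div, norm_mul, Complex.norm_I, mul_one, Complex.norm_real,
    Real.norm_eq_abs]
  have hb : ∀ t : ℝ, ‖Complex.exp ((x * Complex.I) * t)‖ = 1 := fun t => by
    rw [← e, Complex.norm_exp_ofReal_mul_I]
  have := norm_sub_le (Complex.exp ((x * Complex.I) * b)) (Complex.exp ((x * Complex.I) * a))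
  rw [hb, hb] at this
  rw [mul_one_div]
  gcongr
  linarith

/-- Mean value theorem for Dirichlet polynomials. -/
theorem integral_norm_sq_dirichlet_le (c : ℕ → ℂ) (N : ℕ) (T : ℝ) {U : ℝ} (hU : 0 ≤ U) :
    ∫ t in T..(T + U), ‖∑ n ∈ Finset.range N, c n *
        Complex.exp (-(t * Real.log ((n : ℝ) + 1) : ℝ) * Complex.I)‖ ^ 2 ≤
      (U + 4 * N * (1 + Real.log N)) * ∑ n ∈ Finset.range N, ‖c n‖ ^ 2 := by
  set K : ℕ → ℕ → ℝ := fun m n =>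
    ‖∫ t in T..(T + U), Complex.exp ((t * (Real.log ((n : ℝ) + 1) - Real.log ((m : ℝ) + 1)) : ℝ)
      * Complex.I)‖ with hK
  have hsq : ∀ t : ℝ, ((‖∑ n ∈ Finset.range N, c n *
        Complex.exp (-(t * Real.log ((n : ℝ) + 1) : ℝ) * Complex.I)‖ ^ 2 : ℝ) : ℂ) =
      ∑ m ∈ Finset.range N, ∑ n ∈ Finset.range N, c m * conj (c n) * Complex.exp
        ((t * (Real.log ((n : ℝ) + 1) - Real.log ((m : ℝ) + 1)) : ℝ) * Complex.I) := by
    intro t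
    push_cast
    rw [← Complex.mul_conj', map_sum, Finset.sum_mul_sum]
    refine Finset.sum_congr rfl fun m _ => Finset.sum_congr rfl fun n _ => ?_
    rw [map_mul, ← Complex.exp_conj, mul_mul_mul_comm, ← Complex.exp_add]
    simp only [map_mul, map_neg, Complex.conj_ofReal, Complex.conj_I]
    congr 2
    ring
  have hK1 : ∀ m ∈ Finset.range N, ∑ n ∈ Finset.range N, K m n ≤
      U + 4 * N * (1 + Real.log N) := by
    intro m hm
    have hm' := Finset.mem_range.mp hm
    have h1 : ∀ n ∈ Finset.range N, K m n ≤ (if n = m then U else 0) +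
        2 * N * (1 / |(m : ℝ) - n|) := by
      intro n hn
      by_cases h : n = m
      · subst h
        simp [hK, abs_of_nonneg hU]
      · rw [if_neg h, zero_add]
        have h2 := inv_abs_log_sub_le hm' (Finset.mem_range.mp hn) (Ne.symm h)
        have hne : Real.log ((n : ℝ) + 1) - Real.log ((m : ℝ) + 1) ≠ 0 := by
          intro h0
          have := Real.log_injOn_pos (Set.mem_Ioi.mpr (by positivity))
            (Set.mem_Ioi.mpr (by positivity)) (sub_eq_zero.mp h0)
          exact h (by exact_mod_cast add_right_cancel this)
        have h3 := norm_integral_exp_mul_I_le hne T (T + U)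
        rw [abs_sub_comm] at h2
        simp only [hK]
        linarith
    refine (Finset.sum_le_sum h1).trans ?_
    rw [Finset.sum_add_distrib, Finset.sum_ite_eq' , if_pos hm, ← Finset.mul_sum]
    have := sum_inv_abs_sub_le hm'
    have hN : (0 : ℝ) ≤ 2 * N := by positivity
    nlinarith
  have hsymm : ∀ m n, K m n = K n m := by
    intro m n
    simp only [hK]
    rw [← RCLike.norm_conj, ← intervalIntegral.intervalIntegral_conj]
    congr 1
    refine intervalIntegral.integral_congr fun t _ => ?_
    simp only [← Complex.exp_conj, map_mul, Complex.conj_ofReal, Complex.conj_I]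
    congr 1
    push_cast
    ring
  have hint : ((∫ t in T..(T + U), ‖∑ n ∈ Finset.range N, c n *
        Complex.exp (-(t * Real.log ((n : ℝ) + 1) : ℝ) * Complex.I)‖ ^ 2 : ℝ) : ℂ) =
      ∑ m ∈ Finset.range N, ∑ n ∈ Finset.range N, c m * conj (c n) *
        ∫ t in T..(T + U), Complex.exp
        ((t * (Real.log ((n : ℝ) + 1) - Real.log ((m : ℝ) + 1)) : ℝ) * Complex.I) := by
    rw [← intervalIntegral.integral_ofReal]
    simp_rw [hsq]
    rw [intervalIntegral.integral_finsetSum]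
    · refine Finset.sum_congr rfl fun m _ => ?_
      rw [intervalIntegral.integral_finsetSum]
      · refine Finset.sum_congr rfl fun n _ => ?_
        rw [intervalIntegral.integral_const_mul]
      · intro n _
        exact Continuous.intervalIntegrable (by fun_prop) _ _
    · intro m _
      exact Continuous.intervalIntegrable (by fun_prop) _ _
  have hle := Complex.re_le_norm ((∫ t in T..(T + U), ‖∑ n ∈ Finset.range N, c n *
        Complex.exp (-(t * Real.log ((n : ℝ) + 1) : ℝ) * Complex.I)‖ ^ 2 : ℝ) : ℂ)
  rw [Complex.ofReal_re, hint] at hle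
  have hT : ∑ m ∈ Finset.range N, ∑ n ∈ Finset.range N, ‖c m‖ ^ 2 * K m n ≤
      (U + 4 * N * (1 + Real.log N)) * ∑ n ∈ Finset.range N, ‖c n‖ ^ 2 := by
    rw [Finset.mul_sum]
    refine Finset.sum_le_sum fun m hm => ?_
    rw [← Finset.mul_sum, mul_comm]
    exact mul_le_mul_of_nonneg_right (hK1 m hm) (by positivity)
  have hT' : ∑ m ∈ Finset.range N, ∑ n ∈ Finset.range N, ‖c n‖ ^ 2 * K m n =
      ∑ m ∈ Finset.range N, ∑ n ∈ Finset.range N, ‖c m‖ ^ 2 * K m n := by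
    rw [Finset.sum_comm]
    simp_rw [hsymm]
  calc _ ≤ _ := hle
    _ ≤ ∑ m ∈ Finset.range N, ∑ n ∈ Finset.range N, ‖c m‖ * ‖c n‖ * K m n := by
      refine (norm_sum_le _ _).trans (Finset.sum_le_sum fun m _ => ?_)
      refine (norm_sum_le _ _).trans (Finset.sum_le_sum fun n _ => ?_)
      rw [norm_mul, norm_mul, RCLike.norm_conj]
    _ ≤ ∑ m ∈ Finset.range N, ∑ n ∈ Finset.range N,
        (1 / 2 * (‖c m‖ ^ 2 * K m n) + 1 / 2 * (‖c n‖ ^ 2 * K m n)) := by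
      refine Finset.sum_le_sum fun m _ => Finset.sum_le_sum fun n _ => ?_
      have hk0 : 0 ≤ K m n := norm_nonneg _
      nlinarith [mul_nonneg hk0 (sq_nonneg (‖c m‖ - ‖c n‖))]
    _ = ∑ m ∈ Finset.range N, ∑ n ∈ Finset.range N, ‖c m‖ ^ 2 * K m n := by
      simp_rw [Finset.sum_add_distrib, ← Finset.mul_sum]
      simp_rw [← Finset.mul_sum] at hT'
      rw [hT']
      ring
    _ ≤ _ := hT

/-- The integral `∫₀ᴴ exp (i v x) dv`. -/
noncomputable def osc (H x : ℝ) : ℂ := ∫ v in (0 : ℝ)..H, Complex.exp ((v * x : ℝ) * Complex.I)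

theorem norm_osc_le {H : ℝ} (hH : 0 ≤ H) (x : ℝ) : ‖osc H x‖ ≤ H := by
  have := intervalIntegral.norm_integral_le_of_norm_le_const (a := 0) (b := H) (C := 1)
    (f := fun v : ℝ => Complex.exp ((v * x : ℝ) * Complex.I))
    fun v _ => (Complex.norm_exp_ofReal_mul_I _).le
  rwa [sub_zero, one_mul, abs_of_nonneg hH] at this

theorem norm_osc_sq_le_inv {x : ℝ} (hx : x ≠ 0) (H : ℝ) : ‖osc H x‖ ^ 2 ≤ 4 / x ^ 2 := by
  have h := norm_integral_exp_mul_I_le hx 0 H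
  calc ‖osc H x‖ ^ 2 ≤ (2 * (1 / |x|)) ^ 2 := by rw [osc]; gcongr
    _ = 4 / x ^ 2 := by rw [mul_one_div, div_pow, sq_abs]; norm_num

theorem norm_osc_sq_le {H : ℝ} (hH : 0 ≤ H) (x : ℝ) :
    ‖osc H x‖ ^ 2 ≤ 8 * (H ^ 2 / (1 + (H * x) ^ 2)) := by
  have hp : 0 < 1 + (H * x) ^ 2 := by positivity
  rw [mul_div_assoc', le_div_iff₀ hp]
  have h1 : ‖osc H x‖ ^ 2 ≤ H ^ 2 := by
    have := norm_osc_le hH x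
    gcongr
  have h2 : ‖osc H x‖ ^ 2 * x ^ 2 ≤ 4 := by
    rcases eq_or_ne x 0 with rfl | hx
    · norm_num
    · rw [← le_div_iff₀ (by positivity)]
      exact norm_osc_sq_le_inv hx H
  nlinarith [sq_nonneg H, mul_le_mul_of_nonneg_left h2 (sq_nonneg H)]

theorem sub_le_arctan_sub {x y : ℝ} (hxy : x < y) (h1 : y - x ≤ 1) :
    (y - x) / (1 + x ^ 2) ≤ 3 * (Real.arctan y - Real.arctan x) := by
  obtain ⟨c, hc, he⟩ := exists_hasDerivAt_eq_slope Real.arctan (fun z => 1 / (1 + z ^ 2)) hxy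
    Real.continuous_arctan.continuousOn fun z _ => Real.hasDerivAt_arctan z
  have hd : 0 < y - x := by linarith
  rw [eq_div_iff hd.ne'] at he
  rw [← he, mul_comm (1 / _), mul_one_div, mul_div_assoc']
  rw [div_le_div_iff₀ (by positivity) (by positivity)]
  have h2 : 1 + c ^ 2 ≤ 3 * (1 + x ^ 2) := by
    have h3 : 0 ≤ c - x := by linarith [hc.1]
    have h4 : c - x ≤ 1 := by linarith [hc.2]
    nlinarith [sq_nonneg (2 * x - c)]
  nlinarith

theorem sum_log_kernel_le {H : ℝ} (hH : 0 < H) (x : ℝ) {m N : ℕ} (hm : H ≤ (m : ℝ) + 1) :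
    ∑ n ∈ Finset.Ico m N, 1 / ((n : ℝ) + 1) *
      (H ^ 2 / (1 + (H * (Real.log ((n : ℝ) + 1) - x)) ^ 2)) ≤ 6 * H * Real.pi := by
  rcases le_or_gt N m with h | hmN
  · rw [Finset.Ico_eq_empty_of_le h, Finset.sum_empty]
    have := Real.pi_pos
    positivity
  set g : ℕ → ℝ := fun n => Real.arctan (H * (Real.log ((n : ℝ) + 1) - x)) with hg
  have hterm : ∀ n ∈ Finset.Ico m N, 1 / ((n : ℝ) + 1) *
      (H ^ 2 / (1 + (H * (Real.log ((n : ℝ) + 1) - x)) ^ 2)) ≤ 6 * H * (g (n + 1) - g n) := by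
    intro n hn
    have hmn : (m : ℝ) ≤ n := by exact_mod_cast (Finset.mem_Ico.mp hn).1
    have hn0 : (0 : ℝ) < (n : ℝ) + 1 := by positivity
    have hn1 : (0 : ℝ) < (n : ℝ) + 1 + 1 := by positivity
    set d := Real.log ((n : ℝ) + 1 + 1) - Real.log ((n : ℝ) + 1) with hd
    have hd' : d = Real.log (((n : ℝ) + 1 + 1) / ((n : ℝ) + 1)) := by
      rw [Real.log_div hn1.ne' hn0.ne']
    have hdu : d ≤ 1 / ((n : ℝ) + 1) := by
      have := Real.log_le_sub_one_of_pos (div_pos hn1 hn0)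
      rw [hd']
      refine this.trans (le_of_eq ?_)
      field_simp
      ring
    have hdl : 1 / ((n : ℝ) + 1) ≤ 2 * d := by
      have := Real.one_sub_inv_le_log_of_pos (div_pos hn1 hn0)
      rw [← hd', inv_div, one_sub_div hn1.ne'] at this
      have h3 : 1 / ((n : ℝ) + 1) ≤ 2 * (((n : ℝ) + 1 + 1 - ((n : ℝ) + 1)) / ((n : ℝ) + 1 + 1)) := by
        rw [mul_div_assoc', div_le_div_iff₀ hn0 hn1]
        have : (0 : ℝ) ≤ n := by positivity
        linarith
      linarith
    have hd0 : 0 < d := by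
      have : 0 < 1 / ((n : ℝ) + 1) := by positivity
      linarith
    have hHd : H * d ≤ 1 := by
      calc H * d ≤ ((n : ℝ) + 1) * (1 / ((n : ℝ) + 1)) :=
            mul_le_mul (by linarith) hdu hd0.le hn0.le
        _ = 1 := by field_simp
    set X := H * (Real.log ((n : ℝ) + 1) - x) with hX
    have hY : H * (Real.log (((n + 1 : ℕ) : ℝ) + 1) - x) = X + H * d := by
      rw [hX, hd]; push_cast; ring
    have key := sub_le_arctan_sub (x := X) (y := X + H * d) (by nlinarith) (by linarith)
    rw [add_sub_cancel_left] at key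
    have hgn : g (n + 1) - g n = Real.arctan (X + H * d) - Real.arctan X := by
      simp only [hg]; rw [hY]
    rw [hgn]
    calc 1 / ((n : ℝ) + 1) * (H ^ 2 / (1 + X ^ 2)) ≤ 2 * d * (H ^ 2 / (1 + X ^ 2)) :=
          mul_le_mul_of_nonneg_right hdl (by positivity)
      _ = 2 * H * (H * d / (1 + X ^ 2)) := by ring
      _ ≤ 2 * H * (3 * (Real.arctan (X + H * d) - Real.arctan X)) :=
          mul_le_mul_of_nonneg_left key (by positivity)
      _ = _ := by ring
  refine (Finset.sum_le_sum hterm).trans ?_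
  rw [← Finset.mul_sum, Finset.sum_Ico_sub _ hmN.le]
  have h1 := Real.arctan_lt_pi_div_two (H * (Real.log ((N : ℝ) + 1) - x))
  have h2 := Real.neg_pi_div_two_lt_arctan (H * (Real.log ((m : ℝ) + 1) - x))
  refine mul_le_mul_of_nonneg_left ?_ (by positivity)
  simp only [hg]
  linarith

theorem sum_osc_sq_le {H x : ℝ} (hH : 1 ≤ H) (hx : Real.log (H + 1) + 1 ≤ x) (N : ℕ) :
    ∑ n ∈ Finset.range N, 1 / ((n : ℝ) + 1) * ‖osc H (x - Real.log ((n : ℝ) + 1))‖ ^ 2 ≤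
      400 * H := by
  set m := ⌈H⌉₊ with hm
  have hHm : H ≤ (m : ℝ) := Nat.le_ceil _
  have hmH : (m : ℝ) < H + 1 := Nat.ceil_lt_add_one (by linarith)
  have hpi := Real.pi_lt_d2
  have h1 : ∑ n ∈ Finset.range m, 1 / ((n : ℝ) + 1) * ‖osc H (x - Real.log ((n : ℝ) + 1))‖ ^ 2 ≤
      4 * (1 + Real.log m) := by
    refine le_trans ?_ (mul_le_mul_of_nonneg_left (sum_range_inv_add_one_le (le_refl m))
      (by norm_num))
    rw [Finset.mul_sum]
    refine Finset.sum_le_sum fun n hn => ?_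
    have hn' : (n : ℝ) + 1 ≤ m := by exact_mod_cast Finset.mem_range.mp hn
    have hl : Real.log ((n : ℝ) + 1) ≤ Real.log (H + 1) :=
      Real.log_le_log (by positivity) (by linarith)
    have hx1 : 1 ≤ x - Real.log ((n : ℝ) + 1) := by linarith
    have h2 := norm_osc_sq_le_inv (by linarith : x - Real.log ((n : ℝ) + 1) ≠ 0) H
    have h3 : 4 / (x - Real.log ((n : ℝ) + 1)) ^ 2 ≤ 4 :=
      div_le_self (by norm_num) (one_le_pow₀ hx1)
    rw [mul_comm]
    exact mul_le_mul_of_nonneg_right (h2.trans h3) (by positivity)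
  have h2 : ∑ n ∈ Finset.Ico m N, 1 / ((n : ℝ) + 1) *
      ‖osc H (x - Real.log ((n : ℝ) + 1))‖ ^ 2 ≤ 8 * (6 * H * Real.pi) := by
    refine le_trans ?_ (mul_le_mul_of_nonneg_left
      (sum_log_kernel_le (by linarith) x (by linarith : H ≤ (m : ℝ) + 1) (N := N)) (by norm_num))
    rw [Finset.mul_sum]
    refine Finset.sum_le_sum fun n _ => ?_
    have := norm_osc_sq_le (by linarith : 0 ≤ H) (x - Real.log ((n : ℝ) + 1))
    have e : (H * (x - Real.log ((n : ℝ) + 1))) ^ 2 = (H * (Real.log ((n : ℝ) + 1) - x)) ^ 2 := by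
      ring
    rw [e] at this
    calc _ ≤ _ := mul_le_mul_of_nonneg_left this (by positivity)
      _ = _ := by ring
  have hlog : Real.log m ≤ m - 1 := Real.log_le_sub_one_of_pos (by linarith)
  have h3 : ∑ n ∈ Finset.range N, 1 / ((n : ℝ) + 1) *
      ‖osc H (x - Real.log ((n : ℝ) + 1))‖ ^ 2 ≤ ∑ n ∈ Finset.range m ∪ Finset.Ico m N,
      1 / ((n : ℝ) + 1) * ‖osc H (x - Real.log ((n : ℝ) + 1))‖ ^ 2 := by
    refine Finset.sum_le_sum_of_subset_of_nonneg ?_ fun _ _ _ => by positivity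
    intro n hn
    simp only [Finset.mem_union, Finset.mem_range, Finset.mem_Ico] at hn ⊢
    omega
  rw [Finset.sum_union (by
    rw [Finset.disjoint_left]; intro n; simp only [Finset.mem_range, Finset.mem_Ico]; omega)] at h3
  nlinarith

theorem sum_osc_log_sq_le {H : ℝ} (hH : 1 ≤ H) (N : ℕ) :
    ∑ n ∈ Finset.Ico 1 N, 1 / ((n : ℝ) + 1) * ‖osc H (-Real.log ((n : ℝ) + 1))‖ ^ 2 ≤
      400 * H := by
  have hpi := Real.pi_lt_d2
  have hl2 := Real.log_two_gt_d9
  have h := sum_log_kernel_le one_pos 0 (by norm_num : (1 : ℝ) ≤ ((1 : ℕ) : ℝ) + 1) (N := N)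
  have h1 : ∑ n ∈ Finset.Ico 1 N, 1 / ((n : ℝ) + 1) * ‖osc H (-Real.log ((n : ℝ) + 1))‖ ^ 2 ≤
      16 * (6 * 1 * Real.pi) := by
    refine le_trans ?_ (mul_le_mul_of_nonneg_left h (by norm_num))
    rw [Finset.mul_sum]
    refine Finset.sum_le_sum fun n hn => ?_
    have hn1 : (1 : ℝ) ≤ n := by exact_mod_cast (Finset.mem_Ico.mp hn).1
    have hl : Real.log 2 ≤ Real.log ((n : ℝ) + 1) := Real.log_le_log (by norm_num) (by linarith)
    set y := Real.log ((n : ℝ) + 1) with hy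
    have h2 := norm_osc_sq_le_inv (by linarith : -y ≠ 0) H
    have h3 : 4 / (-y) ^ 2 ≤ 16 * (1 ^ 2 / (1 + (1 * (y - 0)) ^ 2)) := by
      rw [mul_div_assoc', div_le_div_iff₀ (by nlinarith) (by positivity)]
      nlinarith
    calc _ ≤ _ := mul_le_mul_of_nonneg_left (h2.trans h3) (by positivity)
      _ = _ := by ring
  linarith

/-- Half the logarithm of `T / 2π`. -/
noncomputable def freq (T : ℝ) : ℝ := Real.log (T / (2 * Real.pi)) / 2

/-- The deviation of `Γ_ℝ(1/2 + i (t + v)) / Γ_ℝ(1/2 + i t)` from its expected size and phase. -/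
noncomputable def phaseErr (T t v : ℝ) : ℂ :=
  Complex.Gammaℝ (critPt (t + v)) / Complex.Gammaℝ (critPt t) * (Real.exp (Real.pi / 4 * v) : ℝ) *
    Complex.exp (-(v * freq T : ℝ) * Complex.I)

theorem critPt_add (t v : ℝ) : critPt (t + v) = critPt t + v * Complex.I := by
  simp only [critPt]; push_cast; ring

theorem phaseErr_eq {T : ℝ} (hT : 0 < T) (t v : ℝ) : phaseErr T t v =
    (Complex.Gamma (critPt t / 2 + v * Complex.I / 2) / Complex.Gamma (critPt t / 2) *
      Complex.exp (-(v * Complex.I / 2 * Complex.log (critPt t / 2)))) *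
      Complex.exp (v * Complex.I / 2 * (Complex.log (critPt t / 2) -
          ((Real.log (T / 2) : ℂ) + (Real.pi / 2 : ℝ) * Complex.I))) := by
  have hlog : freq T = (Real.log (T / 2) - Real.log Real.pi) / 2 := by
    rw [freq, ← div_div, Real.log_div (by positivity) Real.pi_ne_zero]
  rw [phaseErr, critPt_add, Gammaℝ_add_div, hlog, Complex.ofReal_exp]
  have h : ∀ a b c d e G : ℂ, a + b + c = d + e →
      Complex.exp a * G * Complex.exp b * Complex.exp c = G * Complex.exp d * Complex.exp e := by
    intro a b c d e G h
    have h2 := congrArg Complex.exp h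
    rw [Complex.exp_add, Complex.exp_add, Complex.exp_add] at h2
    linear_combination G * h2
  apply h
  push_cast
  linear_combination ((v : ℂ) / 4 * Real.pi) * Complex.I_sq

theorem norm_phaseErr_sub_one_le {T Δ t v : ℝ} (hΔ : 1 ≤ Δ) (hT : 4 * Δ ≤ T) (ht : |t - T| ≤ Δ)
    (h8 : 8 ≤ T) (hv : 0 ≤ v) (hvT : 4 * v ≤ T) :
    ‖phaseErr T t v - 1‖ ≤ Real.exp ((8 * v + 4 * v ^ 2) * (Δ / T)) - 1 := by
  have hT0 : 0 < T := by linarith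
  have ht' := abs_le.mp ht
  have hw : ‖(v : ℂ) * Complex.I / 2‖ = v / 2 := by
    rw [norm_div, norm_mul, Complex.norm_I, Complex.norm_real, Real.norm_of_nonneg hv]
    norm_num
  have him : (critPt t / 2).im = t / 2 := by
    rw [show critPt t / 2 = critPt t / ((2 : ℝ) : ℂ) by norm_num, Complex.div_ofReal_im, critPt_im]
  have hre : (critPt t / 2).re = 1 / 4 := by
    rw [show critPt t / 2 = critPt t / ((2 : ℝ) : ℂ) by norm_num, Complex.div_ofReal_re, critPt_re]
    norm_num
  have h1 := gamma_ratio (z := critPt t / 2) (w := v * Complex.I / 2) (by rw [hre]; norm_num)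
    (by rw [him]; linarith) (by rw [hw, him]; linarith)
  rw [hw, him] at h1
  have h2 := norm_log_sub_le hΔ hT ht
  have h3 := norm_exp_sub_one_le_exp (v * Complex.I / 2 * (Complex.log (critPt t / 2) -
          ((Real.log (T / 2) : ℂ) + (Real.pi / 2 : ℝ) * Complex.I)))
  rw [norm_mul, hw] at h3
  have h4 : v / 2 * ‖Complex.log (critPt t / 2) -
      ((Real.log (T / 2) : ℂ) + (Real.pi / 2 : ℝ) * Complex.I)‖ ≤ v / 2 * (4 * (Δ / T)) :=
    mul_le_mul_of_nonneg_left h2 (by positivity)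
  rw [phaseErr_eq hT0]
  refine (norm_mul_sub_one_le_exp h1
    (h3.trans (sub_le_sub_right (Real.exp_le_exp.mpr h4) 1))).trans ?_
  refine sub_le_sub_right (Real.exp_le_exp.mpr ?_) 1
  have h5 : 1 / T ≤ Δ / T := by gcongr
  have h6 : 4 * (v / 2 + (v / 2) ^ 2) / (t / 2) ≤ (6 * v + 4 * v ^ 2) * (1 / T) := by
    have ht2 : 3 / 4 * T ≤ t := by linarith
    rw [mul_one_div, div_le_div_iff₀ (by linarith) hT0]
    have : (6 * v + 4 * v ^ 2) * (3 / 4 * T / 2) ≤ (6 * v + 4 * v ^ 2) * (t / 2) :=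
      mul_le_mul_of_nonneg_left (by linarith) (by positivity)
    nlinarith [mul_nonneg hv hT0.le, mul_nonneg (sq_nonneg v) hT0.le]
  have h7 : (6 * v + 4 * v ^ 2) * (1 / T) ≤ (6 * v + 4 * v ^ 2) * (Δ / T) :=
    mul_le_mul_of_nonneg_left h5 (by positivity)
  linarith

theorem phaseErr_ne_zero (T t v : ℝ) : phaseErr T t v ≠ 0 :=
  mul_ne_zero (mul_ne_zero (div_ne_zero (Gammaℝ_critPt_ne _) (Gammaℝ_critPt_ne _))
    (by exact_mod_cast (Real.exp_pos _).ne')) (Complex.exp_ne_zero _)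

theorem Gammaℝ_critPt_add (T t v : ℝ) : Complex.Gammaℝ (critPt (t + v)) =
    Complex.Gammaℝ (critPt t) * phaseErr T t v * (Real.exp (-(Real.pi / 4 * v)) : ℝ) *
      Complex.exp ((v * freq T : ℝ) * Complex.I) := by
  have h := Gammaℝ_critPt_ne t
  have e1 : Complex.exp (-(v * freq T : ℝ) * Complex.I) * Complex.exp ((v * freq T : ℝ) * Complex.I)
      = 1 := by rw [← Complex.exp_add]; simp
  have e2 : ((Real.exp (Real.pi / 4 * v) : ℝ) : ℂ) * (Real.exp (-(Real.pi / 4 * v)) : ℝ) = 1 := by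
    rw [← Complex.ofReal_mul, ← Real.exp_add]; simp
  rw [phaseErr]
  generalize Complex.exp (-(v * freq T : ℝ) * Complex.I) = x at *
  generalize Complex.exp ((v * freq T : ℝ) * Complex.I) = y at *
  generalize ((Real.exp (Real.pi / 4 * v) : ℝ) : ℂ) = p at *
  generalize ((Real.exp (-(Real.pi / 4 * v)) : ℝ) : ℂ) = q at *
  field_simp
  linear_combination (-Complex.Gammaℝ (critPt (t + v))) * e2 -
    Complex.Gammaℝ (critPt (t + v)) * p * q * e1

theorem norm_chi_add_sub_le {T t v η : ℝ} (h : ‖phaseErr T t v - 1‖ ≤ η) (hη : η ≤ 1 / 2) :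
    ‖chi (t + v) - chi t * Complex.exp (-(v * (2 * freq T) : ℝ) * Complex.I)‖ ≤ 4 * η := by
  set E := phaseErr T t v with hE
  have hE0 : E ≠ 0 := phaseErr_ne_zero T t v
  have hEn : 1 / 2 ≤ ‖E‖ := by
    have := norm_sub_norm_le (1 : ℂ) (1 - E)
    rw [sub_sub_cancel, norm_one, norm_sub_rev] at this
    linarith
  have hG := Gammaℝ_critPt_ne t
  have hx : ((Real.exp (-(Real.pi / 4 * v)) : ℝ) : ℂ) ≠ 0 := by
    exact_mod_cast (Real.exp_pos _).ne'
  have hq : conj (Complex.exp ((v * freq T : ℝ) * Complex.I)) =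
      Complex.exp (-(v * (2 * freq T) : ℝ) * Complex.I) *
        Complex.exp ((v * freq T : ℝ) * Complex.I) := by
    rw [← Complex.exp_add, ← Complex.exp_conj, map_mul, Complex.conj_ofReal, Complex.conj_I]
    congr 1
    push_cast
    ring
  have hchi : chi (t + v) = chi t * Complex.exp (-(v * (2 * freq T) : ℝ) * Complex.I) *
      (conj E / E) := by
    rw [chi, chi, Gammaℝ_critPt_add T t v, ← hE]
    simp only [map_mul, Complex.conj_ofReal]
    rw [hq]
    have := Complex.exp_ne_zero ((v * freq T : ℝ) * Complex.I)
    field_simp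
  have hle : ‖conj E / E - 1‖ ≤ 4 * η := by
    rw [div_sub_one hE0, norm_div, div_le_iff₀ (by linarith)]
    have h1 : conj E - E = conj (E - 1) - (E - 1) := by rw [map_sub, map_one]; ring
    have h2 := norm_sub_le (conj (E - 1)) (E - 1)
    rw [← h1, RCLike.norm_conj] at h2
    have : 0 ≤ η := (norm_nonneg _).trans h
    nlinarith
  have e : chi (t + v) - chi t * Complex.exp (-(v * (2 * freq T) : ℝ) * Complex.I) =
      chi t * Complex.exp (-(v * (2 * freq T) : ℝ) * Complex.I) * (conj E / E - 1) := by
    rw [hchi]; ring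
  rw [e, norm_mul, norm_mul, norm_chi, ← Complex.ofReal_neg, Complex.norm_exp_ofReal_mul_I]
  linarith

theorem continuous_critPt : Continuous critPt := by
  unfold critPt
  fun_prop

theorem continuous_zeta_critPt : Continuous fun u : ℝ => riemannZeta (critPt u) :=
  continuous_iff_continuousAt.mpr fun u =>
    ContinuousAt.comp (f := critPt) (differentiableAt_riemannZeta (critPt_ne_one u)).continuousAt
      continuous_critPt.continuousAt

theorem xi_critPt_re (u : ℝ) : ((xi (critPt u)).re : ℂ) = xi (critPt u) := by
  refine Complex.conj_eq_iff_re.mp ?_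
  rw [← xi_conj, ← one_sub_critPt, xi_one_sub]

theorem critPt_mul_sub_one (u : ℝ) : critPt u * (critPt u - 1) = ((-(1 / 4 + u ^ 2) : ℝ) : ℂ) := by
  simp only [critPt]
  push_cast
  linear_combination ((u : ℂ) ^ 2) * Complex.I_sq

theorem xi_critPt (u : ℝ) : ((xi (critPt u)).re : ℂ) = ((-(1 / 4 + u ^ 2) : ℝ) : ℂ) *
    Complex.Gammaℝ (critPt u) * riemannZeta (critPt u) := by
  rw [xi_critPt_re, xi_eq (by simp) (critPt_ne_one u), critPt_mul_sub_one]

theorem exists_sign_of_ne_zero {f : ℝ → ℝ} {a b : ℝ} (hf : Continuous f)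
    (h0 : ∀ x ∈ Set.Icc a b, f x ≠ 0) :
    ∃ σ : ℝ, |σ| = 1 ∧ ∀ x ∈ Set.Icc a b, f x = σ * |f x| := by
  by_cases hp : ∀ x ∈ Set.Icc a b, 0 ≤ f x
  · exact ⟨1, by simp, fun x hx => by rw [abs_of_nonneg (hp x hx), one_mul]⟩
  · push Not at hp
    obtain ⟨y, hy, hfy⟩ := hp
    refine ⟨-1, by simp, fun x hx => ?_⟩
    rcases le_or_gt (f x) 0 with h | h
    · rw [abs_of_nonpos h]; ring
    · obtain ⟨z, hz, hz0⟩ := isPreconnected_Icc.intermediate_value hy hx hf.continuousOn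
        ⟨hfy.le, h.le⟩
      exact absurd hz0 (h0 z hz)

theorem norm_integral_zeta_le {T t H : ℝ} (hH : 0 ≤ H)
    (hη : ∀ v ∈ Set.Icc 0 H, ‖phaseErr T t v - 1‖ ≤ 1 / 5)
    (hz : ∀ u ∈ Set.Icc t (t + H), riemannZeta (critPt u) ≠ 0) :
    ‖∫ v in (0 : ℝ)..H, riemannZeta (critPt (t + v))‖ ≤
      2 * ‖∫ v in (0 : ℝ)..H, riemannZeta (critPt (t + v)) *
        Complex.exp ((v * freq T : ℝ) * Complex.I)‖ := by
  have hXc : Continuous fun u : ℝ => (xi (critPt u)).re :=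
    Complex.continuous_re.comp (differentiable_xi.continuous.comp continuous_critPt)
  have hX0 : ∀ u ∈ Set.Icc t (t + H), (xi (critPt u)).re ≠ 0 := by
    intro u hu h
    have := xi_critPt u
    rw [h, Complex.ofReal_zero, eq_comm] at this
    have h4 : ((-(1 / 4 + u ^ 2) : ℝ) : ℂ) ≠ 0 := by
      have : 0 < 1 / 4 + u ^ 2 := by positivity
      exact_mod_cast (neg_lt_zero.mpr this).ne
    exact mul_ne_zero (mul_ne_zero h4 (Gammaℝ_critPt_ne u)) (hz u hu) this
  obtain ⟨σ, hσ, hs⟩ := exists_sign_of_ne_zero hXc hX0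
  set G := Complex.Gammaℝ (critPt t) with hG
  have hG0 : G ≠ 0 := Gammaℝ_critPt_ne t
  set κ : ℂ := (-σ : ℝ) * (‖G‖ / G) with hκ
  have hκn : ‖κ‖ = 1 := by
    rw [hκ, norm_mul, norm_div, Complex.norm_real, Complex.norm_real, norm_norm, norm_neg,
      Real.norm_eq_abs, hσ, div_self (norm_ne_zero_iff.mpr hG0), one_mul]
  have hcz : Continuous fun v : ℝ => riemannZeta (critPt (t + v)) :=
    continuous_zeta_critPt.comp (by fun_prop : Continuous fun v : ℝ => t + v)
  have hcn : Continuous fun v : ℝ => ‖riemannZeta (critPt (t + v))‖ := hcz.norm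
  have hpt : ∀ v ∈ Set.Icc 0 H, ‖riemannZeta (critPt (t + v)) *
      Complex.exp ((v * freq T : ℝ) * Complex.I) - κ * ‖riemannZeta (critPt (t + v))‖‖ ≤
      1 / 2 * ‖riemannZeta (critPt (t + v))‖ := by
    intro v hv
    set E := phaseErr T t v with hE
    have hE0 : E ≠ 0 := phaseErr_ne_zero T t v
    have hEv := hη v hv
    rw [← hE] at hEv
    have hEn : 4 / 5 ≤ ‖E‖ := by
      have := norm_sub_norm_le (1 : ℂ) (1 - E)
      rw [sub_sub_cancel, norm_one, norm_sub_rev] at this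
      linarith
    set Z := riemannZeta (critPt (t + v)) with hZ
    set q := Complex.exp ((v * freq T : ℝ) * Complex.I) with hq
    have hqn : ‖q‖ = 1 := Complex.norm_exp_ofReal_mul_I _
    have hx := xi_critPt (t + v)
    have hsv := hs (t + v) ⟨by linarith [hv.1], by linarith [hv.2]⟩
    set X := (xi (critPt (t + v))).re with hX
    set d := 1 / 4 + (t + v) ^ 2 with hd
    have hd0 : 0 < d := by positivity
    rw [Gammaℝ_critPt_add T t v, ← hG, ← hE, ← hq, ← hZ] at hx
    set p := Real.exp (-(Real.pi / 4 * v)) with hp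
    have hp0 : 0 < p := Real.exp_pos _
    have hn := congrArg norm hx
    simp only [norm_mul, Complex.norm_real, Real.norm_eq_abs, abs_neg, abs_of_pos hd0,
      abs_of_pos hp0, hqn, mul_one] at hn
    have hZq : Z * q = κ * ‖Z‖ * (‖E‖ / E) := by
      have h1 : ((-d : ℝ) : ℂ) * (G * E * p * q) * Z =
          ((σ * (d * (‖G‖ * ‖E‖ * p) * ‖Z‖) : ℝ) : ℂ) := by rw [← hx, ← hn, ← hsv]
      have hdc : (d : ℂ) ≠ 0 := by exact_mod_cast hd0.ne'
      have hpc : (p : ℂ) ≠ 0 := by exact_mod_cast hp0.ne'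
      rw [hκ]
      field_simp
      push_cast at h1 ⊢
      refine mul_left_cancel₀ (mul_ne_zero hdc hpc) ?_
      linear_combination -h1
    have e : Z * q - κ * ‖Z‖ = κ * ‖Z‖ * (‖E‖ / E - 1) := by rw [hZq]; ring
    rw [e, norm_mul, norm_mul, hκn, one_mul, Complex.norm_real, norm_norm, mul_comm]
    refine mul_le_mul_of_nonneg_right ?_ (norm_nonneg _)
    rw [div_sub_one hE0, norm_div, div_le_iff₀ (by linarith)]
    have h2 : (‖E‖ : ℂ) - E = ((‖E‖ - 1 : ℝ) : ℂ) - (E - 1) := by push_cast; ring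
    have h3 := norm_sub_le ((‖E‖ - 1 : ℝ) : ℂ) (E - 1)
    rw [← h2, Complex.norm_real, Real.norm_eq_abs] at h3
    have h4 := abs_norm_sub_norm_le E 1
    rw [norm_one] at h4
    linarith
  set J := ∫ v in (0 : ℝ)..H, ‖riemannZeta (critPt (t + v))‖ with hJ
  have h1 : ‖∫ v in (0 : ℝ)..H, riemannZeta (critPt (t + v))‖ ≤ J :=
    intervalIntegral.norm_integral_le_integral_norm hH
  have hJ0 : 0 ≤ J := (norm_nonneg _).trans h1
  have h2 : ‖(∫ v in (0 : ℝ)..H, riemannZeta (critPt (t + v)) *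
      Complex.exp ((v * freq T : ℝ) * Complex.I)) - κ * J‖ ≤ 1 / 2 * J := by
    have e : κ * (J : ℂ) = ∫ v in (0 : ℝ)..H, κ * (‖riemannZeta (critPt (t + v))‖ : ℂ) := by
      rw [intervalIntegral.integral_const_mul, intervalIntegral.integral_ofReal]
    rw [e, ← intervalIntegral.integral_sub
      (Continuous.intervalIntegrable (by fun_prop) _ _)
      (Continuous.intervalIntegrable (by fun_prop) _ _), hJ,
      ← intervalIntegral.integral_const_mul]
    refine intervalIntegral.norm_integral_le_of_norm_le hH ?_
      (Continuous.intervalIntegrable (by fun_prop) _ _)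
    exact Eventually.of_forall fun v hv => hpt v (Set.Ioc_subset_Icc_self hv)
  have h3 := norm_sub_norm_le (κ * J) (κ * J - ∫ v in (0 : ℝ)..H, riemannZeta (critPt (t + v)) *
      Complex.exp ((v * freq T : ℝ) * Complex.I))
  rw [sub_sub_cancel, norm_mul, hκn, one_mul, Complex.norm_real, Real.norm_of_nonneg hJ0,
    norm_sub_rev] at h3
  linarith

/-- The Dirichlet polynomial obtained by integrating `dpoly T N (t + v) * exp (i v x)`. -/
noncomputable def oscSum (T : ℝ) (N : ℕ) (H x t : ℝ) : ℂ :=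
  ∑ n ∈ Finset.range N, coef T n * osc H (x - Real.log ((n : ℝ) + 1)) *
    Complex.exp (-(t * Real.log ((n : ℝ) + 1) : ℝ) * Complex.I)

theorem continuous_dpoly (T : ℝ) (N : ℕ) : Continuous (dpoly T N) := by
  unfold dpoly
  fun_prop

theorem continuous_oscSum (T : ℝ) (N : ℕ) (H x : ℝ) : Continuous (oscSum T N H x) := by
  unfold oscSum
  fun_prop

theorem integral_dpoly (T : ℝ) (N : ℕ) (H x t : ℝ) :
    ∫ v in (0 : ℝ)..H, dpoly T N (t + v) * Complex.exp ((v * x : ℝ) * Complex.I) =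
      oscSum T N H x t := by
  have e : ∀ v : ℝ, dpoly T N (t + v) * Complex.exp ((v * x : ℝ) * Complex.I) =
      ∑ n ∈ Finset.range N, coef T n *
        Complex.exp (-(t * Real.log ((n : ℝ) + 1) : ℝ) * Complex.I) *
        Complex.exp ((v * (x - Real.log ((n : ℝ) + 1)) : ℝ) * Complex.I) := by
    intro v
    rw [dpoly, Finset.sum_mul]
    refine Finset.sum_congr rfl fun n _ => ?_
    rw [mul_assoc, mul_assoc, ← Complex.exp_add, ← Complex.exp_add]
    congr 2
    push_cast
    ring
  simp_rw [e]
  rw [intervalIntegral.integral_finsetSum fun n _ => Continuous.intervalIntegrable (by fun_prop) _ _,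
    oscSum]
  refine Finset.sum_congr rfl fun n _ => ?_
  rw [intervalIntegral.integral_const_mul, osc]
  ring

theorem sum_rpow_neg_half_le (N : ℕ) :
    ∑ n ∈ Finset.range N, ((n : ℝ) + 1) ^ (-(1 / 2) : ℝ) ≤ 2 * Real.sqrt N := by
  induction N with
  | zero => simp
  | succ n ih =>
    rw [Finset.sum_range_succ, Real.rpow_neg (by positivity), ← Real.sqrt_eq_rpow]
    push_cast
    set A := Real.sqrt ((n : ℝ) + 1) with hA
    set B := Real.sqrt (n : ℝ) with hB
    have hA0 : 0 < A := Real.sqrt_pos.mpr (by positivity)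
    have hA2 : A ^ 2 = n + 1 := Real.sq_sqrt (by positivity)
    have hB2 : B ^ 2 = n := Real.sq_sqrt (by positivity)
    have : A⁻¹ ≤ 2 * A - 2 * B := by
      rw [inv_le_iff_one_le_mul₀ hA0]
      nlinarith [sq_nonneg (A - B)]
    linarith

theorem norm_dpoly_le (T : ℝ) (N : ℕ) (u : ℝ) : ‖dpoly T N u‖ ≤ 2 * wgtConst * Real.sqrt N := by
  have h1 : ‖dpoly T N u‖ ≤ ∑ n ∈ Finset.range N, ((n : ℝ) + 1) ^ (-(1 / 2) : ℝ) * wgtConst := by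
    refine norm_sum_le_of_le _ fun n _ => ?_
    rw [norm_mul, ← Complex.ofReal_neg, Complex.norm_exp_ofReal_mul_I, mul_one]
    exact norm_coef_le T n
  rw [← Finset.sum_mul] at h1
  have := mul_le_mul_of_nonneg_right (sum_rpow_neg_half_le N) wgtConst_pos.le
  linarith

theorem norm_integral_zeta_sub_le {T t H η δ M : ℝ} {N : ℕ} (x : ℝ) (hH : 0 ≤ H)
    (hδ : ∀ v ∈ Set.Icc 0 H, ‖2 * Real.pi * riemannZeta (critPt (t + v)) -
      (dpoly T N (t + v) + chi (t + v) * conj (dpoly T N (t + v)))‖ ≤ δ)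
    (hη : ∀ v ∈ Set.Icc 0 H, ‖phaseErr T t v - 1‖ ≤ η) (hη2 : η ≤ 1 / 2)
    (hM : ∀ u, ‖dpoly T N u‖ ≤ M) :
    ‖2 * Real.pi * (∫ v in (0 : ℝ)..H, riemannZeta (critPt (t + v)) *
        Complex.exp ((v * x : ℝ) * Complex.I)) -
      (oscSum T N H x t + chi t * conj (oscSum T N H (2 * freq T - x) t))‖ ≤
      (δ + 4 * η * M) * H := by
  have hcz : Continuous fun v : ℝ => riemannZeta (critPt (t + v)) :=
    continuous_zeta_critPt.comp (by fun_prop : Continuous fun v : ℝ => t + v)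
  have hcd : Continuous fun v : ℝ => dpoly T N (t + v) :=
    (continuous_dpoly T N).comp (by fun_prop : Continuous fun v : ℝ => t + v)
  have hcj : Continuous fun v : ℝ => conj (dpoly T N (t + v)) :=
    Complex.continuous_conj.comp hcd
  have hconj : conj (oscSum T N H (2 * freq T - x) t) = ∫ v in (0 : ℝ)..H,
      Complex.exp (-(v * (2 * freq T) : ℝ) * Complex.I) * conj (dpoly T N (t + v)) *
        Complex.exp ((v * x : ℝ) * Complex.I) := by
    rw [← integral_dpoly, ← intervalIntegral.intervalIntegral_conj]
    refine intervalIntegral.integral_congr fun v _ => ?_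
    simp only [map_mul, ← Complex.exp_conj, Complex.conj_ofReal, Complex.conj_I]
    rw [mul_comm (Complex.exp _), mul_assoc, ← Complex.exp_add]
    congr 2
    push_cast
    ring
  rw [hconj, ← integral_dpoly, ← intervalIntegral.integral_const_mul,
    ← intervalIntegral.integral_const_mul, ← intervalIntegral.integral_add
      (Continuous.intervalIntegrable (by fun_prop) _ _)
      (Continuous.intervalIntegrable (by fun_prop) _ _), ← intervalIntegral.integral_sub
      (Continuous.intervalIntegrable (by fun_prop) _ _)
      (Continuous.intervalIntegrable (by fun_prop) _ _)]
  have hb := intervalIntegral.norm_integral_le_of_norm_le_const (a := 0) (b := H)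
    (C := δ + 4 * η * M) (f := fun v : ℝ => 2 * Real.pi * (riemannZeta (critPt (t + v)) *
        Complex.exp ((v * x : ℝ) * Complex.I)) - (dpoly T N (t + v) *
        Complex.exp ((v * x : ℝ) * Complex.I) + chi t *
        (Complex.exp (-(v * (2 * freq T) : ℝ) * Complex.I) * conj (dpoly T N (t + v)) *
        Complex.exp ((v * x : ℝ) * Complex.I)))) ?_
  · rwa [sub_zero, abs_of_nonneg hH] at hb
  intro v hv
  rw [Set.uIoc_of_le hH] at hv
  have hv' := Set.Ioc_subset_Icc_self hv
  have h1 := norm_chi_add_sub_le (hη v hv') hη2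
  have h2 := hδ v hv'
  have hη0 : 0 ≤ η := (norm_nonneg _).trans (hη v hv')
  have e : 2 * Real.pi * (riemannZeta (critPt (t + v)) *
        Complex.exp ((v * x : ℝ) * Complex.I)) - (dpoly T N (t + v) *
        Complex.exp ((v * x : ℝ) * Complex.I) + chi t *
        (Complex.exp (-(v * (2 * freq T) : ℝ) * Complex.I) * conj (dpoly T N (t + v)) *
        Complex.exp ((v * x : ℝ) * Complex.I))) =
      ((2 * Real.pi * riemannZeta (critPt (t + v)) -
      (dpoly T N (t + v) + chi (t + v) * conj (dpoly T N (t + v)))) +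
      (chi (t + v) - chi t * Complex.exp (-(v * (2 * freq T) : ℝ) * Complex.I)) *
        conj (dpoly T N (t + v))) * Complex.exp ((v * x : ℝ) * Complex.I) := by ring
  rw [e, norm_mul, Complex.norm_exp_ofReal_mul_I, mul_one]
  refine (norm_add_le _ _).trans (add_le_add h2 ?_)
  rw [norm_mul, RCLike.norm_conj]
  exact mul_le_mul h1 (hM _) (norm_nonneg _) (by positivity)

theorem coef_zero (T : ℝ) : coef T 0 = wgt (-freq T) := by
  simp [coef, freq]

theorem tendsto_freq : Tendsto freq atTop atTop := by
  have hpi := Real.pi_pos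
  exact (Real.tendsto_log_atTop.comp (tendsto_id.atTop_div_const (by positivity))).atTop_div_const
    (by norm_num)

theorem eventually_coef_zero : ∀ᶠ T : ℝ in atTop, 3 ≤ ‖coef T 0‖ := by
  have h : Tendsto (fun T : ℝ => wgtConst * Real.exp (-(-freq T) ^ 2 / 8)) atTop (𝓝 0) := by
    rw [show (0 : ℝ) = wgtConst * 0 by ring]
    refine Tendsto.const_mul _ (Real.tendsto_exp_atBot.comp ?_)
    have h2 : Tendsto (fun T : ℝ => freq T ^ 2 / 8) atTop atTop :=
      ((tendsto_pow_atTop two_ne_zero).comp tendsto_freq).atTop_div_const (by norm_num)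
    refine (tendsto_neg_atTop_atBot.comp h2).congr fun T => ?_
    simp only [Function.comp]
    ring
  filter_upwards [h.eventually_le_const (by norm_num : (0 : ℝ) < 1),
    tendsto_freq.eventually_ge_atTop 0] with T h1 h2
  have h3 := norm_wgt_sub_le (x := -freq T) (by linarith)
  have h4 := norm_sub_norm_le (2 * Real.pi : ℂ) (2 * Real.pi - wgt (-freq T))
  have h5 : ‖(2 * Real.pi : ℂ)‖ = 2 * Real.pi := by
    rw [norm_mul, Complex.norm_real, Real.norm_of_nonneg Real.pi_pos.le, Complex.norm_ofNat]
  rw [sub_sub_cancel, norm_sub_rev, h5] at h4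
  rw [coef_zero]
  have := Real.pi_gt_three
  linarith

theorem len_le {ε T : ℝ} (hε : -(1 / 2) ≤ ε) (hT : 1 ≤ T) : (len ε T : ℝ) ≤ 2 * T ^ (1 / 2 + ε) := by
  have h1 : (1 : ℝ) ≤ T ^ (1 / 2 + ε) := Real.one_le_rpow hT (by linarith)
  have := Nat.ceil_lt_add_one (by linarith : (0 : ℝ) ≤ T ^ (1 / 2 + ε))
  rw [len]
  linarith

theorem sqrt_len_le {ε T : ℝ} (hε0 : 0 < ε) (hε : ε ≤ 1 / 20) (hT : 1 ≤ T) :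
    Real.sqrt (len ε T) ≤ 2 * T ^ (11 / 40 : ℝ) := by
  have hT0 : 0 < T := by linarith
  refine Real.sqrt_le_iff.mpr ⟨by positivity, (len_le (by linarith) hT).trans ?_⟩
  rw [mul_pow, ← Real.rpow_natCast, ← Real.rpow_natCast, ← Real.rpow_mul hT0.le]
  have h1 : T ^ (1 / 2 + ε) ≤ T ^ (11 / 40 * ((2 : ℕ) : ℝ)) :=
    Real.rpow_le_rpow_of_exponent_le hT (by push_cast; linarith)
  have h2 : (0 : ℝ) < T ^ (1 / 2 + ε) := by positivity
  norm_num at h1 ⊢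
  linarith

theorem eventually_phaseErr {a H : ℝ} (ha : a ≤ 3 / 5) (ha0 : 0 ≤ a) (hH : 0 ≤ H) :
    ∀ᶠ T : ℝ in atTop, ∀ t : ℝ, |t - T| ≤ T ^ a → ∀ v ∈ Set.Icc 0 H,
      ‖phaseErr T t v - 1‖ ≤ 3 * (8 * H + 4 * H ^ 2) * T ^ (-(2 / 5) : ℝ) := by
  set κ := 8 * H + 4 * H ^ 2 with hκ
  have hκ0 : 0 ≤ κ := by positivity
  have h1 : Tendsto (fun T : ℝ => κ * T ^ (-(2 / 5) : ℝ)) atTop (𝓝 0) := by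
    rw [show (0 : ℝ) = κ * 0 by ring]
    exact (tendsto_rpow_neg_atTop (by norm_num)).const_mul _
  filter_upwards [h1.eventually_le_const (by norm_num : (0 : ℝ) < 1), eventually_ge_atTop 8,
    eventually_ge_atTop (4 * H),
    (tendsto_rpow_atTop (by norm_num : (0 : ℝ) < 2 / 5)).eventually_ge_atTop 4]
    with T hT1 hT8 hTH hT4 t ht v hv
  have hTone : 1 ≤ T := by linarith
  have hT0 : 0 < T := by linarith
  have hTa : 1 ≤ T ^ a := Real.one_le_rpow hTone ha0
  have hTa2 : T ^ a ≤ T ^ (3 / 5 : ℝ) := Real.rpow_le_rpow_of_exponent_le hTone ha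
  have hT35 : T ^ (3 / 5 : ℝ) * T ^ (2 / 5 : ℝ) = T := by
    rw [← Real.rpow_add hT0]; norm_num
  have h35 : 0 < T ^ (3 / 5 : ℝ) := by positivity
  have h := norm_phaseErr_sub_one_le hTa (by nlinarith) ht hT8 hv.1 (by linarith [hv.2])
  refine h.trans ?_
  have hx : (8 * v + 4 * v ^ 2) * (T ^ a / T) ≤ κ * T ^ (-(2 / 5) : ℝ) := by
    have e : T ^ (-(2 / 5) : ℝ) = T ^ (3 / 5 : ℝ) / T := by
      rw [eq_div_iff hT0.ne', ← Real.rpow_add_one hT0.ne']; norm_num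
    have h3 : T ^ a / T ≤ T ^ (3 / 5 : ℝ) / T := by gcongr
    have h2 : 8 * v + 4 * v ^ 2 ≤ κ := by nlinarith [hv.1, hv.2]
    rw [e]
    exact mul_le_mul h2 h3 (by positivity) hκ0
  set y := κ * T ^ (-(2 / 5) : ℝ) with hy
  have hy0 : 0 ≤ y := by positivity
  have h4 := exp_sub_one_le_mul_exp y
  have h5 : Real.exp y ≤ 3 := (Real.exp_le_exp.mpr hT1).trans Real.exp_one_lt_three.le
  have h6 := Real.exp_le_exp.mpr hx
  rw [mul_assoc, ← hy]
  nlinarith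

/-- On a zero-free stretch of the critical line one of three Dirichlet polynomials is large. -/
theorem eventually_sq_le {a ε H : ℝ} (ha : a ≤ 3 / 5) (ha0 : 0 < a) (hε : 0 < ε) (hε1 : ε ≤ 1 / 20)
    (hH : 1 ≤ H) : ∀ᶠ T : ℝ in atTop, ∀ t ∈ Set.Icc T (T + T ^ a),
      (∀ u ∈ Set.Icc t (t + H), riemannZeta (critPt u) ≠ 0) →
      4 * H ^ 2 ≤ 3 * (16 * ‖oscSum T (len ε T) H (freq T) t‖ ^ 2 +
        ‖oscSum T (len ε T) H 0 t - coef T 0 * H‖ ^ 2 +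
        ‖oscSum T (len ε T) H (2 * freq T) t‖ ^ 2) := by
  obtain ⟨C, hC, hafe⟩ := exists_afe ha ha0.le hε (by linarith : ε ≤ 1 / 2)
  have hw := wgtConst_pos
  have hH0 : 0 ≤ H := by linarith
  set κ := 3 * (8 * H + 4 * H ^ 2) with hκ
  have hκ0 : 0 < κ := by positivity
  have hη : Tendsto (fun T : ℝ => κ * T ^ (-(2 / 5) : ℝ)) atTop (𝓝 0) := by
    rw [show (0 : ℝ) = κ * 0 by ring]
    exact (tendsto_rpow_neg_atTop (by norm_num)).const_mul _
  have herr : Tendsto (fun T : ℝ => C * T ^ (-(1 / 10) : ℝ) +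
      16 * κ * wgtConst * T ^ (-(1 / 8) : ℝ)) atTop (𝓝 0) := by
    rw [show (0 : ℝ) = C * 0 + 16 * κ * wgtConst * 0 by ring]
    exact ((tendsto_rpow_neg_atTop (by norm_num)).const_mul _).add
      ((tendsto_rpow_neg_atTop (by norm_num)).const_mul _)
  filter_upwards [hafe, eventually_phaseErr ha ha0.le hH0, eventually_coef_zero,
    hη.eventually_le_const (by norm_num : (0 : ℝ) < 1 / 5),
    herr.eventually_le_const (by norm_num : (0 : ℝ) < 1 / 3), eventually_ge_atTop 1,
    (tendsto_rpow_atTop ha0).eventually_ge_atTop H] with T hafe hph hc hη herr hT hTH t ht hz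
  have hT0 : 0 < T := by linarith
  set N := len ε T with hN
  set e := C * T ^ (-(1 / 10) : ℝ) + 16 * κ * wgtConst * T ^ (-(1 / 8) : ℝ) with he
  have htT : |t - T| ≤ T ^ a := by rw [abs_of_nonneg (by linarith [ht.1])]; linarith [ht.2]
  have hph' := hph t htT
  have hδ : ∀ v ∈ Set.Icc 0 H, ‖2 * Real.pi * riemannZeta (critPt (t + v)) -
      (dpoly T N (t + v) + chi (t + v) * conj (dpoly T N (t + v)))‖ ≤
      C * T ^ (-(1 / 10) : ℝ) := fun v hv => by
    refine hafe (t + v) ?_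
    rw [abs_of_nonneg (by linarith [ht.1, hv.1])]
    linarith [ht.2, hv.2]
  have hM : ∀ u, ‖dpoly T N u‖ ≤ 4 * wgtConst * T ^ (11 / 40 : ℝ) := fun u => by
    refine (norm_dpoly_le T N u).trans ?_
    have := mul_le_mul_of_nonneg_left (sqrt_len_le hε hε1 hT) (by positivity : 0 ≤ 2 * wgtConst)
    linarith
  have hE : C * T ^ (-(1 / 10) : ℝ) + 4 * (κ * T ^ (-(2 / 5) : ℝ)) *
      (4 * wgtConst * T ^ (11 / 40 : ℝ)) = e := by
    have : T ^ (-(1 / 8) : ℝ) = T ^ (-(2 / 5) : ℝ) * T ^ (11 / 40 : ℝ) := by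
      rw [← Real.rpow_add hT0]; norm_num
    rw [he, this]
    ring
  have h1 := norm_integral_zeta_sub_le 0 hH0 hδ hph' (by linarith) hM
  have h2 := norm_integral_zeta_sub_le (freq T) hH0 hδ hph' (by linarith) hM
  have h3 := norm_integral_zeta_le hH0 (fun v hv => (hph' v hv).trans hη) hz
  rw [hE] at h1 h2
  rw [show 2 * freq T - freq T = freq T by ring] at h2
  simp only [mul_zero, Complex.ofReal_zero, zero_mul, Complex.exp_zero, mul_one, sub_zero] at h1
  set A := ∫ v in (0 : ℝ)..H, riemannZeta (critPt (t + v)) with hA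
  set B := ∫ v in (0 : ℝ)..H, riemannZeta (critPt (t + v)) *
        Complex.exp ((v * freq T : ℝ) * Complex.I) with hB
  set S0 := oscSum T N H 0 t
  set S1 := oscSum T N H (freq T) t
  set S2 := oscSum T N H (2 * freq T) t
  have hchi := norm_chi t
  have h2pi : ∀ z : ℂ, ‖2 * Real.pi * z‖ = 2 * Real.pi * ‖z‖ := fun z => by
    rw [norm_mul, norm_mul, Complex.norm_real, Real.norm_of_nonneg Real.pi_pos.le,
      Complex.norm_ofNat]
  have hBn : 2 * Real.pi * ‖B‖ ≤ 2 * ‖S1‖ + e * H := by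
    rw [← h2pi]
    have h4 := norm_add_le (2 * Real.pi * B - (S1 + chi t * conj S1)) (S1 + chi t * conj S1)
    have h5 := norm_add_le S1 (chi t * conj S1)
    rw [norm_mul, hchi, RCLike.norm_conj] at h5
    rw [sub_add_cancel] at h4
    linarith
  have hAn : 3 * H ≤ 2 * Real.pi * ‖A‖ + ‖S0 - coef T 0 * H‖ + ‖S2‖ + e * H := by
    rw [← h2pi]
    have h4 : coef T 0 * H = 2 * Real.pi * A - (2 * Real.pi * A - (S0 + chi t * conj S2)) -
      (S0 - coef T 0 * H) - chi t * conj S2 := by ring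
    have h5 : ‖coef T 0 * H‖ ≤ ‖2 * Real.pi * A‖ +
        ‖2 * Real.pi * A - (S0 + chi t * conj S2)‖ + ‖S0 - coef T 0 * H‖ +
        ‖chi t * conj S2‖ := by
      conv_lhs => rw [h4]
      refine (norm_sub_le _ _).trans (add_le_add_left ?_ _)
      refine (norm_sub_le _ _).trans (add_le_add_left ?_ _)
      exact norm_sub_le _ _
    rw [norm_mul, Complex.norm_real, Real.norm_of_nonneg hH0, norm_mul (chi t), hchi,
      RCLike.norm_conj] at h5
    nlinarith
  have hAB : 2 * Real.pi * ‖A‖ ≤ 2 * (2 * Real.pi * ‖B‖) := by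
    have := mul_le_mul_of_nonneg_left h3 (by positivity : 0 ≤ 2 * Real.pi)
    linarith
  have heH : e * H ≤ 1 / 3 * H := mul_le_mul_of_nonneg_right herr hH0
  set x := ‖S1‖
  set y := ‖S0 - coef T 0 * H‖
  set z := ‖S2‖
  have hsum : 2 * H ≤ 4 * x + y + z := by linarith
  have hsq : (2 * H) ^ 2 ≤ (4 * x + y + z) ^ 2 := by gcongr
  nlinarith [sq_nonneg (4 * x - y), sq_nonneg (4 * x - z), sq_nonneg (y - z)]

theorem eventually_len_mul_log_le {ε : ℝ} (hε : 0 < ε) (hε1 : ε ≤ 1 / 2) :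
    ∀ᶠ T : ℝ in atTop, 4 * (len ε T : ℝ) * (1 + Real.log (len ε T)) ≤ T ^ (1 / 2 + 2 * ε) := by
  filter_upwards [(isLittleO_log_rpow_atTop hε).bound (by norm_num : (0 : ℝ) < 1 / 16),
    (tendsto_rpow_atTop hε).eventually_ge_atTop 32, eventually_ge_atTop 1] with T h1 h2 hT
  have hT0 : 0 < T := by linarith
  have hl := len_le (by linarith : -(1 / 2) ≤ ε) hT
  have hlen : (1 : ℝ) ≤ len ε T :=
    (Real.one_le_rpow hT (by linarith : 0 ≤ 1 / 2 + ε)).trans (Nat.le_ceil _)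
  have hTT : T ^ (1 / 2 + ε) ≤ T := by
    conv_rhs => rw [← Real.rpow_one T]
    exact Real.rpow_le_rpow_of_exponent_le hT (by linarith)
  have hlog : Real.log (len ε T) ≤ 1 + Real.log T := by
    have h3 : Real.log (len ε T) ≤ Real.log (2 * T) :=
      Real.log_le_log (by linarith) (by linarith)
    rw [Real.log_mul two_ne_zero hT0.ne'] at h3
    have := Real.log_two_lt_d9
    linarith
  rw [Real.norm_of_nonneg (Real.log_nonneg hT), Real.norm_of_nonneg (by positivity)] at h1
  have h3 : 8 * (1 + Real.log (len ε T)) ≤ T ^ ε := by linarith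
  have h0 : 0 ≤ Real.log (len ε T) := Real.log_nonneg hlen
  calc 4 * (len ε T : ℝ) * (1 + Real.log (len ε T))
      ≤ 4 * (2 * T ^ (1 / 2 + ε)) * (1 + Real.log (len ε T)) :=
        mul_le_mul_of_nonneg_right (by linarith) (by linarith)
    _ = T ^ (1 / 2 + ε) * (8 * (1 + Real.log (len ε T))) := by ring
    _ ≤ T ^ (1 / 2 + ε) * T ^ ε := mul_le_mul_of_nonneg_left h3 (by positivity)
    _ = _ := by rw [← Real.rpow_add hT0]; ring_nf

theorem norm_coef_mul_sq_le (T : ℝ) (n : ℕ) (z : ℂ) :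
    ‖coef T n * z‖ ^ 2 ≤ wgtConst ^ 2 * (1 / ((n : ℝ) + 1) * ‖z‖ ^ 2) := by
  have h := norm_coef_le T n
  have hn : (0 : ℝ) < (n : ℝ) + 1 := by positivity
  have e : (((n : ℝ) + 1) ^ (-(1 / 2) : ℝ)) ^ 2 = 1 / ((n : ℝ) + 1) := by
    rw [← Real.rpow_natCast, ← Real.rpow_mul hn.le,
      show -(1 / 2) * ((2 : ℕ) : ℝ) = -1 by norm_num, Real.rpow_neg_one, one_div]
  rw [norm_mul, mul_pow, ← mul_assoc]
  refine mul_le_mul_of_nonneg_right ?_ (by positivity)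
  calc ‖coef T n‖ ^ 2 ≤ (((n : ℝ) + 1) ^ (-(1 / 2) : ℝ) * wgtConst) ^ 2 := by gcongr
    _ = _ := by rw [mul_pow, e, mul_comm]

theorem integral_norm_oscSum_sq_le {T U H x : ℝ} {N : ℕ} (hU : 0 ≤ U) (hH : 1 ≤ H)
    (hN : 4 * (N : ℝ) * (1 + Real.log N) ≤ U) (hx : Real.log (H + 1) + 1 ≤ x) :
    ∫ t in T..(T + U), ‖oscSum T N H x t‖ ^ 2 ≤ 800 * wgtConst ^ 2 * H * U := by
  have h1 := integral_norm_sq_dirichlet_le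
    (fun n => coef T n * osc H (x - Real.log ((n : ℝ) + 1))) N T hU
  have h2 : ∑ n ∈ Finset.range N, ‖coef T n * osc H (x - Real.log ((n : ℝ) + 1))‖ ^ 2 ≤
      wgtConst ^ 2 * (400 * H) := by
    refine (Finset.sum_le_sum fun n _ => norm_coef_mul_sq_le T n _).trans ?_
    rw [← Finset.mul_sum]
    exact mul_le_mul_of_nonneg_left (sum_osc_sq_le hH hx N) (by positivity)
  refine h1.trans ?_
  calc _ ≤ (2 * U) * (wgtConst ^ 2 * (400 * H)) :=
        mul_le_mul (by linarith) h2 (Finset.sum_nonneg fun _ _ => by positivity) (by positivity)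
    _ = _ := by ring

theorem osc_zero (H : ℝ) : osc H 0 = H := by simp [osc]

theorem integral_norm_oscSum_zero_sq_le {T U H : ℝ} {N : ℕ} (hU : 0 ≤ U) (hH : 1 ≤ H)
    (hN : 4 * (N : ℝ) * (1 + Real.log N) ≤ U) (hN1 : 1 ≤ N) :
    ∫ t in T..(T + U), ‖oscSum T N H 0 t - coef T 0 * H‖ ^ 2 ≤ 800 * wgtConst ^ 2 * H * U := by
  set c : ℕ → ℂ := fun n => if n = 0 then 0 else coef T n * osc H (-Real.log ((n : ℝ) + 1)) with hc
  have hsplit : ∀ f : ℕ → ℂ, ∑ n ∈ Finset.range N, f n = f 0 + ∑ n ∈ Finset.Ico 1 N, f n := by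
    intro f
    rw [Finset.range_eq_Ico, Finset.sum_eq_sum_Ico_succ_bot (by omega)]
  have he : ∀ t : ℝ, oscSum T N H 0 t - coef T 0 * H = ∑ n ∈ Finset.range N, c n *
      Complex.exp (-(t * Real.log ((n : ℝ) + 1) : ℝ) * Complex.I) := by
    intro t
    rw [oscSum, hsplit, hsplit]
    have h0 : c 0 = 0 := if_pos rfl
    rw [h0]
    simp only [Nat.cast_zero, zero_add, Real.log_one, sub_zero, mul_zero, Complex.ofReal_zero,
      neg_zero, zero_mul, Complex.exp_zero, mul_one, osc_zero, add_sub_cancel_left, zero_sub]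
    refine Finset.sum_congr rfl fun n hn => ?_
    have hn1 := (Finset.mem_Ico.mp hn).1
    have hcn : c n = coef T n * osc H (-Real.log ((n : ℝ) + 1)) := if_neg (by omega)
    rw [hcn]
  simp_rw [he]
  have h1 := integral_norm_sq_dirichlet_le c N T hU
  have h2 : ∑ n ∈ Finset.range N, ‖c n‖ ^ 2 ≤ wgtConst ^ 2 * (400 * H) := by
    rw [Finset.range_eq_Ico, Finset.sum_eq_sum_Ico_succ_bot (by omega)]
    have h0 : c 0 = 0 := if_pos rfl
    rw [h0, norm_zero]
    norm_num
    refine le_trans ?_ (mul_le_mul_of_nonneg_left (sum_osc_log_sq_le hH N)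
      (by positivity : 0 ≤ wgtConst ^ 2))
    rw [Finset.mul_sum]
    refine Finset.sum_le_sum fun n hn => ?_
    have hn1 := (Finset.mem_Ico.mp hn).1
    have hcn : c n = coef T n * osc H (-Real.log ((n : ℝ) + 1)) := if_neg (by omega)
    rw [hcn]
    exact norm_coef_mul_sq_le T n _
  refine h1.trans ?_
  calc _ ≤ (2 * U) * (wgtConst ^ 2 * (400 * H)) :=
        mul_le_mul (by linarith) h2 (Finset.sum_nonneg fun _ _ => by positivity) (by positivity)
    _ = _ := by ring

/-- Zeros found in many disjoint short blocks, given that a function with small integral is large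
at the left end of every zero-free block. -/
theorem exists_finset_of_integral_le {Z : ℝ → Prop} {g : ℝ → ℝ} (hg : Continuous g)
    (hg0 : ∀ t, 0 ≤ g t) {T U H w G : ℝ} (hH : 0 < H) (hw : 0 < w) {k : ℕ}
    (hk : 3 * H * ((k : ℝ) + 1) ≤ U) (hint : ∫ t in T..(T + U), g t ≤ G)
    (hz : ∀ t ∈ Set.Icc T (T + U), (∀ u ∈ Set.Icc t (t + H), ¬ Z u) → w ≤ g t) :
    ∃ F : Finset ℝ, (∀ t ∈ F, t ∈ Set.Ioo T (T + U) ∧ Z t) ∧ (k : ℝ) - G / (w * H) ≤ F.card := by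
  classical
  set x : ℕ → ℝ := fun j => T + H + 3 * H * j with hx
  have hxs : ∀ j, x (j + 1) = x j + 3 * H := fun j => by simp only [hx]; push_cast; ring
  have hxT : ∀ j, T + H ≤ x j := fun j => by
    simp only [hx]
    have : 0 ≤ 3 * H * (j : ℝ) := by positivity
    linarith
  have hxU : ∀ j, j < k → x j + 3 * H ≤ T + U - 2 * H := fun j hj => by
    simp only [hx]
    have h1 : (j : ℝ) + 1 ≤ k := by exact_mod_cast hj
    nlinarith
  have hgi : ∀ a b : ℝ, IntervalIntegrable g volume a b := fun a b => hg.intervalIntegrable a b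
  set bad := (Finset.range k).filter fun j => ∀ u ∈ Set.Icc (x j) (x j + 2 * H), ¬ Z u with hbad
  set good := (Finset.range k).filter fun j => ¬ ∀ u ∈ Set.Icc (x j) (x j + 2 * H), ¬ Z u
    with hgood
  have hcard : bad.card + good.card = k := by
    rw [hbad, hgood, Finset.card_filter_add_card_filter_not, Finset.card_range]
  have hlow : ∀ j ∈ bad, w * H ≤ ∫ t in x j..x (j + 1), g t := by
    intro j hj
    obtain ⟨hjk, hj0⟩ := Finset.mem_filter.mp hj
    have hjk' := hxU j (Finset.mem_range.mp hjk)
    have h1 : ∫ t in x j..(x j + H), w ≤ ∫ t in x j..(x j + H), g t := by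
      refine intervalIntegral.integral_mono_on (by linarith) (by simp) (hgi _ _) fun t ht => ?_
      refine hz t ⟨by linarith [ht.1, hxT j], by linarith [ht.2]⟩ fun u hu => ?_
      exact hj0 u ⟨by linarith [ht.1, hu.1], by linarith [ht.2, hu.2]⟩
    have h2 : ∫ t in x j..(x j + H), w = w * H := by simp [mul_comm]
    have h3 : ∫ t in x j..(x j + H), g t ≤ ∫ t in x j..x (j + 1), g t :=
      intervalIntegral.integral_mono_interval le_rfl (by linarith) (by rw [hxs]; linarith)
        (Eventually.of_forall hg0) (hgi _ _)
    linarith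
  have hsum : (bad.card : ℝ) * (w * H) ≤ G := by
    calc (bad.card : ℝ) * (w * H) = ∑ j ∈ bad, w * H := by rw [Finset.sum_const, nsmul_eq_mul]
      _ ≤ ∑ j ∈ bad, ∫ t in x j..x (j + 1), g t := Finset.sum_le_sum hlow
      _ ≤ ∑ j ∈ Finset.range k, ∫ t in x j..x (j + 1), g t := by
        refine Finset.sum_le_sum_of_subset_of_nonneg (Finset.filter_subset _ _) fun j _ _ => ?_
        exact intervalIntegral.integral_nonneg (by rw [hxs]; linarith) fun t _ => hg0 t
      _ = ∫ t in x 0..x k, g t :=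
        intervalIntegral.sum_integral_adjacent_intervals fun j _ => hgi _ _
      _ ≤ ∫ t in T..(T + U), g t := by
        refine intervalIntegral.integral_mono_interval (by linarith [hxT 0]) ?_ ?_
          (Eventually.of_forall hg0) (hgi _ _)
        · simp only [hx]
          have : (0 : ℝ) ≤ 3 * H * k := by positivity
          push_cast
          linarith
        · simp only [hx]
          linarith
      _ ≤ G := hint
  have hex : ∀ j ∈ good, ∃ u ∈ Set.Icc (x j) (x j + 2 * H), Z u := by
    intro j hj
    have := (Finset.mem_filter.mp hj).2
    push Not at this
    exact this
  choose! z hzI hzZ using hex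
  have hinj : Set.InjOn z good := by
    intro i hi j hj hij
    by_contra hne
    wlog hlt : i < j generalizing i j
    · exact this hj hi hij.symm (Ne.symm hne) (by omega)
    have h1 := (hzI i hi).2
    have h2 := (hzI j hj).1
    have h3 : x i + 3 * H ≤ x j := by
      simp only [hx]
      have : (i : ℝ) + 1 ≤ j := by exact_mod_cast hlt
      nlinarith
    linarith
  refine ⟨good.image z, ?_, ?_⟩
  · intro t ht
    obtain ⟨j, hj, rfl⟩ := Finset.mem_image.mp ht
    have hI := hzI j hj
    have hU := hxU j (Finset.mem_range.mp (Finset.mem_filter.mp hj).1)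
    exact ⟨⟨by linarith [hI.1, hxT j], by linarith [hI.2]⟩, hzZ j hj⟩
  · rw [Finset.card_image_of_injOn hinj]
    have h1 : (bad.card : ℝ) ≤ G / (w * H) := by rwa [le_div_iff₀ (by positivity)]
    have h2 : (bad.card : ℝ) + good.card = k := by exact_mod_cast hcard
    linarith

/-- Many zeros in short intervals, for exponents slightly larger than `1/2`. -/
theorem exists_zeros_of_le {a : ℝ} (ha : 1 / 2 < a) (ha' : a ≤ 3 / 5) :
    ∃ K > (0 : ℝ), ∀ᶠ T : ℝ in atTop, ∃ F : Finset ℝ,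
      (∀ t ∈ F, t ∈ Set.Ioo T (T + T ^ a) ∧ riemannZeta (critPt t) = 0) ∧
        K * T ^ a ≤ F.card := by
  set W := wgtConst with hW
  have hW0 : 0 < W := wgtConst_pos
  set H := 1 + 129600 * W ^ 2 with hH
  have hH1 : 1 ≤ H := by
    have : 0 ≤ 129600 * W ^ 2 := by positivity
    linarith
  have hH0 : 0 < H := by linarith
  set ε := (a - 1 / 2) / 2 with hε
  have hε0 : 0 < ε := by rw [hε]; linarith
  have hε1 : ε ≤ 1 / 20 := by rw [hε]; linarith
  have haε : 1 / 2 + 2 * ε = a := by rw [hε]; ring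
  refine ⟨1 / (8 * H), by positivity, ?_⟩
  have hlen := eventually_len_mul_log_le hε0 (by linarith)
  rw [haε] at hlen
  filter_upwards [hlen, eventually_sq_le ha' (by linarith) hε0 hε1 hH1,
    tendsto_freq.eventually_ge_atTop (Real.log (H + 1) + 1), eventually_ge_atTop 1,
    (tendsto_rpow_atTop (by linarith : 0 < a)).eventually_ge_atTop (16 * H)]
    with T hN hsq hfr hT hU
  set N := len ε T with hNdef
  set U := T ^ a with hUdef
  have hU0 : 0 ≤ U := by linarith
  have hN1 : 1 ≤ N := Nat.one_le_ceil_iff.mpr (by positivity)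
  have hl0 : 0 ≤ Real.log (H + 1) := Real.log_nonneg (by linarith)
  set g : ℝ → ℝ := fun t => 3 * (16 * ‖oscSum T N H (freq T) t‖ ^ 2 +
        ‖oscSum T N H 0 t - coef T 0 * H‖ ^ 2 + ‖oscSum T N H (2 * freq T) t‖ ^ 2) with hg
  have hc := continuous_oscSum T N H
  have hc1 := hc (freq T)
  have hc2 := hc 0
  have hc3 := hc (2 * freq T)
  have hgc : Continuous g := by fun_prop
  have hint : ∫ t in T..(T + U), g t ≤ 43200 * W ^ 2 * H * U := by
    simp only [hg]
    rw [intervalIntegral.integral_const_mul, intervalIntegral.integral_add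
      (Continuous.intervalIntegrable (by fun_prop) _ _)
      (Continuous.intervalIntegrable (by fun_prop) _ _), intervalIntegral.integral_add
      (Continuous.intervalIntegrable (by fun_prop) _ _)
      (Continuous.intervalIntegrable (by fun_prop) _ _), intervalIntegral.integral_const_mul]
    have h1 := integral_norm_oscSum_sq_le (T := T) hU0 hH1 hN hfr
    have h2 := integral_norm_oscSum_zero_sq_le (T := T) hU0 hH1 hN hN1
    have h3 := integral_norm_oscSum_sq_le (T := T) (x := 2 * freq T) hU0 hH1 hN (by linarith)
    rw [← hW] at h1 h2 h3
    linarith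
  have h16 : 16 ≤ U / H := by rwa [le_div_iff₀ hH0]
  obtain ⟨k, hk⟩ : ∃ k, ⌊U / (3 * H)⌋₊ = k + 1 := by
    refine ⟨⌊U / (3 * H)⌋₊ - 1, ?_⟩
    have : 1 ≤ ⌊U / (3 * H)⌋₊ := by
      rw [Nat.one_le_floor_iff, le_div_iff₀ (by positivity)]
      linarith
    omega
  have hk1 : (k : ℝ) + 1 ≤ U / (3 * H) := by
    have := Nat.floor_le (by positivity : 0 ≤ U / (3 * H))
    rw [hk] at this
    push_cast at this
    exact this
  have hk2 : U / (3 * H) < (k : ℝ) + 2 := by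
    have := Nat.lt_floor_add_one (U / (3 * H))
    rw [hk] at this
    push_cast at this
    linarith
  obtain ⟨F, hF, hcard⟩ := exists_finset_of_integral_le (Z := fun u => riemannZeta (critPt u) = 0)
    hgc (fun t => by positivity) hH0 (by positivity : 0 < 4 * H ^ 2) (k := k)
    (by rw [mul_comm]; exact (le_div_iff₀ (by positivity)).mp hk1) hint hsq
  refine ⟨F, hF, le_trans ?_ hcard⟩
  have e1 : U / (3 * H) = 1 / 3 * (U / H) := by field_simp
  have e2 : 43200 * W ^ 2 * H * U / (4 * H ^ 2 * H) ≤ 1 / 12 * (U / H) := by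
    rw [div_le_iff₀ (by positivity)]
    have : 1 / 12 * (U / H) * (4 * H ^ 2 * H) = 1 / 3 * H * (H * U) := by field_simp; ring
    rw [this]
    have hHU : 0 ≤ H * U := by positivity
    nlinarith
  have e3 : 1 / (8 * H) * U = 1 / 8 * (U / H) := by field_simp
  rw [e3]
  linarith

end HardyLittlewood

/-- Hardy–Littlewood Theorem B: for fixed `1/2 < a < 1` there exist `K, T₀ > 0` such that
for every `T > T₀` the open interval `(T, T + T^a)` contains more than `K·T^a` zeros of
`t ↦ ζ(1/2 + i t)`. -/
theorem hardy_littlewood_theoremB (a : ℝ) (ha : 1/2 < a) (ha' : a < 1) :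
    ∃ K > (0:ℝ), ∃ T₀ > (0:ℝ), ∀ T > T₀,
      ∃ F : Finset ℝ,
        (∀ t ∈ F, t ∈ Set.Ioo T (T + T ^ a) ∧
          riemannZeta (1/2 + Complex.I * t) = 0) ∧
        K * T ^ a < (F.card : ℝ) := by
  set b := 1 / 2 + (a - 1 / 2) / 5 with hb
  have hb1 : 1 / 2 < b := by linarith
  have hb2 : b ≤ 3 / 5 := by linarith
  have hba : 0 < a - b := by linarith
  obtain ⟨K, hK, hev⟩ := HardyLittlewood.exists_zeros_of_le hb1 hb2
  obtain ⟨T₁, hT₁⟩ := eventually_atTop.mp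
    (hev.and ((tendsto_rpow_atTop hba).eventually_ge_atTop 8))
  refine ⟨K / 4, by positivity, max T₁ 1, by positivity, fun T hT => ?_⟩
  have hTT₁ : T₁ ≤ T := (le_max_left _ _).trans hT.le
  have hT1 : 1 ≤ T := (le_max_right _ _).trans hT.le
  have hT0 : 0 < T := by linarith
  set V := T ^ b with hV
  have hV0 : 0 < V := by positivity
  have hU : T ^ a = V * T ^ (a - b) := by rw [hV, ← Real.rpow_add hT0]; ring_nf
  have hVU : 8 * V ≤ T ^ a := by
    rw [hU, mul_comm 8]
    exact mul_le_mul_of_nonneg_left (hT₁ T hTT₁).2 hV0.le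
  have hUT : T ^ a ≤ T := by
    conv_rhs => rw [← Real.rpow_one T]
    exact Real.rpow_le_rpow_of_exponent_le hT1 ha'.le
  choose! F hF hFc using fun S (hS : T₁ ≤ S) => (hT₁ S hS).1
  set k := ⌊T ^ a / (2 * V)⌋₊ with hk
  have hk1 : 2 * V * k ≤ T ^ a := by
    have := Nat.floor_le (by positivity : 0 ≤ T ^ a / (2 * V))
    rw [le_div_iff₀ (by positivity)] at this
    linarith
  have hk2 : T ^ a < 2 * V * (k + 1) := by
    have := Nat.lt_floor_add_one (T ^ a / (2 * V))
    rw [div_lt_iff₀ (by positivity)] at this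
    linarith
  set x : ℕ → ℝ := fun j => T + 2 * V * j with hx
  have hxT : ∀ j, T ≤ x j := fun j => le_add_of_nonneg_right (by positivity)
  have hxk : ∀ j ∈ Finset.range k, x j + 2 * V ≤ T + T ^ a := fun j hj => by
    have : (j : ℝ) + 1 ≤ k := by exact_mod_cast Finset.mem_range.mp hj
    simp only [hx]
    nlinarith
  have hpow : ∀ j ∈ Finset.range k, x j ^ b ≤ 2 * V := fun j hj => by
    have h1 : x j ^ b ≤ (2 * T) ^ b :=
      Real.rpow_le_rpow (by linarith [hxT j]) (by linarith [hxk j hj]) (by linarith)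
    rw [Real.mul_rpow (by norm_num) hT0.le] at h1
    have h2 : (2 : ℝ) ^ b ≤ 2 := by
      conv_rhs => rw [← Real.rpow_one 2]
      exact Real.rpow_le_rpow_of_exponent_le (by norm_num) (by linarith)
    exact h1.trans (mul_le_mul_of_nonneg_right h2 hV0.le)
  have hmem : ∀ j ∈ Finset.range k, ∀ t ∈ F (x j), x j < t ∧ t < x j + 2 * V :=
    fun j hj t ht => by
      have := (hF (x j) (hTT₁.trans (hxT j)) t ht).1
      exact ⟨this.1, by linarith [this.2, hpow j hj]⟩
  refine ⟨(Finset.range k).biUnion fun j => F (x j), fun t ht => ?_, ?_⟩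
  · obtain ⟨j, hj, htj⟩ := Finset.mem_biUnion.mp ht
    have h1 := hmem j hj t htj
    refine ⟨⟨by linarith [hxT j], by linarith [hxk j hj]⟩, ?_⟩
    have h2 := (hF (x j) (hTT₁.trans (hxT j)) t htj).2
    rwa [HardyLittlewood.critPt, mul_comm] at h2
  · have hdis : ((Finset.range k : Finset ℕ) : Set ℕ).PairwiseDisjoint fun j => F (x j) := by
      intro i hi j hj hij
      refine Finset.disjoint_left.mpr fun t hti htj => ?_
      have h1 := hmem i hi t hti
      have h2 := hmem j hj t htj
      simp only [hx] at h1 h2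
      rcases lt_or_gt_of_ne hij with h | h
      · have : (i : ℝ) + 1 ≤ j := by exact_mod_cast h
        nlinarith
      · have : (j : ℝ) + 1 ≤ i := by exact_mod_cast h
        nlinarith
    rw [Finset.card_biUnion hdis]
    have h3 : (k : ℝ) * (K * V) ≤ ((∑ j ∈ Finset.range k, (F (x j)).card : ℕ) : ℝ) := by
      push_cast
      rw [← nsmul_eq_mul, ← Finset.card_range k, ← Finset.sum_const, Finset.card_range]
      refine Finset.sum_le_sum fun j _ => le_trans ?_ (hFc (x j) (hTT₁.trans (hxT j)))
      exact mul_le_mul_of_nonneg_left (Real.rpow_le_rpow hT0.le (hxT j) (by linarith)) hK.le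
    nlinarith [mul_lt_mul_of_pos_left hk2 hK, mul_le_mul_of_nonneg_left hVU hK.le]
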